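/- Let S₀ be a finite set and let H act on ℓ²(ℤ × S₀) as the sum of the adjacency Laplacian of the strip (Δ((n,s),(n',s')) = 1 if |n−n'| + dist(s,s') = 1, and 0 otherwise) and the diagonal potential V_{(n,s)} = λ f_s(θ + nω), where each f_s, s ∈ S₀, is a nonconstant real analytic function on 𝕋. Then there exists λ₀ = λ₀((f_s)) such that for every λ > λ₀ and every θ ∈ 𝕋, the operator H exhibits Anderson localization for Lebesgue-almost every frequency ω ∈ 𝕋. -/

import Mathlib

open MeasureTheory Filter

noncomputable section

/-- `ψ : ℤ × S₀ → ℂ` decays exponentially in the `ℤ`-direction of the strip. -/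
def ExpDecayStrip {S₀ : Type} (ψ : ℤ × S₀ → ℂ) : Prop :=
  ∃ C : ℝ, 0 < C ∧ ∃ α : ℝ, 0 < α ∧ ∀ n : ℤ, ∀ s : S₀,
    ‖ψ (n, s)‖ ≤ C * Real.exp (-α * |(n : ℝ)|)

/-- The eigenvalue equation on the strip `ℤ × S₀` for the operator `Δ + λ V`, where `Δ` is the
adjacency Laplacian of the strip (`Δ((n,s),(n',s')) = 1` iff `|n-n'| + dist(s,s') = 1`) and
`V(n,s) = λ f_s(θ + nω)`.  Since `|n-n'| ∈ ℤ`, the neighbors of `(n,s)` are exactly `(n±1, s)`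
and the points `(n,s')` with `dist(s,s') = 1`. -/
def StripEigenEq {S₀ : Type} [Fintype S₀] [MetricSpace S₀]
    (f : S₀ → ℝ → ℝ) (lam ω θ : ℝ) (ψ : ℤ × S₀ → ℂ) (E : ℝ) : Prop :=
  ∀ (n : ℤ) (s : S₀),
    ψ (n + 1, s) + ψ (n - 1, s)
      + (∑ s' : S₀, if dist s s' = 1 then ψ (n, s') else 0)
      + ((lam * f s (θ + (n : ℝ) * ω) : ℝ) : ℂ) * ψ (n, s) = (E : ℂ) * ψ (n, s)

section LinearAlgebra

open Matrix

theorem norm_det_le_prod_sum {n : Type*} [Fintype n] [DecidableEq n] (A : Matrix n n ℂ) :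
    ‖A.det‖ ≤ ∏ i, ∑ j, ‖A i j‖ := by
  rw [← det_transpose, det_apply']
  refine (norm_sum_le _ _).trans ?_
  rw [Finset.prod_univ_sum]
  have h1 : ∀ σ : Equiv.Perm n, ‖((Equiv.Perm.sign σ : ℤ) : ℂ) * ∏ i, Aᵀ (σ i) i‖
      = ∏ i, ‖A i (σ i)‖ := by
    intro σ
    rw [norm_mul, norm_prod]
    rcases Int.units_eq_one_or (Equiv.Perm.sign σ) with h | h <;> simp [h]
  simp_rw [h1]
  let e : Equiv.Perm n ↪ (n → n) := ⟨fun σ => σ, DFunLike.coe_injective⟩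
  have h2 : ∑ σ : Equiv.Perm n, ∏ i, ‖A i (σ i)‖
      = ∑ g ∈ Finset.univ.map e, ∏ i, ‖A i (g i)‖ := by
    rw [Finset.sum_map]; rfl
  rw [h2]
  refine Finset.sum_le_sum_of_subset_of_nonneg ?_ ?_
  · intro g _; simp
  · intro g _ _; exact Finset.prod_nonneg fun _ _ => norm_nonneg _

theorem norm_prod_sub_prod_le {ι : Type*} (s : Finset ι) (a b : ι → ℂ) {L δ : ℝ} (hL : 1 ≤ L)
    (ha : ∀ i, ‖a i‖ ≤ L) (hb : ∀ i, ‖b i‖ ≤ L) (hab : ∀ i, ‖a i - b i‖ ≤ δ) :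
    ‖∏ i ∈ s, a i - ∏ i ∈ s, b i‖ ≤ s.card * δ * L ^ s.card := by
  classical
  induction s using Finset.induction_on with
  | empty => simp
  | insert i s hi ih =>
    have hδ : 0 ≤ δ := (norm_nonneg _).trans (hab i)
    have hp : ‖∏ j ∈ s, b j‖ ≤ L ^ s.card := by
      rw [norm_prod]
      exact (Finset.prod_le_prod (fun _ _ => norm_nonneg _) (fun j _ => hb j)).trans (by simp)
    rw [Finset.prod_insert hi, Finset.prod_insert hi, Finset.card_insert_of_notMem hi]
    have : a i * ∏ j ∈ s, a j - b i * ∏ j ∈ s, b j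
        = a i * (∏ j ∈ s, a j - ∏ j ∈ s, b j) + (a i - b i) * ∏ j ∈ s, b j := by ring
    rw [this]
    refine (norm_add_le _ _).trans ?_
    rw [norm_mul, norm_mul]
    have h1 : ‖a i‖ * ‖∏ j ∈ s, a j - ∏ j ∈ s, b j‖ ≤ L * (s.card * δ * L ^ s.card) := by
      gcongr; exact ha i
    have h2 : ‖a i - b i‖ * ‖∏ j ∈ s, b j‖ ≤ δ * L ^ s.card := by
      gcongr; exact hab i
    have h3 : δ * L ^ s.card ≤ δ * (L * L ^ s.card) := by
      gcongr; exact le_mul_of_one_le_left (by positivity) hL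
    push_cast
    rw [pow_succ]
    nlinarith

theorem norm_det_sub_det_le {n : Type*} [Fintype n] [DecidableEq n] (A B : Matrix n n ℂ)
    {L δ : ℝ} (hL : 1 ≤ L) (hA : ∀ i j, ‖A i j‖ ≤ L) (hB : ∀ i j, ‖B i j‖ ≤ L)
    (hAB : ∀ i j, ‖A i j - B i j‖ ≤ δ) :
    ‖A.det - B.det‖ ≤
      (Fintype.card n).factorial * (Fintype.card n * δ * L ^ Fintype.card n) := by
  rw [det_apply', det_apply', ← Finset.sum_sub_distrib]
  refine (norm_sum_le _ _).trans ?_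
  have : ∀ σ ∈ (Finset.univ : Finset (Equiv.Perm n)),
      ‖((Equiv.Perm.sign σ : ℤ) : ℂ) * ∏ i, A (σ i) i
        - ((Equiv.Perm.sign σ : ℤ) : ℂ) * ∏ i, B (σ i) i‖
      ≤ Fintype.card n * δ * L ^ Fintype.card n := by
    intro σ _
    rw [← mul_sub, norm_mul]
    have h1 : ‖((Equiv.Perm.sign σ : ℤ) : ℂ)‖ = 1 := by
      rcases Int.units_eq_one_or (Equiv.Perm.sign σ) with h | h <;> simp [h]
    rw [h1, one_mul]
    exact norm_prod_sub_prod_le Finset.univ _ _ hL (fun i => hA _ _) (fun i => hB _ _)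
      (fun i => hAB _ _)
  refine (Finset.sum_le_sum this).trans ?_
  rw [Finset.sum_const, nsmul_eq_mul, Finset.card_univ, Fintype.card_perm]

theorem prod_half_norm_diag_le_norm_det {n : Type*} [Fintype n] [DecidableEq n]
    (A : Matrix n n ℂ) (hA : ∀ i, 0 < ‖A i i‖)
    (h : ∀ i, ∑ j ∈ Finset.univ.erase i, ‖A i j‖ ≤ ‖A i i‖ / 2) :
    ∏ i, (‖A i i‖ / 2) ≤ ‖A.det‖ := by
  have hdet : A.det ≠ 0 := by
    refine det_ne_zero_of_sum_row_lt_diag fun i => ?_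
    linarith [h i, hA i]
  -- rows of the inverse, weighted by the diagonal, have `ℓ¹` norm at most `2`
  have hu : IsUnit A.det := isUnit_iff_ne_zero.mpr hdet
  set X : Matrix n n ℂ := A⁻¹ * diagonal (fun i => A i i) with hX
  have hXA : A * X = diagonal (fun i => A i i) := by
    rw [hX, ← Matrix.mul_assoc, mul_nonsing_inv _ hu, Matrix.one_mul]
  have hrow : ∀ i, ∑ j, ‖X i j‖ ≤ 2 := by
    rcases isEmpty_or_nonempty n with he | hne
    · intro i; exact (he.false i).elim
    obtain ⟨k, -, hk⟩ := Finset.exists_max_image Finset.univ (fun i => ∑ j, ‖X i j‖)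
      Finset.univ_nonempty
    suffices hk2 : ∑ j, ‖X k j‖ ≤ 2 from fun i => (hk i (Finset.mem_univ i)).trans hk2
    set T := ∑ j, ‖X k j‖ with hT
    have h1 : ∀ j, ‖A k k‖ * ‖X k j‖ ≤ ‖(diagonal (fun i => A i i)) k j‖
        + ∑ l ∈ Finset.univ.erase k, ‖A k l‖ * ‖X l j‖ := by
      intro j
      have : A k k * X k j = (diagonal (fun i => A i i)) k j
          - ∑ l ∈ Finset.univ.erase k, A k l * X l j := by
        rw [← hXA, Matrix.mul_apply, ← Finset.add_sum_erase _ _ (Finset.mem_univ k)]; ring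
      rw [← norm_mul, this]
      refine (norm_sub_le _ _).trans ?_
      gcongr
      refine (norm_sum_le _ _).trans (le_of_eq ?_)
      simp
    have h2 : ‖A k k‖ * T ≤ ‖A k k‖ + ∑ l ∈ Finset.univ.erase k, ‖A k l‖ * T := by
      calc ‖A k k‖ * T = ∑ j, ‖A k k‖ * ‖X k j‖ := by rw [hT, Finset.mul_sum]
        _ ≤ ∑ j, (‖(diagonal (fun i => A i i)) k j‖
            + ∑ l ∈ Finset.univ.erase k, ‖A k l‖ * ‖X l j‖) :=
          Finset.sum_le_sum fun j _ => h1 j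
        _ = ‖A k k‖ + ∑ l ∈ Finset.univ.erase k, ‖A k l‖ * ∑ j, ‖X l j‖ := by
          rw [Finset.sum_add_distrib]
          congr 1
          · rw [Finset.sum_eq_single k]
            · simp
            · intro b _ hb; simp [diagonal_apply_ne _ hb.symm]
            · simp
          · rw [Finset.sum_comm]
            simp_rw [Finset.mul_sum]
        _ ≤ _ := by
          gcongr with l hl
          exact hk l (Finset.mem_univ l)
    rw [← Finset.sum_mul] at h2
    have hT0 : 0 ≤ T := Finset.sum_nonneg fun _ _ => norm_nonneg _
    have h3 := mul_le_mul_of_nonneg_right (h k) hT0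
    have h4 := hA k
    by_contra hc
    push Not at hc
    nlinarith
  have hdX : ‖X.det‖ ≤ 2 ^ Fintype.card n := by
    refine (norm_det_le_prod_sum X).trans ?_
    calc ∏ i, ∑ j, ‖X i j‖ ≤ ∏ _i : n, (2 : ℝ) :=
          Finset.prod_le_prod (fun _ _ => Finset.sum_nonneg fun _ _ => norm_nonneg _)
            (fun i _ => hrow i)
      _ = _ := by simp
  have hprod : ‖A.det‖ * ‖X.det‖ = ∏ i, ‖A i i‖ := by
    rw [← norm_mul, ← det_mul, hXA, det_diagonal, norm_prod]
  rw [Finset.prod_div_distrib, ← hprod, Finset.prod_const, Finset.card_univ,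
    div_le_iff₀ (by positivity)]
  gcongr

theorem Matrix.IsHermitian.exists_eigenvalue_near {n : Type*} [Fintype n] [DecidableEq n]
    {H : Matrix n n ℂ} (hH : H.IsHermitian) {E δ : ℝ} {v : n → ℂ} (hv : v ≠ 0)
    (h : ∑ i, ‖(H *ᵥ v) i - E * v i‖ ^ 2 ≤ δ ^ 2 * ∑ i, ‖v i‖ ^ 2) (hδ : 0 ≤ δ) :
    ∃ i, |hH.eigenvalues i - E| ≤ δ := by
  by_contra hc
  push Not at hc
  set b := hH.eigenvectorBasis with hb
  set x : EuclideanSpace ℂ n := WithLp.toLp 2 v with hx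
  set y : EuclideanSpace ℂ n := WithLp.toLp 2 (H *ᵥ v - (E : ℂ) • v) with hy
  have hcoef : ∀ i, inner ℂ (b i) y = ((hH.eigenvalues i - E : ℝ) : ℂ) * inner ℂ (b i) x := by
    intro i
    have h1 := hH.mulVec_eigenvectorBasis i
    simp only [EuclideanSpace.inner_eq_star_dotProduct, hy, hx]
    have h2 : (H *ᵥ v) ⬝ᵥ star (b i).ofLp = (hH.eigenvalues i : ℂ) * (v ⬝ᵥ star (b i).ofLp) := by
      rw [dotProduct_comm, dotProduct_mulVec, ← star_star (star (b i).ofLp ᵥ* H), star_vecMul,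
        star_star, hH.eq, h1, star_smul, smul_dotProduct, dotProduct_comm]
      simp [hb]
    rw [sub_dotProduct, smul_dotProduct, h2]
    push_cast
    simp only [smul_eq_mul]; ring
  have hy2 : ‖y‖ ^ 2 = ∑ i, (hH.eigenvalues i - E) ^ 2 * ‖inner ℂ (b i) x‖ ^ 2 := by
    rw [← b.sum_sq_norm_inner_right y]
    refine Finset.sum_congr rfl fun i _ => ?_
    rw [hcoef, norm_mul, mul_pow, Complex.norm_real, Real.norm_eq_abs, sq_abs]
  have hx2 : ‖x‖ ^ 2 = ∑ i, ‖inner ℂ (b i) x‖ ^ 2 := (b.sum_sq_norm_inner_right x).symm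
  have hlt : δ ^ 2 * ‖x‖ ^ 2 < ‖y‖ ^ 2 := by
    rw [hy2, hx2, Finset.mul_sum]
    have hx0 : x ≠ 0 := by
      intro h0; apply hv
      have := congrArg WithLp.ofLp h0
      simpa [hx] using this
    obtain ⟨i, hi⟩ : ∃ i, inner ℂ (b i) x ≠ 0 := by
      by_contra hall
      push Not at hall
      have : ‖x‖ ^ 2 = 0 := by rw [hx2]; simp [hall]
      exact hx0 (by simpa using this)
    refine Finset.sum_lt_sum (fun j _ => ?_) ⟨i, Finset.mem_univ i, ?_⟩
    · refine mul_le_mul_of_nonneg_right ?_ (by positivity)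
      rw [← sq_abs (hH.eigenvalues j - E)]
      gcongr; exact (hc j).le
    · have : 0 < ‖inner ℂ (b i) x‖ ^ 2 := by positivity
      refine mul_lt_mul_of_pos_right ?_ this
      rw [← sq_abs (hH.eigenvalues i - E)]
      have := hc i
      gcongr
  rw [EuclideanSpace.norm_sq_eq, EuclideanSpace.norm_sq_eq] at hlt
  refine absurd h (not_le.mpr ?_)
  simpa [hx, hy] using hlt

end LinearAlgebra

section StripMatrix

open Matrix

variable {S : Type} [Fintype S] [MetricSpace S] [DecidableEq S]

/-- The hopping part of the restriction of the strip operator to `N` consecutive columns. -/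
def stripHop (S : Type) [MetricSpace S] [DecidableEq S] (N : ℕ) :
    Matrix (Fin N × S) (Fin N × S) ℂ := fun p q =>
  (if p.2 = q.2 then (if (p.1 : ℕ) + 1 = q.1 then 1 else 0) + (if (q.1 : ℕ) + 1 = p.1 then 1 else 0)
    else 0) + (if p.1 = q.1 then (if dist p.2 q.2 = 1 then 1 else 0) else 0)

/-- The restriction of `Δ + v` to `N` consecutive columns of the strip. -/
def stripMat (N : ℕ) (v : ℕ → S → ℂ) : Matrix (Fin N × S) (Fin N × S) ℂ :=
  stripHop S N + diagonal fun p => v p.1 p.2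

theorem stripHop_self (N : ℕ) (p : Fin N × S) : stripHop S N p p = 0 := by
  simp [stripHop]

theorem stripMat_self (N : ℕ) (v : ℕ → S → ℂ) (p : Fin N × S) :
    stripMat N v p p = v p.1 p.2 := by
  simp [stripMat, stripHop_self]

theorem stripMat_of_ne {N : ℕ} (v : ℕ → S → ℂ) {p q : Fin N × S} (h : p ≠ q) :
    stripMat N v p q = stripHop S N p q := by
  simp [stripMat, h]

theorem stripMat_sub_smul_one (N : ℕ) (v : ℕ → S → ℂ) (E : ℂ) :
    stripMat N v - E • (1 : Matrix (Fin N × S) (Fin N × S) ℂ)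
      = stripMat N (fun i s => v i s - E) := by
  ext p q
  rcases eq_or_ne p q with rfl | h
  · simp [stripMat_self]
  · simp [stripMat_of_ne _ h, h]

theorem stripMat_isHermitian (N : ℕ) (v : ℕ → S → ℝ) :
    (stripMat N (fun i s => (v i s : ℂ))).IsHermitian := by
  refine Matrix.IsHermitian.ext fun p q => ?_
  rcases eq_or_ne p q with rfl | h
  · simp [stripMat_self]
  · rw [stripMat_of_ne _ h, stripMat_of_ne _ h.symm]
    simp only [stripHop, dist_comm q.2 p.2, eq_comm (a := q.2), eq_comm (a := q.1)]
    split_ifs <;> simp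

theorem sum_fin_ite_add_one (N p : ℕ) (g : ℕ → ℂ) :
    ∑ i : Fin N, (if p + 1 = (i : ℕ) then g i else 0) = if p + 1 < N then g (p + 1) else 0 := by
  rw [Fin.sum_univ_eq_sum_range (fun i => if p + 1 = i then g i else 0) N, Finset.sum_ite_eq]
  simp

theorem sum_fin_ite_sub_one (N p : ℕ) (hp : p < N) (g : ℕ → ℂ) :
    ∑ i : Fin N, (if (i : ℕ) + 1 = p then g i else 0) = if 0 < p then g (p - 1) else 0 := by
  rw [Fin.sum_univ_eq_sum_range (fun i => if i + 1 = p then g i else 0) N]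
  rcases Nat.eq_zero_or_pos p with rfl | h0
  · simp
  · rw [if_pos h0]
    obtain ⟨k, rfl⟩ : ∃ k, p = k + 1 := ⟨p - 1, by omega⟩
    simp only [Nat.add_right_cancel_iff, Finset.sum_ite_eq', Finset.mem_range, Nat.add_sub_cancel]
    rw [if_pos (by omega)]

theorem stripHop_mulVec (N : ℕ) (g : ℕ → S → ℂ) (p : Fin N × S) :
    (stripHop S N *ᵥ fun q => g q.1 q.2) p
      = (if (p.1 : ℕ) + 1 < N then g (p.1 + 1) p.2 else 0)
        + (if 0 < (p.1 : ℕ) then g (p.1 - 1) p.2 else 0)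
        + ∑ s, if dist p.2 s = 1 then g p.1 s else 0 := by
  rw [mulVec, dotProduct, Fintype.sum_prod_type]
  have : ∀ i : Fin N, ∑ s, stripHop S N p (i, s) * g i s
      = (if (p.1 : ℕ) + 1 = i then g i p.2 else 0) + (if (i : ℕ) + 1 = p.1 then g i p.2 else 0)
        + (if p.1 = i then ∑ s, (if dist p.2 s = 1 then g i s else 0) else 0) := by
    intro i
    simp only [stripHop, add_mul, Finset.sum_add_distrib, ite_mul, zero_mul, one_mul]
    simp only [Finset.sum_ite_eq, Finset.mem_univ, if_true]
    congr 1
    split_ifs <;> simp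
  rw [Finset.sum_congr rfl fun i _ => this i]
  rw [Finset.sum_add_distrib, Finset.sum_add_distrib,
    sum_fin_ite_add_one N p.1 (fun i => g i p.2),
    sum_fin_ite_sub_one N p.1 p.1.2 (fun i => g i p.2), Finset.sum_ite_eq]
  simp

/-- Row sums of the conjugated hopping matrix. -/
theorem sum_norm_conj_stripHop_le (N : ℕ) {μ lam : ℝ} (hμ : 0 < μ) (h1 : μ ≤ lam) (h2 : μ⁻¹ ≤ lam)
    (p : Fin N × S) :
    ∑ q : Fin N × S, μ ^ (p.1 : ℕ) * ‖stripHop S N p q‖ * (μ ^ (q.1 : ℕ))⁻¹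
      ≤ 2 * lam + Fintype.card S := by
  have key := stripHop_mulVec N (fun i (_ : S) => ((μ ^ (p.1 : ℕ) * (μ ^ i)⁻¹ : ℝ) : ℂ)) p
  have hn : ∀ q : Fin N × S, stripHop S N p q = (‖stripHop S N p q‖ : ℝ) := by
    intro q
    simp only [stripHop]
    split_ifs <;> norm_num
  have hL : (stripHop S N *ᵥ fun q => ((μ ^ (p.1 : ℕ) * (μ ^ (q.1 : ℕ))⁻¹ : ℝ) : ℂ)) p
      = ((∑ q : Fin N × S, μ ^ (p.1 : ℕ) * ‖stripHop S N p q‖ * (μ ^ (q.1 : ℕ))⁻¹ : ℝ) : ℂ) := by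
    rw [mulVec, dotProduct, Complex.ofReal_sum]
    refine Finset.sum_congr rfl fun q _ => ?_
    conv_lhs => rw [hn q]
    push_cast; ring
  rw [hL] at key
  have h3 : (∑ s, if dist p.2 s = 1 then ((μ ^ (p.1 : ℕ) * (μ ^ (p.1 : ℕ))⁻¹ : ℝ) : ℂ) else 0)
      = ((∑ s : S, if dist p.2 s = 1 then (1 : ℝ) else 0 : ℝ) : ℂ) := by
    rw [mul_inv_cancel₀ (by positivity)]
    rw [Complex.ofReal_sum]
    exact Finset.sum_congr rfl fun s _ => by split_ifs <;> simp
  have h4 : (∑ s : S, if dist p.2 s = 1 then (1 : ℝ) else 0) ≤ Fintype.card S := by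
    calc (∑ s : S, if dist p.2 s = 1 then (1 : ℝ) else 0) ≤ ∑ _s : S, (1 : ℝ) :=
          Finset.sum_le_sum fun s _ => by split_ifs <;> norm_num
      _ = _ := by simp
  have h5 : ((if (p.1 : ℕ) + 1 < N then ((μ ^ (p.1 : ℕ) * (μ ^ ((p.1 : ℕ) + 1))⁻¹ : ℝ) : ℂ) else 0))
      = ((if (p.1 : ℕ) + 1 < N then μ⁻¹ else 0 : ℝ) : ℂ) := by
    have : μ ^ (p.1 : ℕ) * (μ ^ ((p.1 : ℕ) + 1))⁻¹ = μ⁻¹ := by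
      rw [pow_succ]; field_simp
    rw [this]; split_ifs <;> simp
  have h6 : ((if 0 < (p.1 : ℕ) then ((μ ^ (p.1 : ℕ) * (μ ^ ((p.1 : ℕ) - 1))⁻¹ : ℝ) : ℂ) else 0))
      = ((if 0 < (p.1 : ℕ) then μ else 0 : ℝ) : ℂ) := by
    split_ifs with h
    · congr 1
      obtain ⟨k, hk⟩ : ∃ k, (p.1 : ℕ) = k + 1 := ⟨p.1 - 1, by omega⟩
      rw [hk, Nat.add_sub_cancel, pow_succ]; field_simp
    · simp
  rw [h3, h5, h6] at key
  norm_cast at key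
  rw [key]
  have a1 : (if (p.1 : ℕ) + 1 < N then μ⁻¹ else 0) ≤ lam := by split_ifs <;> linarith
  have a2 : (if 0 < (p.1 : ℕ) then μ else 0) ≤ lam := by split_ifs <;> linarith
  push_cast at h4 ⊢
  linarith

theorem sum_norm_stripHop_le (N : ℕ) (p : Fin N × S) :
    ∑ q : Fin N × S, ‖stripHop S N p q‖ ≤ 2 + Fintype.card S := by
  simpa using sum_norm_conj_stripHop_le (S := S) N one_pos (le_refl (1 : ℝ)) (by simp) p

theorem norm_stripHop_le (N : ℕ) (p q : Fin N × S) : ‖stripHop S N p q‖ ≤ 2 + Fintype.card S :=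
  (Finset.single_le_sum (f := fun q => ‖stripHop S N p q‖) (fun _ _ => norm_nonneg _)
    (Finset.mem_univ q)).trans (sum_norm_stripHop_le N p)

theorem norm_stripMat_le (N : ℕ) (v : ℕ → S → ℂ) {V : ℝ} (hv : ∀ i s, ‖v i s‖ ≤ V)
    (p q : Fin N × S) : ‖stripMat N v p q‖ ≤ V + 2 + Fintype.card S := by
  rw [stripMat, Matrix.add_apply]
  refine (norm_add_le _ _).trans ?_
  have h1 := norm_stripHop_le N p q
  have h2 : ‖diagonal (fun p : Fin N × S => v p.1 p.2) p q‖ ≤ V := by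
    rcases eq_or_ne p q with rfl | h
    · simpa using hv _ _
    · simpa [h] using (norm_nonneg _).trans (hv p.1 p.2)
  linarith

theorem norm_det_stripMat_le (N : ℕ) (v : ℕ → S → ℂ) {V : ℝ} (hv : ∀ i s, ‖v i s‖ ≤ V) :
    ‖(stripMat N v).det‖ ≤ (V + 2 + Fintype.card S) ^ (N * Fintype.card S) := by
  refine (norm_det_le_prod_sum _).trans ?_
  calc ∏ p, ∑ q, ‖stripMat N v p q‖ ≤ ∏ _p : Fin N × S, (V + 2 + Fintype.card S) := by
        refine Finset.prod_le_prod (fun _ _ => Finset.sum_nonneg fun _ _ => norm_nonneg _)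
          fun p _ => ?_
        calc ∑ q, ‖stripMat N v p q‖
            ≤ ∑ q, (‖stripHop S N p q‖ + ‖diagonal (fun p : Fin N × S => v p.1 p.2) p q‖) :=
              Finset.sum_le_sum fun q _ => norm_add_le _ _
          _ ≤ _ := by
              rw [Finset.sum_add_distrib]
              have : ∑ q, ‖diagonal (fun p : Fin N × S => v p.1 p.2) p q‖ = ‖v p.1 p.2‖ := by
                rw [Finset.sum_eq_single p]
                · simp
                · intro b _ hb; simp [hb.symm]
                · simp
              rw [this]
              linarith [hv p.1 p.2, sum_norm_stripHop_le N p]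
    _ = _ := by simp

theorem le_norm_det_stripMat (N : ℕ) (v : ℕ → S → ℂ) {ε : ℝ} (hv : ∀ i s, ε ≤ ‖v i s‖)
    (hε : 2 * (2 + Fintype.card S) ≤ ε) :
    (ε / 2) ^ (N * Fintype.card S) ≤ ‖(stripMat N v).det‖ := by
  have hε0 : 0 < ε := by
    have : (0 : ℝ) ≤ Fintype.card S := by positivity
    linarith
  refine le_trans ?_ (prod_half_norm_diag_le_norm_det _ ?_ ?_)
  · calc (ε / 2) ^ (N * Fintype.card S) = ∏ _p : Fin N × S, (ε / 2) := by
          rw [Finset.prod_const, Finset.card_univ, Fintype.card_prod, Fintype.card_fin]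
      _ ≤ _ := by
        refine Finset.prod_le_prod (fun _ _ => by positivity) fun p _ => ?_
        rw [stripMat_self]; linarith [hv p.1 p.2]
  · intro p; rw [stripMat_self]; linarith [hv p.1 p.2]
  · intro p
    rw [stripMat_self]
    have : ∑ q ∈ Finset.univ.erase p, ‖stripMat N v p q‖
        = ∑ q ∈ Finset.univ.erase p, ‖stripHop S N p q‖ :=
      Finset.sum_congr rfl fun q hq => by
        rw [stripMat_of_ne _ (Finset.ne_of_mem_erase hq).symm]
    rw [this]
    have h1 := Finset.sum_le_sum_of_subset_of_nonneg (Finset.erase_subset p Finset.univ)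
      (f := fun q => ‖stripHop S N p q‖) (fun _ _ _ => norm_nonneg _)
    linarith [hv p.1 p.2, sum_norm_stripHop_le N p]

theorem norm_adjugate_stripMat_le_aux (N : ℕ) (v : ℕ → S → ℂ) {V lam μ : ℝ} (hl : 1 ≤ lam)
    (hv : ∀ i s, ‖v i s‖ ≤ V) (hμ : 0 < μ) (h1 : μ ≤ lam) (h2 : μ⁻¹ ≤ lam) (p q : Fin N × S) :
    ‖(stripMat N v).adjugate p q‖
      ≤ μ ^ (q.1 : ℕ) * (μ ^ (p.1 : ℕ))⁻¹ * (V + 2 * lam + Fintype.card S) ^ (N * Fintype.card S) := by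
  have hV : 0 ≤ V := (norm_nonneg _).trans (hv q.1 q.2)
  set B := V + 2 * lam + Fintype.card S with hB
  have hB1 : 1 ≤ B := by
    have : (0 : ℝ) ≤ Fintype.card S := by positivity
    linarith
  set M := (stripMat N v).updateRow q (Pi.single p 1) with hM
  set Wl : Matrix (Fin N × S) (Fin N × S) ℂ := diagonal fun i => ((μ ^ (i.1 : ℕ) : ℝ) : ℂ) with hWl
  set Wr : Matrix (Fin N × S) (Fin N × S) ℂ := diagonal fun i => (((μ ^ (i.1 : ℕ))⁻¹ : ℝ) : ℂ)
    with hWr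
  have hdet : (Wl * M * Wr).det = M.det := by
    have : Wl.det * Wr.det = 1 := by
      rw [← det_mul, hWl, hWr, diagonal_mul_diagonal]
      have h1 : ∀ i : Fin N × S, ((μ ^ (i.1 : ℕ) : ℝ) : ℂ) * (((μ ^ (i.1 : ℕ))⁻¹ : ℝ) : ℂ) = 1 := by
        intro i
        rw [← Complex.ofReal_mul, mul_inv_cancel₀ (by positivity), Complex.ofReal_one]
      simp_rw [h1]
      rw [diagonal_one, det_one]
    rw [det_mul, det_mul]
    linear_combination M.det * this
  rw [adjugate_apply, ← hM, ← hdet]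
  refine (norm_det_le_prod_sum _).trans ?_
  have hent : ∀ i j, ‖(Wl * M * Wr) i j‖ = μ ^ (i.1 : ℕ) * ‖M i j‖ * (μ ^ (j.1 : ℕ))⁻¹ := by
    intro i j
    rw [hWl, hWr, mul_diagonal, diagonal_mul, norm_mul, norm_mul, Complex.norm_real,
      Complex.norm_real, Real.norm_of_nonneg (by positivity), Real.norm_of_nonneg (by positivity)]
  simp_rw [hent]
  have hrow : ∀ i, i ≠ q → ∑ j, μ ^ (i.1 : ℕ) * ‖M i j‖ * (μ ^ (j.1 : ℕ))⁻¹ ≤ B := by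
    intro i hi
    have h3 : ∀ j, μ ^ (i.1 : ℕ) * ‖M i j‖ * (μ ^ (j.1 : ℕ))⁻¹
        ≤ μ ^ (i.1 : ℕ) * ‖stripHop S N i j‖ * (μ ^ (j.1 : ℕ))⁻¹ + (if i = j then V else 0) := by
      intro j
      rw [hM, updateRow_ne hi]
      rcases eq_or_ne i j with rfl | hij
      · rw [stripMat_self, stripHop_self, if_pos rfl, norm_zero, mul_zero, zero_mul, zero_add,
          mul_right_comm, mul_inv_cancel₀ (by positivity), one_mul]
        exact hv _ _
      · rw [stripMat_of_ne _ hij, if_neg hij, add_zero]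
    refine (Finset.sum_le_sum fun j _ => h3 j).trans ?_
    rw [Finset.sum_add_distrib, Finset.sum_ite_eq, if_pos (Finset.mem_univ _)]
    have := sum_norm_conj_stripHop_le N hμ h1 h2 i
    linarith
  have hrowq : ∑ j, μ ^ (q.1 : ℕ) * ‖M q j‖ * (μ ^ (j.1 : ℕ))⁻¹
      = μ ^ (q.1 : ℕ) * (μ ^ (p.1 : ℕ))⁻¹ := by
    rw [Finset.sum_eq_single p]
    · simp [hM]
    · intro b _ hb; simp [hM, hb]
    · simp
  rw [← Finset.mul_prod_erase _ _ (Finset.mem_univ q), hrowq]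
  gcongr
  calc ∏ i ∈ Finset.univ.erase q, ∑ j, μ ^ (i.1 : ℕ) * ‖M i j‖ * (μ ^ (j.1 : ℕ))⁻¹
      ≤ ∏ i ∈ Finset.univ.erase q, B :=
        Finset.prod_le_prod (fun i _ => Finset.sum_nonneg fun j _ => by positivity)
          fun i hi => hrow i (Finset.ne_of_mem_erase hi)
    _ ≤ B ^ (N * Fintype.card S) := by
        rw [Finset.prod_const]
        refine pow_le_pow_right₀ hB1 ?_
        refine (Finset.card_le_card (Finset.erase_subset _ _)).trans ?_
        simp

theorem norm_adjugate_stripMat_le (N : ℕ) (v : ℕ → S → ℂ) {V lam : ℝ} (hl : 1 ≤ lam)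
    (hv : ∀ i s, ‖v i s‖ ≤ V) (p q : Fin N × S) {k : ℕ}
    (hk : (p.1 : ℕ) + k ≤ q.1 ∨ (q.1 : ℕ) + k ≤ p.1) :
    ‖(stripMat N v).adjugate p q‖
      ≤ (lam ^ k)⁻¹ * (V + 2 * lam + Fintype.card S) ^ (N * Fintype.card S) := by
  have hV : 0 ≤ V := (norm_nonneg _).trans (hv q.1 q.2)
  have hl0 : 0 < lam := by linarith
  have hB : 0 ≤ V + 2 * lam + Fintype.card S := by positivity
  rcases hk with hk | hk
  · refine (norm_adjugate_stripMat_le_aux N v hl hv (μ := lam⁻¹) (by positivity)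
      ((inv_le_one_of_one_le₀ hl).trans hl) (by simp) p q).trans ?_
    gcongr
    rw [inv_pow, inv_pow, inv_inv, inv_mul_le_iff₀ (by positivity), ← div_eq_mul_inv,
      le_div_iff₀ (by positivity), ← pow_add]
    exact pow_le_pow_right₀ hl hk
  · refine (norm_adjugate_stripMat_le_aux N v hl hv (μ := lam) (by positivity) le_rfl
      ((inv_le_one_of_one_le₀ hl).trans hl) p q).trans ?_
    gcongr
    rw [mul_inv_le_iff₀ (by positivity), ← div_eq_inv_mul, le_div_iff₀ (by positivity), ← pow_add]
    exact pow_le_pow_right₀ hl hk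

theorem stripMat_mulVec_of_eq (N : ℕ) (v : ℤ → S → ℂ) (ψ : ℤ → S → ℂ) (A : ℤ)
    (h : ∀ n s, ψ (n + 1) s + ψ (n - 1) s + (∑ s', if dist s s' = 1 then ψ n s' else 0)
      + v n s * ψ n s = 0) (p : Fin N × S) :
    (stripMat N (fun i => v (A + i)) *ᵥ fun q => ψ (A + (q.1 : ℕ)) q.2) p
      = -((if (p.1 : ℕ) = 0 then ψ (A - 1) p.2 else 0)
          + if (p.1 : ℕ) + 1 = N then ψ (A + N) p.2 else 0) := by
  have h1 := h (A + (p.1 : ℕ)) p.2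
  rw [stripMat, add_mulVec, Pi.add_apply, mulVec_diagonal,
    stripHop_mulVec N (fun i s => ψ (A + i) s) p]
  have hp := p.1.2
  have e1 : ψ (A + (p.1 : ℕ) + 1) p.2 = (if (p.1 : ℕ) + 1 < N then ψ (A + ((p.1 + 1 : ℕ) : ℤ)) p.2
      else 0) + if (p.1 : ℕ) + 1 = N then ψ (A + N) p.2 else 0 := by
    rcases (Nat.succ_le_of_lt hp).lt_or_eq with h2 | h2
    · rw [if_pos h2, if_neg (by omega), add_zero]; push_cast; rw [add_assoc]
    · have h2' : (p.1 : ℕ) + 1 = N := h2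
      rw [if_neg (by omega), if_pos h2', zero_add, show A + ((p.1 : ℕ) : ℤ) + 1 = A + N by omega]
  have e2 : ψ (A + (p.1 : ℕ) - 1) p.2 = (if 0 < (p.1 : ℕ) then ψ (A + ((p.1 - 1 : ℕ) : ℤ)) p.2
      else 0) + if (p.1 : ℕ) = 0 then ψ (A - 1) p.2 else 0 := by
    rcases Nat.eq_zero_or_pos (p.1 : ℕ) with h2 | h2
    · rw [if_neg (by omega), if_pos h2, h2]; simp
    · rw [if_pos h2, if_neg (by omega), add_zero]
      congr 1; push_cast [h2]; ring
  rw [e1, e2] at h1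
  linear_combination h1

theorem norm_mul_norm_det_le_of_mulVec {n : Type*} [Fintype n] [DecidableEq n] (M : Matrix n n ℂ)
    (φ r : n → ℂ) (h : M *ᵥ φ = r) (p : n) :
    ‖φ p‖ * ‖M.det‖ ≤ ∑ q, ‖M.adjugate p q‖ * ‖r q‖ := by
  have h1 : M.det • φ = M.adjugate *ᵥ r := by
    rw [← h, mulVec_mulVec, adjugate_mul, smul_mulVec, one_mulVec]
  have h2 := congrFun h1 p
  rw [Pi.smul_apply, smul_eq_mul] at h2
  rw [mul_comm, ← norm_mul, h2, mulVec, dotProduct]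
  exact (norm_sum_le _ _).trans (Finset.sum_le_sum fun q _ => (norm_mul _ _).le)

end StripMatrix

section GreenDecay

variable {S : Type} [Fintype S] [MetricSpace S] [DecidableEq S]

theorem norm_mul_le_of_strip_window (N : ℕ) (v : ℤ → S → ℂ) (ψ : ℤ → S → ℂ) (A : ℤ)
    {V lam κ : ℝ} (hl : 1 ≤ lam) (hv : ∀ n s, ‖v n s‖ ≤ V)
    (h : ∀ n s, ψ (n + 1) s + ψ (n - 1) s + (∑ s', if dist s s' = 1 then ψ n s' else 0)
      + v n s * ψ n s = 0)
    (hκ : κ ≤ ‖(stripMat N (fun i => v (A + i))).det‖) {c k : ℕ} (hck : k ≤ c) (hcN : c + k + 1 ≤ N) :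
    ‖ψ (A + c)‖ * κ ≤ Fintype.card S * (lam ^ k)⁻¹
      * (V + 2 * lam + Fintype.card S) ^ (N * Fintype.card S) * (‖ψ (A - 1)‖ + ‖ψ (A + N)‖) := by
  rcases isEmpty_or_nonempty S with hS | ⟨⟨s0⟩⟩
  · have : ∀ n, ψ n = 0 := fun n => Subsingleton.elim _ _
    simp [this]
  have hV : 0 ≤ V := (norm_nonneg _).trans (hv 0 s0)
  set B := (V + 2 * lam + Fintype.card S) ^ (N * Fintype.card S) with hB
  have hB0 : 0 ≤ B := by positivity
  set G := (lam ^ k)⁻¹ * B with hG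
  have hG0 : 0 ≤ G := by positivity
  have hs : ∀ s, ‖ψ (A + c) s‖ * κ ≤ Fintype.card S * G * (‖ψ (A - 1)‖ + ‖ψ (A + N)‖) := by
    intro s
    set p : Fin N × S := (⟨c, by omega⟩, s)
    have h1 := norm_mul_norm_det_le_of_mulVec (stripMat N (fun i => v (A + i)))
      (fun q => ψ (A + (q.1 : ℕ)) q.2) _ rfl p
    have h2 : ∀ q : Fin N × S, ‖(stripMat N fun i => v (A + i)).adjugate p q‖
        * ‖((stripMat N fun i => v (A + i)).mulVec fun q => ψ (A + (q.1 : ℕ)) q.2) q‖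
        ≤ (if (q.1 : ℕ) = 0 then G * ‖ψ (A - 1)‖ else 0)
          + (if (q.1 : ℕ) + 1 = N then G * ‖ψ (A + N)‖ else 0) := by
      intro q
      rw [stripMat_mulVec_of_eq N v ψ A h q, norm_neg]
      have hadj : (q.1 : ℕ) = 0 ∨ (q.1 : ℕ) + 1 = N →
          ‖(stripMat N fun i => v (A + i)).adjugate p q‖ ≤ G := by
        intro hq
        refine norm_adjugate_stripMat_le N _ hl (fun i s => hv _ _) p q (k := k) ?_
        rcases hq with hq | hq
        · right; rw [hq]; simpa [p] using hck
        · left; simp only [p]; omega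
      have n1 := norm_le_pi_norm (ψ (A - 1)) q.2
      have n2 := norm_le_pi_norm (ψ (A + N)) q.2
      have t := norm_nonneg ((stripMat N fun i => v (A + i)).adjugate p q)
      have t1 := norm_nonneg (ψ (A - 1))
      have t2 := norm_nonneg (ψ (A + N))
      split_ifs with c1 c2 c2
      · have ha := hadj (Or.inl c1)
        rw [← mul_add]
        exact mul_le_mul ha ((norm_add_le _ _).trans (add_le_add n1 n2)) (norm_nonneg _) hG0
      · have ha := hadj (Or.inl c1)
        rw [add_zero, add_zero]
        exact mul_le_mul ha n1 (norm_nonneg _) hG0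
      · have ha := hadj (Or.inr c2)
        rw [zero_add, zero_add]
        exact mul_le_mul ha n2 (norm_nonneg _) hG0
      · simp
    have h3 : ∀ (a : ℕ) (x : ℝ), 0 ≤ x →
        ∑ q : Fin N × S, (if (q.1 : ℕ) = a then x else 0) ≤ Fintype.card S * x := by
      intro a x hx
      rw [Fintype.sum_prod_type_right]
      have : ∀ s : S, ∑ i : Fin N, (if (i : ℕ) = a then x else 0) ≤ x := by
        intro s
        rw [Fin.sum_univ_eq_sum_range (fun i => if i = a then x else 0) N, Finset.sum_ite_eq']
        split_ifs <;> simp [hx]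
      refine (Finset.sum_le_sum fun s _ => this s).trans ?_
      simp
    have h4 : ∀ q : Fin N × S, ((q.1 : ℕ) + 1 = N) = ((q.1 : ℕ) = N - 1) := by
      intro q; have := q.1.2; apply propext; omega
    refine (mul_le_mul_of_nonneg_left hκ (norm_nonneg _)).trans (h1.trans ?_)
    refine (Finset.sum_le_sum fun q _ => h2 q).trans ?_
    simp_rw [h4]
    rw [Finset.sum_add_distrib]
    refine (add_le_add (h3 0 _ (by positivity)) (h3 (N - 1) _ (by positivity))).trans (le_of_eq ?_)
    ring
  have hR : 0 ≤ Fintype.card S * G * (‖ψ (A - 1)‖ + ‖ψ (A + N)‖) := by positivity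
  rw [show (Fintype.card S : ℝ) * (lam ^ k)⁻¹ * B = Fintype.card S * G by rw [hG]; ring]
  rcases le_or_gt κ 0 with h0 | h0
  · exact (mul_nonpos_of_nonneg_of_nonpos (norm_nonneg _) h0).trans hR
  · rw [← le_div_iff₀ h0]
    exact (pi_norm_le_iff_of_nonneg (by positivity)).2 fun s => (le_div_iff₀ h0).2 (hs s)

/-- If one of the windows of length `8ν` starting at a point of `[n-4ν, n-2ν)` has a determinant
of the typical size, then a solution decays at `n`. -/
theorem exists_decay_of_good_window {ν : ℕ} (hν : 1 ≤ ν) (v : ℤ → S → ℂ) (ψ : ℤ → S → ℂ)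
    {lam C2 C4 : ℝ} (hl : 1 ≤ lam) (hC2 : 0 ≤ C2) (hC4 : 1 ≤ C4)
    (hv : ∀ n s, ‖v n s‖ + 2 * lam + Fintype.card S ≤ C2 * lam)
    (hlam : (16 * Fintype.card S + 1) * (Real.exp 1 * (C2 ^ Fintype.card S * C4)) ^ 8 ≤ lam ^ 2)
    (h : ∀ n s, ψ (n + 1) s + ψ (n - 1) s + (∑ s', if dist s s' = 1 then ψ n s' else 0)
      + v n s * ψ n s = 0) (n : ℤ)
    (hgood : ∃ a < 2 * ν, (lam ^ Fintype.card S / C4) ^ (8 * ν) / 8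
      ≤ ‖(stripMat (8 * ν) (fun i => v (n - 4 * ν + a + i))).det‖) :
    ∃ n1 n2 : ℤ, |n1 - n| ≤ 8 * ν ∧ |n2 - n| ≤ 8 * ν ∧
      ‖ψ n‖ ≤ Real.exp (-(8 * ν)) * max ‖ψ n1‖ ‖ψ n2‖ := by
  obtain ⟨a, ha, hdet⟩ := hgood
  refine ⟨n - 4 * ν + a - 1, n - 4 * ν + a + (8 * ν : ℕ), ?_, ?_, ?_⟩
  · rw [abs_le]; omega
  · rw [abs_le]; push_cast; omega
  have hl0 : 0 < lam := by linarith
  set d := Fintype.card S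
  have h1 := norm_mul_le_of_strip_window (8 * ν) v ψ (n - 4 * ν + a) hl (V := C2 * lam - 2 * lam - d)
    (fun n s => by linarith [hv n s]) h hdet (c := 4 * ν - a) (k := 2 * ν) (by omega) (by omega)
  rw [show n - 4 * ν + a + ((4 * ν - a : ℕ) : ℤ) = n by push_cast [show a ≤ 4 * ν by omega]; ring] at h1
  set X := ‖ψ (n - 4 * ν + a - 1)‖
  set Y := ‖ψ (n - 4 * ν + a + (8 * ν : ℕ))‖
  have hXY : X + Y ≤ 2 * max X Y := by linarith [le_max_left X Y, le_max_right X Y]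
  have hm : 0 ≤ max X Y := (norm_nonneg _).trans (le_max_left _ _)
  have hP : 0 < (lam ^ d / C4) ^ (8 * ν) := by positivity
  have e1 : C2 * lam - 2 * lam - d + 2 * lam + d = C2 * lam := by ring
  rw [e1] at h1
  have hpow := pow_le_pow_left₀ (by positivity) hlam ν
  have h16 : (16 * d : ℝ) ≤ (16 * d + 1) ^ ν := by
    calc (16 * d : ℝ) ≤ 16 * d + 1 := by linarith
      _ ≤ _ := le_self_pow₀ (by have : (0 : ℝ) ≤ d := by positivity
                                linarith) (by omega)
  have hexp : Real.exp (-(8 * ν)) * Real.exp 1 ^ (8 * ν) = 1 := by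
    rw [← Real.exp_nat_mul, ← Real.exp_add]; simp
  have key : 16 * d * (C2 ^ d * C4) ^ (8 * ν) ≤ Real.exp (-(8 * ν)) * lam ^ (2 * ν) := by
    calc 16 * d * (C2 ^ d * C4) ^ (8 * ν)
        ≤ (16 * d + 1) ^ ν * (C2 ^ d * C4) ^ (8 * ν) := by gcongr
      _ = Real.exp (-(8 * ν)) * (((16 * d + 1) * (Real.exp 1 * (C2 ^ d * C4)) ^ 8) ^ ν) := by
          rw [mul_pow, ← pow_mul, mul_pow]
          linear_combination (-((16 * d + 1) ^ ν * (C2 ^ d * C4) ^ (8 * ν))) * hexp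
      _ ≤ _ := by
          rw [pow_mul lam]; gcongr
  have h2 : ‖ψ n‖ * ((lam ^ d / C4) ^ (8 * ν) / 8)
      ≤ (Real.exp (-(8 * ν)) * max X Y) * ((lam ^ d / C4) ^ (8 * ν) / 8) := by
    refine h1.trans ?_
    calc d * (lam ^ (2 * ν))⁻¹ * (C2 * lam) ^ (8 * ν * d) * (X + Y)
        ≤ d * (lam ^ (2 * ν))⁻¹ * (C2 * lam) ^ (8 * ν * d) * (2 * max X Y) := by gcongr
      _ = (16 * d * (C2 ^ d * C4) ^ (8 * ν)) * (lam ^ (2 * ν))⁻¹ * max X Y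
            * ((lam ^ d / C4) ^ (8 * ν) / 8) := by
          rw [div_pow, mul_pow, mul_pow, ← pow_mul, ← pow_mul, mul_comm d (8 * ν)]
          field_simp
          ring
      _ ≤ (Real.exp (-(8 * ν)) * lam ^ (2 * ν)) * (lam ^ (2 * ν))⁻¹ * max X Y
            * ((lam ^ d / C4) ^ (8 * ν) / 8) := by gcongr
      _ = _ := by field_simp
  exact le_of_mul_le_mul_right h2 (by positivity)

end GreenDecay

/-- Iterating one-step decay over a block of good sites. -/
theorem le_exp_mul_of_iterate_decay {m : ℤ → ℝ} {N : ℕ} {c : ℤ} {r : ℤ} {X : ℝ}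
    (hgood : ∀ n, |n - c| ≤ r → ∃ n1 n2 : ℤ, |n1 - n| ≤ N ∧ |n2 - n| ≤ N ∧
      m n ≤ Real.exp (-N) * max (m n1) (m n2))
    (hX : ∀ n, |n - c| ≤ r + N → m n ≤ X) (j : ℕ) :
    ∀ n, |n - c| ≤ r + N - j * N → m n ≤ Real.exp (-N) ^ j * X := by
  induction j with
  | zero => intro n hn; simpa using hX n (by simpa using hn)
  | succ j ih =>
    intro n hn
    push_cast at hn
    have hj : (0 : ℤ) ≤ j * N := by positivity
    obtain ⟨n1, n2, h1, h2, h3⟩ := hgood n (by linarith)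
    refine h3.trans ?_
    rw [pow_succ', mul_assoc]
    gcongr
    refine max_le (ih n1 ?_) (ih n2 ?_)
    · calc |n1 - c| ≤ |n1 - n| + |n - c| := abs_sub_le _ _ _
        _ ≤ _ := by linarith
    · calc |n2 - c| ≤ |n2 - n| + |n - c| := abs_sub_le _ _ _
        _ ≤ _ := by linarith

section Extension

open Topology

theorem exists_local_holomorphic_extension {f : ℝ → ℝ} {x : ℝ} (hf : AnalyticAt ℝ f x) :
    ∃ r > 0, ∃ g : ℂ → ℂ, DifferentiableOn ℂ g (Metric.ball (x : ℂ) r) ∧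
      ∀ y : ℝ, (y : ℂ) ∈ Metric.ball (x : ℂ) r → g y = f y := by
  obtain ⟨p, R, hp⟩ := hf
  obtain ⟨r, hr0, hrR⟩ := ENNReal.lt_iff_exists_nnreal_btwn.1 hp.r_pos
  have hr0' : 0 < (r : ℝ) := by exact_mod_cast hr0
  obtain ⟨C, hC0, hC⟩ := p.norm_mul_pow_le_of_lt_radius (hrR.trans_le hp.r_le)
  set q : FormalMultilinearSeries ℂ ℂ ℂ :=
    FormalMultilinearSeries.ofScalars ℂ (fun n => (p.coeff n : ℂ)) with hq
  have hqn : ∀ n, ‖q n‖ = |p.coeff n| := by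
    intro n
    rw [hq, FormalMultilinearSeries.ofScalars_norm, Complex.norm_real, Real.norm_eq_abs]
  have hrad : (r : ENNReal) ≤ q.radius := by
    refine q.le_radius_of_bound C fun n => ?_
    rw [hqn]
    have := hC n
    rwa [FormalMultilinearSeries.norm_apply_eq_norm_coef, Real.norm_eq_abs] at this
  have hqb := (q.hasFPowerSeriesOnBall ((by exact_mod_cast hr0 : (0 : ENNReal) < r).trans_le hrad))
  refine ⟨r, hr0', fun z => q.sum (z - x), ?_, ?_⟩
  · intro z hz
    have h1 : DifferentiableAt ℂ q.sum (z - x) := by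
      refine (hqb.analyticAt_of_mem ?_).differentiableAt
      rw [Metric.mem_eball, edist_zero_right]
      refine lt_of_lt_of_le ?_ hrad
      rw [Metric.mem_ball, dist_eq_norm] at hz
      rw [← ofReal_norm, ENNReal.ofReal_lt_coe_iff (by positivity)]
      exact hz
    exact (DifferentiableAt.comp z h1 ((differentiableAt_id).sub_const _)).differentiableWithinAt
  · intro y hy
    have hy' : |y - x| < r := by
      rw [Metric.mem_ball, dist_eq_norm, ← Complex.ofReal_sub, Complex.norm_real] at hy
      exact hy
    have h2 := hp.hasSum (y := y - x) (by
      rw [Metric.mem_eball, edist_zero_right, ← ofReal_norm]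
      refine lt_trans ?_ hrR
      rw [ENNReal.ofReal_lt_coe_iff (by positivity)]
      exact hy')
    have h3 : HasSum (fun n => q n fun _ => ((y : ℂ) - x)) ((f (x + (y - x)) : ℝ) : ℂ) := by
      convert Complex.hasSum_ofReal.2 h2 using 2 with n
      simp [hq, mul_comm]
    refine h3.tsum_eq.trans ?_
    simp

theorem eqOn_of_eq_on_real {g h : ℂ → ℂ} {U : Set ℂ} (hU : IsOpen U) (hc : Convex ℝ U)
    (hg : DifferentiableOn ℂ g U) (hh : DifferentiableOn ℂ h U) {x : ℝ} (hx : (x : ℂ) ∈ U)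
    (heq : ∀ y : ℝ, (y : ℂ) ∈ U → g y = h y) : Set.EqOn g h U := by
  refine (hg.analyticOnNhd hU).eqOn_of_preconnected_of_frequently_eq (hh.analyticOnNhd hU)
    hc.isPreconnected hx ?_
  have ht : Tendsto (fun y : ℝ => (y : ℂ)) (𝓝[≠] x) (𝓝[≠] (x : ℂ)) := by
    refine tendsto_nhdsWithin_of_tendsto_nhds_of_eventually_within _ ?_ ?_
    · exact (Complex.continuous_ofReal.tendsto x).mono_left nhdsWithin_le_nhds
    · filter_upwards [self_mem_nhdsWithin] with y hy
      simpa using hy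
  refine ht.frequently (Eventually.frequently ?_)
  have : ∀ᶠ y : ℝ in 𝓝 x, (y : ℂ) ∈ U :=
    Complex.continuous_ofReal.continuousAt.eventually_mem (hU.mem_nhds hx)
  filter_upwards [this.filter_mono nhdsWithin_le_nhds] with y hy using heq y hy

theorem exists_holomorphic_extension {f : ℝ → ℝ} (hf : ∀ x, AnalyticAt ℝ f x)
    (hper : ∀ x, f (x + 1) = f x) :
    ∃ ρ > 0, ∃ F : ℂ → ℂ, DifferentiableOn ℂ F {z | |z.im| < ρ} ∧ (∀ x : ℝ, F x = f x) ∧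
      ∀ z, F (z + 1) = F z := by
  choose r hr g hg hgf using fun x => exists_local_holomorphic_extension (hf x)
  have hpz : ∀ (x : ℝ) (n : ℤ), f (x - n) = f x := fun x n => by
    simpa using (show Function.Periodic f 1 from hper).sub_int_mul_eq n (x := x)
  obtain ⟨δ, hδ, hleb⟩ := lebesgue_number_lemma_of_metric (s := (fun x : ℝ => (x : ℂ)) '' Set.Icc 0 1)
    (c := fun x : ℝ => Metric.ball (x : ℂ) (r x)) (isCompact_Icc.image Complex.continuous_ofReal)
    (fun x => Metric.isOpen_ball) (by
      rintro _ ⟨x, -, rfl⟩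
      exact Set.mem_iUnion.2 ⟨x, Metric.mem_ball_self (hr x)⟩)
  have hloc : ∀ y : ℝ, ∃ h : ℂ → ℂ, DifferentiableOn ℂ h (Metric.ball ((Int.fract y : ℝ) : ℂ) δ) ∧
      ∀ t : ℝ, (t : ℂ) ∈ Metric.ball ((Int.fract y : ℝ) : ℂ) δ → h t = f t := by
    intro y
    obtain ⟨x, hx⟩ := hleb _ ⟨Int.fract y, ⟨Int.fract_nonneg y, (Int.fract_lt_one y).le⟩, rfl⟩
    exact ⟨g x, (hg x).mono hx, fun t ht => hgf x t (hx ht)⟩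
  have hloc' : ∀ u : ℝ, ∃ h : ℂ → ℂ, u ∈ Set.Ico (0 : ℝ) 1 →
      DifferentiableOn ℂ h (Metric.ball (u : ℂ) δ) ∧
      ∀ t : ℝ, (t : ℂ) ∈ Metric.ball (u : ℂ) δ → h t = f t := by
    intro u
    obtain ⟨h, h1⟩ := hloc u
    refine ⟨h, fun hu => ?_⟩
    rwa [Int.fract_eq_self.2 hu] at h1
  choose h hh using hloc'
  set k : ℝ → ℂ → ℂ := fun y z => h (Int.fract y) (z - ⌊y⌋) with hk
  have hmem : ∀ (y : ℝ) (z : ℂ), z ∈ Metric.ball (y : ℂ) δ →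
      z - ⌊y⌋ ∈ Metric.ball ((Int.fract y : ℝ) : ℂ) δ := by
    intro y z hz
    rw [Metric.mem_ball, dist_eq_norm] at hz ⊢
    convert hz using 2
    rw [Int.fract]; push_cast; ring
  have hfr : ∀ y : ℝ, Int.fract y ∈ Set.Ico (0 : ℝ) 1 :=
    fun y => ⟨Int.fract_nonneg y, Int.fract_lt_one y⟩
  have hkd : ∀ y : ℝ, DifferentiableOn ℂ (k y) (Metric.ball (y : ℂ) δ) := by
    intro y
    exact (hh _ (hfr y)).1.comp (by fun_prop) fun z hz => hmem y z hz
  have hkf : ∀ (y t : ℝ), (t : ℂ) ∈ Metric.ball (y : ℂ) δ → k y t = f t := by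
    intro y t ht
    have := (hh _ (hfr y)).2 (t - ⌊y⌋) (by simpa using hmem y t ht)
    rw [hpz] at this
    rw [← this, hk]; push_cast; rfl
  refine ⟨δ, hδ, fun z => k z.re z, ?_, ?_, ?_⟩
  · intro z0 hz0
    have hball : ∀ z : ℂ, |z.im| < δ → z ∈ Metric.ball (z.re : ℂ) δ := by
      intro z hz
      rw [Metric.mem_ball, dist_eq_norm]
      have : z - z.re = z.im * Complex.I := by
        linear_combination -(Complex.re_add_im z)
      rw [this]; simpa using hz
    have hev : (fun z => k z.re z) =ᶠ[𝓝 z0] k z0.re := by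
      have h1 : ∀ᶠ z in 𝓝 z0, z ∈ Metric.ball (z0.re : ℂ) δ :=
        Metric.isOpen_ball.mem_nhds (hball z0 hz0)
      have h2 : ∀ᶠ z : ℂ in 𝓝 z0, |z.im| < δ :=
        (isOpen_lt (by fun_prop) continuous_const).mem_nhds hz0
      filter_upwards [h1, h2] with z hz1 hz2
      refine eqOn_of_eq_on_real (x := z.re)
        (U := Metric.ball (z.re : ℂ) δ ∩ Metric.ball (z0.re : ℂ) δ)
        (Metric.isOpen_ball.inter Metric.isOpen_ball)
        ((convex_ball _ _).inter (convex_ball _ _)) ((hkd _).mono Set.inter_subset_left)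
        ((hkd _).mono Set.inter_subset_right) ⟨Metric.mem_ball_self hδ, ?_⟩
        (fun y hy => (hkf _ _ hy.1).trans (hkf _ _ hy.2).symm) ⟨hball z hz2, hz1⟩
      rw [Metric.mem_ball, dist_eq_norm] at hz1 ⊢
      refine lt_of_le_of_lt ?_ hz1
      rw [← Complex.ofReal_sub, Complex.norm_real]
      simpa using Complex.abs_re_le_norm (z - z0.re)
    have h3 : DifferentiableAt ℂ (k z0.re) z0 :=
      (hkd z0.re).differentiableAt (Metric.isOpen_ball.mem_nhds (hball z0 hz0))
    exact (h3.congr_of_eventuallyEq hev).differentiableWithinAt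
  · intro x
    exact hkf x x (Metric.mem_ball_self hδ)
  · intro z
    simp only [hk, Complex.add_re, Complex.one_re, Int.fract_add_one, Int.floor_add_one]
    congr 1; push_cast; ring

theorem exists_bounded_holomorphic_extension {S : Type} [Finite S] {f : S → ℝ → ℝ}
    (hf : ∀ s x, AnalyticAt ℝ (f s) x) (hper : ∀ s x, f s (x + 1) = f s x) :
    ∃ ρ > 0, ∃ B : ℝ, 1 ≤ B ∧ ∃ F : S → ℂ → ℂ,
      (∀ s, DifferentiableOn ℂ (F s) {z | |z.im| < ρ}) ∧ (∀ s (x : ℝ), F s x = f s x) ∧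
      (∀ s z, F s (z + 1) = F s z) ∧ ∀ s z, |z.im| < ρ → ‖F s z‖ ≤ B := by
  choose ρ hρ F hF hFf hFp using fun s => exists_holomorphic_extension (hf s) (hper s)
  have h1 : ∀ᶠ r in 𝓝[>] (0 : ℝ), ∀ s, r < ρ s :=
    eventually_all.2 fun s => (eventually_lt_nhds (hρ s)).filter_mono nhdsWithin_le_nhds
  obtain ⟨r, hr, hr0⟩ := (h1.and self_mem_nhdsWithin).exists
  have hr0 : 0 < r := hr0
  have hb : ∀ s, ∃ B : ℝ, ∀ z : ℂ, |z.im| < r → ‖F s z‖ ≤ B := by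
    intro s
    have hc : IsCompact (Set.Icc (0 : ℝ) 1 ×ℂ Set.Icc (-r) r) := isCompact_Icc.reProdIm isCompact_Icc
    obtain ⟨B, hB⟩ := hc.exists_bound_of_continuousOn (f := F s)
      ((hF s).continuousOn.mono fun z hz => (abs_le.2 hz.2).trans_lt (hr s))
    refine ⟨B, fun z hz => ?_⟩
    have hp : F s (z - (⌊z.re⌋ : ℂ)) = F s z := by
      have := (show Function.Periodic (F s) 1 from hFp s).sub_int_mul_eq ⌊z.re⌋ (x := z)
      simpa using this
    rw [← hp]
    refine hB _ ⟨?_, ?_⟩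
    · simp only [Set.mem_preimage, Complex.sub_re, Complex.intCast_re]
      exact ⟨Int.fract_nonneg z.re, (Int.fract_lt_one z.re).le⟩
    · simpa using abs_le.1 hz.le
  choose B hB using hb
  obtain ⟨B', hB'⟩ := (Set.finite_range B).bddAbove
  refine ⟨r, hr0, max 1 B', le_max_left _ _, F, fun s => (hF s).mono fun z hz => lt_trans hz (hr s),
    hFf, hFp, fun s z hz => (hB s z hz).trans ((hB' ⟨s, rfl⟩).trans (le_max_right _ _))⟩

end Extension

section LowerBound

open Topology

theorem isPreconnected_strip (ρ : ℝ) : IsPreconnected {z : ℂ | |z.im| < ρ} := by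
  have : {z : ℂ | |z.im| < ρ} = Complex.imLm ⁻¹' Set.Ioo (-ρ) ρ := by
    ext z; simp [abs_lt]
  rw [this]
  exact ((convex_Ioo _ _).linear_preimage _).isPreconnected

theorem isOpen_strip (ρ : ℝ) : IsOpen {z : ℂ | |z.im| < ρ} :=
  isOpen_lt (by fun_prop) continuous_const

theorem finite_zeros_of_nonconstant {F : ℂ → ℂ} {ρ : ℝ}
    (hF : DifferentiableOn ℂ F {z | |z.im| < ρ}) (hρ : 0 < ρ) (e : ℂ) (hne : ∃ x : ℝ, F x ≠ e)
    {K : Set ℂ} (hK : IsCompact K) (hKρ : K ⊆ {z | |z.im| < ρ}) : {z ∈ K | F z = e}.Finite := by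
  by_contra hinf
  obtain ⟨w, hw, hacc⟩ := Set.Infinite.exists_accPt_of_subset_isCompact hinf hK
    (Set.sep_subset _ _)
  have hfreq : ∃ᶠ z in 𝓝[≠] w, F z = e :=
    (accPt_iff_frequently_nhdsNE.1 hacc).mono fun z hz => hz.2
  have := (hF.analyticOnNhd (isOpen_strip ρ)).eqOn_of_preconnected_of_frequently_eq
    (g := fun _ => e) analyticOnNhd_const (isPreconnected_strip ρ) (hKρ hw) hfreq
  obtain ⟨x, hx⟩ := hne
  exact hx (this (by simpa using hρ))

theorem exists_im_lower_bound {S : Type} [Finite S] {F : S → ℂ → ℂ} {ρ : ℝ} (hρ : 0 < ρ)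
    (hF : ∀ s, DifferentiableOn ℂ (F s) {z | |z.im| < ρ})
    (hp : ∀ s z, F s (z + 1) = F s z) (hne : ∀ s e, ∃ x : ℝ, F s x ≠ e) {ρ₁ : ℝ} (h0 : 0 < ρ₁)
    (h1 : ρ₁ < ρ) (C : ℝ) :
    ∃ ε > 0, ∀ e ∈ Set.Icc (-C) C, ∃ y ∈ Set.Ioo 0 ρ₁, ∀ s (x : ℝ),
      ε ≤ ‖F s (x + y * Complex.I) - (e : ℂ)‖ := by
  have hloc : ∀ e0 : ℝ, ∃ ε > 0, ∃ y ∈ Set.Ioo 0 ρ₁, ∀ s (x : ℝ),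
      2 * ε ≤ ‖F s (x + y * Complex.I) - (e0 : ℂ)‖ := by
    intro e0
    have hK : IsCompact (Set.Icc (0 : ℝ) 1 ×ℂ Set.Icc 0 ρ₁) := isCompact_Icc.reProdIm isCompact_Icc
    have hKρ : Set.Icc (0 : ℝ) 1 ×ℂ Set.Icc 0 ρ₁ ⊆ {z | |z.im| < ρ} := by
      intro z hz
      have h2 : 0 ≤ z.im ∧ z.im ≤ ρ₁ := hz.2
      rw [Set.mem_ofPred_eq, abs_of_nonneg h2.1]
      linarith [h2.2]
    have hfin : (⋃ s, Complex.im '' {z ∈ Set.Icc (0 : ℝ) 1 ×ℂ Set.Icc 0 ρ₁ | F s z = e0}).Finite :=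
      Set.finite_iUnion fun s => (finite_zeros_of_nonconstant (hF s) hρ e0 (hne s e0) hK hKρ).image _
    obtain ⟨y, hy, hyn⟩ := (Set.Ioo_infinite h0).exists_notMem_finite hfin
    have hmem : ∀ x : ℝ, x ∈ Set.Icc (0 : ℝ) 1 →
        (x + y * Complex.I : ℂ) ∈ Set.Icc (0 : ℝ) 1 ×ℂ Set.Icc 0 ρ₁ := by
      intro x hx
      refine ⟨?_, ?_⟩
      · simpa using hx
      · simpa using ⟨hy.1.le, hy.2.le⟩
    have hpos : ∀ s, ∃ ε > 0, ∀ x ∈ Set.Icc (0 : ℝ) 1, ε ≤ ‖F s (x + y * Complex.I) - (e0 : ℂ)‖ := by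
      intro s
      have hcont : ContinuousOn (fun x : ℝ => ‖F s (x + y * Complex.I) - (e0 : ℂ)‖)
          (Set.Icc (0 : ℝ) 1) := by
        refine ((ContinuousOn.comp (hF s).continuousOn (by fun_prop) ?_).sub
          continuousOn_const).norm
        intro x hx
        exact hKρ (hmem x hx)
      obtain ⟨x0, hx0, hmin⟩ := isCompact_Icc.exists_isMinOn ⟨0, by simp⟩ hcont
      refine ⟨_, ?_, fun x hx => hmin hx⟩
      rw [gt_iff_lt, norm_pos_iff, sub_ne_zero]
      intro h
      refine hyn (Set.mem_iUnion.2 ⟨s, _, ⟨hmem x0 hx0, h⟩, ?_⟩)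
      simp
    choose ε hε hεx using hpos
    have hev : ∀ᶠ r in 𝓝[>] (0 : ℝ), ∀ s, r < ε s :=
      eventually_all.2 fun s => (eventually_lt_nhds (hε s)).filter_mono nhdsWithin_le_nhds
    obtain ⟨r, hr, hr0⟩ := (hev.and self_mem_nhdsWithin).exists
    have hr0 : 0 < r := hr0
    refine ⟨r / 2, by positivity, y, hy, fun s x => ?_⟩
    have hper : F s ((Int.fract x : ℝ) + y * Complex.I) = F s (x + y * Complex.I) := by
      have := (show Function.Periodic (F s) 1 from hp s).sub_int_mul_eq ⌊x⌋
        (x := (x + y * Complex.I))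
      rw [← this, Int.fract]
      congr 1; push_cast; ring
    rw [← hper]
    have := hεx s (Int.fract x) ⟨Int.fract_nonneg x, (Int.fract_lt_one x).le⟩
    linarith [hr s]
  refine isCompact_Icc.induction_on (p := fun A : Set ℝ => ∃ ε > 0, ∀ e ∈ A, ∃ y ∈ Set.Ioo 0 ρ₁,
    ∀ s (x : ℝ), ε ≤ ‖F s (x + y * Complex.I) - (e : ℂ)‖) ⟨1, one_pos, by simp⟩ ?_ ?_ ?_
  · rintro A B hAB ⟨ε, hε, h⟩
    exact ⟨ε, hε, fun e he => h e (hAB he)⟩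
  · rintro A B ⟨ε, hε, h⟩ ⟨ε', hε', h'⟩
    refine ⟨min ε ε', lt_min hε hε', ?_⟩
    rintro e (he | he)
    · obtain ⟨y, hy, h2⟩ := h e he
      exact ⟨y, hy, fun s x => (min_le_left _ _).trans (h2 s x)⟩
    · obtain ⟨y, hy, h2⟩ := h' e he
      exact ⟨y, hy, fun s x => (min_le_right _ _).trans (h2 s x)⟩
  · intro e0 _
    obtain ⟨ε, hε, y, hy, h⟩ := hloc e0
    refine ⟨Metric.ball e0 ε, mem_nhdsWithin_of_mem_nhds (Metric.ball_mem_nhds _ hε), ε, hε,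
      fun e he => ⟨y, hy, fun s x => ?_⟩⟩
    have h2 : ‖((e : ℂ) - e0)‖ < ε := by
      rw [← Complex.ofReal_sub, Complex.norm_real]; exact he
    have h3 := norm_sub_norm_le (F s (x + y * Complex.I) - (e0 : ℂ)) ((e : ℂ) - e0)
    rw [sub_sub_sub_cancel_right] at h3
    linarith [h s x]

end LowerBound

section ZeroLemma

open Topology Metric

theorem lower_bound_of_ne_zero {h : ℂ → ℂ} {c : ℂ} {R L : ℝ} (hR : 0 < R)
    (hd : DifferentiableOn ℂ h (ball c R)) (hne : ∀ z ∈ ball c R, h z ≠ 0) (hL : 0 < L)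
    (hb : ∀ z ∈ ball c R, ‖h z‖ ≤ ‖h c‖ * Real.exp L) {z : ℂ} (hz : z ∈ closedBall c (R / 2)) :
    ‖h c‖ * Real.exp (-(2 * L)) ≤ ‖h z‖ := by
  have hcm : c ∈ ball c R := mem_ball_self hR
  have hld : DifferentiableOn ℂ (fun z => deriv h z / h z) (ball c R) :=
    (hd.deriv isOpen_ball).div hd hne
  obtain ⟨φ, hφc, hφ⟩ := Complex.IsExactOn.with_val_at hld.isExactOn_ball c 0
  have hexp : ∀ z ∈ ball c R, h z = h c * Complex.exp (φ z) := by
    have hder : ∀ z ∈ ball c R, HasDerivAt (fun z => h z * Complex.exp (-φ z)) 0 z := by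
      intro z hz
      have h1 := (hd.differentiableAt (isOpen_ball.mem_nhds hz)).hasDerivAt
      have h2 := h1.mul (hφ z hz).neg.cexp
      have h3 := hne z hz
      have h4 : deriv h z * Complex.exp (-φ z) + h z * (Complex.exp (-φ z) * -(deriv h z / h z))
          = 0 := by field_simp; ring
      exact h4 ▸ h2
    intro z hz
    have hconst := (convex_ball c R).is_const_of_fderivWithin_eq_zero (𝕜 := ℂ)
      (f := fun z => h z * Complex.exp (-φ z))
      (fun z hz => (hder z hz).differentiableAt.differentiableWithinAt)
      (fun z hz => by
        rw [fderivWithin_of_isOpen isOpen_ball hz]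
        ext; simpa using (hder z hz).deriv) hz hcm
    simp only [hφc, neg_zero, Complex.exp_zero, mul_one] at hconst
    rw [← hconst, mul_assoc, ← Complex.exp_add]; simp
  have hcpos : 0 < ‖h c‖ := norm_pos_iff.2 (hne c hcm)
  have hmem : ∀ w ∈ ball (0 : ℂ) R, c + w ∈ ball c R := by
    intro w hw; simpa using hw
  have hz' : z - c ∈ ball (0 : ℂ) R := by
    rw [mem_closedBall, dist_eq_norm] at hz
    rw [mem_ball_zero_iff]; linarith
  have hBC := Complex.borelCaratheodory_zero (f := fun w => φ (c + w)) (M := L) (R := R)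
    (z := z - c) hL (by
      intro w hw
      exact ((hφ _ (hmem w hw)).differentiableAt.comp w
        (by fun_prop)).differentiableWithinAt) (by
      intro w hw
      have h1 := hb _ (hmem w hw)
      rw [hexp _ (hmem w hw), norm_mul, Complex.norm_exp] at h1
      exact Real.exp_le_exp.1 (le_of_mul_le_mul_left h1 hcpos)) hR hz' (by simpa using hφc)
  simp only [add_sub_cancel] at hBC
  have hzb : z ∈ ball c R := by simpa using hmem _ hz'
  rw [hexp z hzb, norm_mul, Complex.norm_exp]
  gcongr
  have h2 : ‖φ z‖ ≤ 2 * L := by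
    refine hBC.trans ?_
    rw [mem_closedBall, dist_eq_norm] at hz
    rw [div_le_iff₀ (by linarith)]
    gcongr
    linarith
  have := Complex.abs_re_le_norm (φ z)
  linarith [neg_abs_le (φ z).re]

theorem exists_zeros_lower_bound {g : ℂ → ℂ} {c : ℂ} {r M m L : ℝ} (hr : 0 < r) (hr3 : r ≤ 3)
    (hg : DifferentiableOn ℂ g (ball c r)) (hM : ∀ z ∈ ball c r, ‖g z‖ ≤ M) (hm : 0 < m)
    (hmc : m ≤ ‖g c‖) (hL : 0 < L) (hML : M ≤ m * Real.exp L) :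
    ∃ Z : Multiset ℂ, (Z.card : ℝ) ≤ 3 * L ∧ ∀ z ∈ closedBall c (r / 6),
      m * Real.exp (-(2 * L)) * (Z.map fun w => ‖z - w‖).prod ≤ ‖g z‖ := by
  classical
  set Q : ℕ → Prop := fun n => ∃ Z : Multiset ℂ, Z.card = n ∧ (∀ w ∈ Z, w ∈ closedBall c (r / 3)) ∧
    ∃ h : ℂ → ℂ, DifferentiableOn ℂ h (ball c r) ∧
      ∀ z ∈ ball c r, g z = (Z.map fun w => z - w).prod * h z with hQ
  have hprod_norm : ∀ (Z : Multiset ℂ) (z : ℂ),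
      ‖(Z.map fun w => z - w).prod‖ = (Z.map fun w => ‖z - w‖).prod := by
    intro Z z
    induction Z using Multiset.induction with
    | empty => simp
    | cons a Z ih => rw [Multiset.map_cons, Multiset.map_cons, Multiset.prod_cons,
        Multiset.prod_cons, norm_mul, ih]
  have hup : ∀ (Z : Multiset ℂ) (z : ℂ) (a : ℝ), (∀ w ∈ Z, ‖z - w‖ ≤ a) →
      (Z.map fun w => ‖z - w‖).prod ≤ a ^ Z.card := by
    intro Z z a h
    have := Multiset.prod_map_le_prod_map₀ (s := Z) (fun w => ‖z - w‖) (fun _ => a)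
      (fun _ _ => norm_nonneg _) h
    simpa using this
  have hlow : ∀ (Z : Multiset ℂ) (z : ℂ) (a : ℝ), 0 ≤ a → (∀ w ∈ Z, a ≤ ‖z - w‖) →
      a ^ Z.card ≤ (Z.map fun w => ‖z - w‖).prod := by
    intro Z z a ha h
    have := Multiset.prod_map_le_prod_map₀ (s := Z) (fun _ => a) (fun w => ‖z - w‖)
      (fun _ _ => ha) h
    simpa using this
  have hcb : c ∈ ball c r := mem_ball_self hr
  -- bounds for the cofactor
  have hcof : ∀ (Z : Multiset ℂ) (h : ℂ → ℂ), (∀ w ∈ Z, w ∈ closedBall c (r / 3)) →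
      DifferentiableOn ℂ h (ball c r) →
      (∀ z ∈ ball c r, g z = (Z.map fun w => z - w).prod * h z) →
      m ≤ (r / 3) ^ Z.card * ‖h c‖ ∧ ∀ z ∈ closedBall c (5 * r / 6), (r / 2) ^ Z.card * ‖h z‖ ≤ M := by
    intro Z h hZ hd heq
    constructor
    · refine hmc.trans ?_
      rw [heq c hcb, norm_mul, hprod_norm]
      gcongr
      exact hup Z c _ fun w hw => by
        have := hZ w hw
        rwa [mem_closedBall, dist_comm, dist_eq_norm] at this
    · intro z hz
      have hsub : closedBall c (5 * r / 6) ⊆ ball c r := closedBall_subset_ball (by linarith)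
      have hdc : DiffContOnCl ℂ h (ball c (5 * r / 6)) :=
        (hd.mono ((closure_ball c (by positivity)).subset.trans hsub)).diffContOnCl
      have hfr : ∀ z ∈ frontier (ball c (5 * r / 6)), ‖h z‖ ≤ M / (r / 2) ^ Z.card := by
        intro z hz
        rw [frontier_ball c (by positivity)] at hz
        have hzs : ‖z - c‖ = 5 * r / 6 := by rwa [mem_sphere, dist_eq_norm] at hz
        have hzb : z ∈ ball c r := hsub (sphere_subset_closedBall hz)
        rw [le_div_iff₀ (by positivity)]
        refine le_trans ?_ (hM z hzb)
        rw [heq z hzb, norm_mul, hprod_norm, mul_comm]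
        gcongr
        refine hlow Z z _ (by positivity) fun w hw => ?_
        have h1 := hZ w hw
        rw [mem_closedBall, dist_eq_norm] at h1
        have h2 := norm_sub_norm_le (z - c) (w - c)
        rw [sub_sub_sub_cancel_right] at h2
        linarith
      have := Complex.norm_le_of_forall_mem_frontier_norm_le isBounded_ball hdc hfr
        (z := z) (by rwa [closure_ball c (by positivity)])
      rwa [le_div_iff₀ (by positivity), mul_comm] at this
  have hbound : ∀ n, Q n → (n : ℝ) ≤ 3 * L := by
    rintro n ⟨Z, rfl, hZ, h, hd, heq⟩
    obtain ⟨h1, h2⟩ := hcof Z h hZ hd heq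
    have h3 := h2 c (mem_closedBall_self (by positivity))
    have h4 : (3 / 2 : ℝ) ^ Z.card * m ≤ m * Real.exp L := by
      calc (3 / 2 : ℝ) ^ Z.card * m ≤ (3 / 2 : ℝ) ^ Z.card * ((r / 3) ^ Z.card * ‖h c‖) := by gcongr
        _ = (r / 2) ^ Z.card * ‖h c‖ := by
            rw [← mul_assoc, ← mul_pow]; congr 2; ring
        _ ≤ _ := h3.trans hML
    have h5 : (3 / 2 : ℝ) ^ Z.card ≤ Real.exp L := by
      rw [mul_comm m] at h4; exact le_of_mul_le_mul_right h4 hm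
    have h6 : Real.exp (1 / 3) ≤ 3 / 2 := by
      have h7 : Real.exp (1 / 3) ^ 3 ≤ (3 / 2 : ℝ) ^ 3 := by
        rw [← Real.exp_nat_mul]
        norm_num
        linarith [Real.exp_one_lt_d9]
      exact le_of_pow_le_pow_left₀ (by norm_num) (by norm_num) h7
    have h8 : Real.exp (Z.card * (1 / 3)) ≤ Real.exp L := by
      rw [Real.exp_nat_mul]
      exact (pow_le_pow_left₀ (Real.exp_pos _).le h6 _).trans h5
    have := Real.exp_le_exp.1 h8
    linarith
  have hQ0 : Q 0 := ⟨0, rfl, by simp, g, hg, by simp⟩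
  obtain ⟨n, hn, hmax⟩ : ∃ n, Q n ∧ ∀ k, Q k → k ≤ n := by
    refine ⟨Nat.findGreatest Q ⌈3 * L⌉₊, Nat.findGreatest_spec (Nat.zero_le _) hQ0, fun k hk => ?_⟩
    refine Nat.le_findGreatest ?_ hk
    exact_mod_cast (hbound k hk).trans (Nat.le_ceil _)
  have hnb := hbound n hn
  obtain ⟨Z, rfl, hZ, h, hd, heq⟩ := hn
  obtain ⟨h1, h2⟩ := hcof Z h hZ hd heq
  have hne : ∀ w ∈ ball c (r / 3), h w ≠ 0 := by
    intro w hw h0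
    have hwr : w ∈ ball c r := ball_subset_ball (by linarith) hw
    have hQs : Q (Z.card + 1) := by
      refine ⟨w ::ₘ Z, Multiset.card_cons _ _, ?_, dslope h w, ?_, ?_⟩
      · intro u hu
        rcases Multiset.mem_cons.1 hu with rfl | hu
        · exact ball_subset_closedBall hw
        · exact hZ u hu
      · exact (Complex.differentiableOn_dslope (isOpen_ball.mem_nhds hwr)).2 hd
      · intro z hz
        have h3 := sub_smul_dslope h w z
        rw [h0, sub_zero, smul_eq_mul] at h3
        rw [heq z hz, Multiset.map_cons, Multiset.prod_cons, ← h3]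
        ring
    have := hmax _ hQs
    omega
  refine ⟨Z, hnb, fun z hz => ?_⟩
  have h3 : (1 : ℝ) ≤ (3 / 2 : ℝ) ^ Z.card := one_le_pow₀ (by norm_num)
  have hbd : ∀ z ∈ ball c (r / 3), ‖h z‖ ≤ ‖h c‖ * Real.exp L := by
    intro z hz
    have h4 := h2 z (closedBall_subset_closedBall (by linarith) (ball_subset_closedBall hz))
    have h5 : (r / 2) ^ Z.card * ‖h z‖ ≤ (r / 2) ^ Z.card * (‖h c‖ * Real.exp L) := by
      calc (r / 2) ^ Z.card * ‖h z‖ ≤ m * Real.exp L := h4.trans hML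
        _ ≤ ((r / 3) ^ Z.card * ‖h c‖) * Real.exp L := by gcongr
        _ ≤ ((r / 2) ^ Z.card * ‖h c‖) * Real.exp L := by gcongr; linarith
        _ = _ := by ring
    exact le_of_mul_le_mul_left h5 (by positivity)
  have h4 := lower_bound_of_ne_zero (by positivity)
    (hd.mono (ball_subset_ball (by linarith))) hne hL hbd (z := z)
    (by rwa [show r / 3 / 2 = r / 6 by ring])
  have hzb : z ∈ ball c r := closedBall_subset_ball (by linarith) hz
  have hmc' : m ≤ ‖h c‖ := by
    refine h1.trans ?_
    have : (r / 3) ^ Z.card ≤ 1 := pow_le_one₀ (by positivity) (by linarith)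
    calc (r / 3) ^ Z.card * ‖h c‖ ≤ 1 * ‖h c‖ := by gcongr
      _ = _ := one_mul _
  rw [heq z hzb, norm_mul, hprod_norm, mul_comm]
  have hp0 : 0 ≤ (Z.map fun w => ‖z - w‖).prod :=
    Multiset.prod_nonneg (by
      intro a ha; obtain ⟨w, -, rfl⟩ := Multiset.mem_map.1 ha; exact norm_nonneg _)
  gcongr
  exact le_trans (by gcongr) h4

end ZeroLemma

/-- The distance to the nearest integer. -/
def distInt (x : ℝ) : ℝ := |x - round x|

theorem distInt_nonneg (x : ℝ) : 0 ≤ distInt x := abs_nonneg _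

theorem distInt_le_half (x : ℝ) : distInt x ≤ 1 / 2 := abs_sub_round x

theorem distInt_le_abs (x : ℝ) : distInt x ≤ |x| := by
  simpa [distInt] using round_le x 0

theorem distInt_le_abs_sub (x : ℝ) (n : ℤ) : distInt x ≤ |x - n| := round_le x n

theorem distInt_sub_int (x : ℝ) (n : ℤ) : distInt (x - n) = distInt x := by
  rw [distInt, distInt, round_sub_intCast]; push_cast; ring_nf

theorem distInt_add_int (x : ℝ) (n : ℤ) : distInt (x + n) = distInt x := by
  rw [distInt, distInt, round_add_intCast]; push_cast; ring_nf

theorem Multiset.prod_map_distInt_le_one (Z : Multiset ℝ) (x : ℝ) :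
    (Z.map fun w => distInt (x - w)).prod ≤ 1 := by
  have := Multiset.prod_map_le_prod_map₀ (s := Z) (fun w => distInt (x - w)) (fun _ => 1)
    (fun _ _ => distInt_nonneg _) (fun w _ => (distInt_le_half _).trans (by norm_num))
  simpa using this

theorem Multiset.prod_map_distInt_nonneg (Z : Multiset ℝ) (x : ℝ) :
    0 ≤ (Z.map fun w => distInt (x - w)).prod :=
  Multiset.prod_nonneg (by
    intro a ha; obtain ⟨w, -, rfl⟩ := Multiset.mem_map.1 ha; exact distInt_nonneg _)

theorem differentiableOn_matrix_det {n : Type*} [Fintype n] [DecidableEq n]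
    {A : ℂ → Matrix n n ℂ} {U : Set ℂ} (h : ∀ i j, DifferentiableOn ℂ (fun z => A z i j) U) :
    DifferentiableOn ℂ (fun z => (A z).det) U := by
  simp_rw [Matrix.det_apply]
  refine DifferentiableOn.fun_sum fun σ _ => ?_
  refine DifferentiableOn.const_smul ?_ _
  exact DifferentiableOn.fun_finsetProd fun i _ => h _ _

/-- Nonconstant real analytic potentials on the circle, extended to a complex strip. -/
structure StripPotential (S : Type) where
  f : S → ℝ → ℝ
  F : S → ℂ → ℂ
  ρ : ℝ
  B : ℝ
  ρ_pos : 0 < ρ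
  one_le_B : 1 ≤ B
  differentiableOn : ∀ s, DifferentiableOn ℂ (F s) {z | |z.im| < ρ}
  F_ofReal : ∀ s (x : ℝ), F s x = f s x
  F_add_one : ∀ s z, F s (z + 1) = F s z
  norm_F_le : ∀ s z, |z.im| < ρ → ‖F s z‖ ≤ B
  nonconst : ∀ s (e : ℂ), ∃ x : ℝ, F s x ≠ e

namespace StripPotential

variable {S : Type} [Fintype S] [MetricSpace S] [DecidableEq S] (P : StripPotential S)

/-- A bound for the energies that have to be considered, in units of the coupling. -/
def C1 : ℝ := P.B + Fintype.card S + 3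

/-- A bound for row sums, in units of the coupling. -/
def C2 : ℝ := P.B + P.C1 + Fintype.card S + 2

/-- The characteristic determinant of `N` consecutive columns, as a function of the phase. -/
def det (N : ℕ) (lam ω E : ℝ) (z : ℂ) : ℂ :=
  (stripMat N fun i s => (lam : ℂ) * P.F s (z + i * ω) - E).det

theorem det_add_one (N : ℕ) (lam ω E : ℝ) (z : ℂ) : P.det N lam ω E (z + 1) = P.det N lam ω E z := by
  have : ∀ (i : ℕ) s, P.F s (z + 1 + i * ω) = P.F s (z + i * ω) := fun i s => by
    rw [← P.F_add_one s (z + i * ω)]; congr 1; ring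
  simp only [det, this]

theorem det_sub_int (N : ℕ) (lam ω E : ℝ) (z : ℂ) (n : ℤ) :
    P.det N lam ω E (z - n) = P.det N lam ω E z := by
  simpa using (show Function.Periodic (P.det N lam ω E) 1 from
    P.det_add_one N lam ω E).sub_int_mul_eq n (x := z)

theorem one_le_C1 : 1 ≤ P.C1 := by
  have := P.one_le_B
  have : (0 : ℝ) ≤ Fintype.card S := by positivity
  unfold C1; linarith

theorem one_le_C2 : 1 ≤ P.C2 := by
  have := P.one_le_B
  have := P.one_le_C1
  have : (0 : ℝ) ≤ Fintype.card S := by positivity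
  unfold C2; linarith

theorem norm_potential_le {lam E : ℝ} (hl : 1 ≤ lam) (hE : |E| ≤ lam * P.C1) (s : S) {z : ℂ}
    (hz : |z.im| < P.ρ) :
    ‖(lam : ℂ) * P.F s z - E‖ + 2 * lam + Fintype.card S ≤ P.C2 * lam := by
  have h1 : ‖(lam : ℂ) * P.F s z - E‖ ≤ lam * P.B + lam * P.C1 := by
    refine (norm_sub_le _ _).trans (add_le_add ?_ ?_)
    · rw [norm_mul, Complex.norm_real, Real.norm_of_nonneg (by linarith)]
      exact mul_le_mul_of_nonneg_left (P.norm_F_le s z hz) (by linarith)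
    · rwa [Complex.norm_real]
  have h2 : (Fintype.card S : ℝ) ≤ lam * Fintype.card S := le_mul_of_one_le_left (by positivity) hl
  unfold C2; linarith

theorem norm_det_le {lam E : ℝ} (hl : 1 ≤ lam) (hE : |E| ≤ lam * P.C1) (N : ℕ) (ω : ℝ) {z : ℂ}
    (hz : |z.im| < P.ρ) :
    ‖P.det N lam ω E z‖ ≤ (lam * P.C2) ^ (N * Fintype.card S) := by
  have hV : ∀ (i : ℕ) s, ‖(lam : ℂ) * P.F s (z + i * ω) - E‖
      ≤ P.C2 * lam - 2 * lam - Fintype.card S := by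
    intro i s
    have := P.norm_potential_le hl hE s (z := z + i * ω) (by simpa using hz)
    linarith
  refine (norm_det_stripMat_le N _ hV).trans ?_
  refine pow_le_pow_left₀ ?_ (by linarith) _
  have h0 := P.norm_potential_le hl hE (z := z)
  rcases isEmpty_or_nonempty S with hS | ⟨⟨s⟩⟩
  · have : 2 ≤ P.C2 := by
      have := P.one_le_B
      have := P.one_le_C1
      have : (0 : ℝ) ≤ Fintype.card S := by positivity
      unfold C2; linarith
    nlinarith
  · have h1 := h0 s hz
    have h2 := norm_nonneg ((lam : ℂ) * P.F s z - E)
    have : (0 : ℝ) ≤ Fintype.card S := by positivity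
    linarith

theorem differentiableOn_det (N : ℕ) (lam ω E : ℝ) :
    DifferentiableOn ℂ (P.det N lam ω E) {z | |z.im| < P.ρ} := by
  refine differentiableOn_matrix_det fun p q => ?_
  rcases eq_or_ne p q with rfl | h
  · simp_rw [stripMat_self]
    refine (DifferentiableOn.const_mul ?_ _).sub_const _
    refine (P.differentiableOn p.2).comp (by fun_prop) fun z hz => ?_
    simpa using hz
  · simp_rw [stripMat_of_ne _ h]
    exact differentiableOn_const _

theorem exists_zeros :
    ∃ C3 : ℝ, 1 ≤ C3 ∧ ∃ lam1 : ℝ, 1 ≤ lam1 ∧ ∀ lam, lam1 ≤ lam → ∀ (N : ℕ) (ω E : ℝ),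
      |E| ≤ lam * P.C1 → ∃ Z : Multiset ℝ, (Z.card : ℝ) ≤ C3 * N ∧ ∀ x : ℝ,
        (lam ^ Fintype.card S / C3) ^ N * (Z.map fun w => distInt (x - w)).prod
          ≤ ‖P.det N lam ω E x‖ := by
  have hρ := P.ρ_pos
  set d := Fintype.card S with hd
  set r := min (P.ρ / 2) 3 with hr
  have hr0 : 0 < r := lt_min (by positivity) (by norm_num)
  have hr3 : r ≤ 3 := min_le_right _ _
  have hrρ : r ≤ P.ρ / 2 := min_le_left _ _
  obtain ⟨ε, hε, hlow⟩ := exists_im_lower_bound hρ P.differentiableOn P.F_add_one P.nonconst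
    (ρ₁ := r / 12) (by positivity) (by linarith) P.C1
  obtain ⟨J, hJ⟩ := exists_nat_gt (12 / r)
  have hJ0 : 0 < (J : ℝ) := lt_trans (by positivity) hJ
  have hC2 := P.one_le_C2
  set T : ℝ := 2 * P.C2 / ε with hT
  have hT0 : 0 < T := by positivity
  set C : ℝ := d * |Real.log T| + 1 with hC
  have hC0 : 0 < C := by positivity
  set C3 : ℝ := max (3 * C * J) (max 1 ((ε / 2) ^ d * Real.exp (-(2 * C)))⁻¹) with hC3
  have hC31 : 1 ≤ C3 := le_max_of_le_right (le_max_left _ _)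
  refine ⟨C3, hC31, max 1 (2 * (2 + d) / ε), le_max_left _ _, ?_⟩
  intro lam hlam N ω E hE
  have hl1 : 1 ≤ lam := (le_max_left _ _).trans hlam
  have hl0 : 0 < lam := by linarith
  have hlε : 2 * (2 + d) ≤ lam * ε := by
    have := (le_max_right 1 (2 * (2 + d) / ε)).trans hlam
    rwa [div_le_iff₀ hε] at this
  rcases Nat.eq_zero_or_pos N with rfl | hN
  · refine ⟨0, by simp, fun x => ?_⟩
    simp [det]
  have hN0 : (0 : ℝ) < N := by exact_mod_cast hN
  obtain ⟨y, hy, hylow⟩ := hlow (E / lam) (by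
    rw [Set.mem_Icc, ← abs_le, abs_div, abs_of_pos hl0, div_le_iff₀ hl0, mul_comm]; exact hE)
  set m : ℝ := (lam * ε / 2) ^ (N * d) with hm
  have hm0 : 0 < m := by positivity
  set L : ℝ := N * C with hL
  have hL0 : 0 < L := by positivity
  have hdisc : ∀ x0 : ℝ, ∃ Z : Multiset ℂ, (Z.card : ℝ) ≤ 3 * L ∧
      ∀ x : ℝ, |x - x0| ≤ r / 12 → m * Real.exp (-(2 * L)) * (Z.map fun w => ‖(x : ℂ) - w‖).prod
        ≤ ‖P.det N lam ω E x‖ := by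
    intro x0
    have hball : Metric.ball (x0 + y * Complex.I : ℂ) r ⊆ {z | |z.im| < P.ρ} := by
      intro z hz
      rw [Metric.mem_ball, dist_eq_norm] at hz
      have h1 := (Complex.abs_im_le_norm _).trans_lt hz
      simp only [Complex.sub_im, Complex.add_im, Complex.ofReal_im, Complex.mul_im,
        Complex.ofReal_re, Complex.I_im, Complex.I_re] at h1
      simp only [mul_one, mul_zero, add_zero, zero_add] at h1
      have h2 := abs_sub_abs_le_abs_sub z.im y
      rw [abs_of_pos hy.1] at h2
      have := hy.2
      show |z.im| < P.ρ
      linarith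
    obtain ⟨Z, hZ, hZb⟩ := exists_zeros_lower_bound (g := P.det N lam ω E)
      (c := x0 + y * Complex.I) (M := (lam * P.C2) ^ (N * d)) hr0 hr3
      ((P.differentiableOn_det N lam ω E).mono hball)
      (fun z hz => P.norm_det_le hl1 hE N ω (hball hz)) hm0 (by
        refine le_norm_det_stripMat N _ (fun i s => ?_) hlε
        have h1 := hylow s (x0 + i * ω)
        have h2 : (lam : ℂ) * P.F s (x0 + y * Complex.I + i * ω) - E
            = lam * (P.F s (((x0 + i * ω : ℝ) : ℂ) + y * Complex.I) - ((E / lam : ℝ) : ℂ)) := by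
          rw [mul_sub, Complex.ofReal_div, mul_div_cancel₀ _ (by exact_mod_cast hl0.ne')]
          congr 3; push_cast; ring
        rw [h2, norm_mul, Complex.norm_real, Real.norm_of_nonneg hl0.le]
        gcongr) hL0 (by
        have h1 : (lam * P.C2) ^ (N * d) = m * T ^ (N * d) := by
          rw [hm, ← mul_pow]; congr 1; rw [hT]; field_simp
        rw [h1]
        gcongr
        rw [← Real.exp_log hT0, ← Real.exp_nat_mul]
        rw [Real.exp_le_exp, hL, hC]
        push_cast
        have h2 := le_abs_self (Real.log T)
        calc (N : ℝ) * d * Real.log T ≤ N * d * |Real.log T| := by gcongr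
          _ ≤ N * (d * |Real.log T| + 1) := by nlinarith)
    refine ⟨Z, hZ, fun x hx => hZb x ?_⟩
    rw [Metric.mem_closedBall, dist_eq_norm]
    have : (x : ℂ) - (x0 + y * Complex.I) = ((x - x0 : ℝ) : ℂ) - y * Complex.I := by
      push_cast; ring
    rw [this]
    refine (norm_sub_le _ _).trans ?_
    rw [Complex.norm_real, norm_mul, Complex.norm_real, Complex.norm_I, Real.norm_of_nonneg hy.1.le]
    rw [Real.norm_eq_abs]
    linarith [hy.2]
  choose Z hZc hZb using hdisc
  set Zr : ℕ → Multiset ℝ := fun j => (Z (j / J)).map Complex.re with hZr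
  refine ⟨∑ j ∈ Finset.range J, Zr j, ?_, fun x => ?_⟩
  · rw [Multiset.card_sum]
    push_cast
    calc ∑ j ∈ Finset.range J, ((Zr j).card : ℝ) ≤ ∑ _j ∈ Finset.range J, 3 * L :=
          Finset.sum_le_sum fun j _ => by rw [hZr, Multiset.card_map]; exact hZc _
      _ = 3 * C * J * N := by rw [Finset.sum_const, Finset.card_range, hL, nsmul_eq_mul]; ring
      _ ≤ _ := by gcongr; exact le_max_left _ _
  · set t := Int.fract x with ht
    have ht0 : 0 ≤ t := Int.fract_nonneg x
    have ht1 : t < 1 := Int.fract_lt_one x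
    set j := ⌊J * t⌋₊ with hj
    have hjJ : j < J := by
      rw [hj, Nat.floor_lt (by positivity)]
      nlinarith
    have hjt : |t - j / J| ≤ r / 12 := by
      have h1 := Nat.floor_le (show 0 ≤ J * t by positivity)
      have h2 := Nat.lt_floor_add_one (J * t)
      rw [← hj] at h1 h2
      have h3 : t - j / J = (J * t - j) / J := by field_simp
      rw [h3, abs_of_nonneg (div_nonneg (by linarith) hJ0.le), div_le_iff₀ hJ0]
      have : 12 < J * r := by rwa [div_lt_iff₀ hr0] at hJ
      nlinarith
    have h1 := hZb (j / J) t hjt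
    have h2 : P.det N lam ω E t = P.det N lam ω E x := by
      rw [← P.det_sub_int N lam ω E x ⌊x⌋, ht, Int.fract]; push_cast; rfl
    rw [h2] at h1
    refine le_trans ?_ h1
    have h3 : ((∑ j ∈ Finset.range J, Zr j).map fun w => distInt (x - w)).prod
        ≤ ((Zr j).map fun w => distInt (x - w)).prod := by
      rw [← Finset.add_sum_erase _ _ (Finset.mem_range.2 hjJ), Multiset.map_add, Multiset.prod_add]
      exact mul_le_of_le_one_right (Multiset.prod_map_distInt_nonneg _ _)
        (Multiset.prod_map_distInt_le_one _ _)
    have h4 : ((Zr j).map fun w => distInt (x - w)).prod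
        ≤ ((Z (j / J)).map fun w => ‖(t : ℂ) - w‖).prod := by
      rw [hZr, Multiset.map_map]
      refine Multiset.prod_map_le_prod_map₀ _ _ (fun _ _ => distInt_nonneg _) fun w _ => ?_
      have h5 : distInt (x - w.re) = distInt (t - w.re) := by
        rw [← distInt_sub_int _ ⌊x⌋, ht, Int.fract]; congr 1; ring
      rw [Function.comp_apply, h5]
      refine (distInt_le_abs _).trans ?_
      simpa using Complex.abs_re_le_norm ((t : ℂ) - w)
    have h6 : (lam ^ d / C3) ^ N ≤ m * Real.exp (-(2 * L)) := by
      have h7 : m * Real.exp (-(2 * L)) = (lam ^ d * ((ε / 2) ^ d * Real.exp (-(2 * C)))) ^ N := by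
        rw [mul_pow, mul_pow, ← Real.exp_nat_mul, ← pow_mul, ← pow_mul, hm, mul_div_assoc, mul_pow,
          mul_comm d N, hL]
        ring_nf
      rw [h7]
      have h8 : C3⁻¹ ≤ (ε / 2) ^ d * Real.exp (-(2 * C)) :=
        inv_le_of_inv_le₀ (by positivity) ((le_max_right _ _).trans (le_max_right _ _))
      rw [div_eq_mul_inv]
      gcongr
    have h9 := Multiset.prod_map_distInt_nonneg (∑ j ∈ Finset.range J, Zr j) x
    calc _ ≤ m * Real.exp (-(2 * L)) * ((∑ j ∈ Finset.range J, Zr j).map fun w => distInt (x - w)).prod := by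
          gcongr
      _ ≤ _ := by gcongr; exact h3.trans h4

end StripPotential

section Arithmetic

theorem distInt_add_le (x y : ℝ) : distInt (x + y) ≤ distInt x + |y| := by
  calc distInt (x + y) ≤ |x + y - round x| := distInt_le_abs_sub _ _
    _ = |(x - round x) + y| := by ring_nf
    _ ≤ _ := abs_add_le _ _

theorem le_distInt_of_between {x : ℝ} {δ : ℝ} (h0 : δ ≤ x) (h1 : x ≤ 1 - δ) : δ ≤ distInt x := by
  rw [distInt]
  rcases le_or_gt (round x) 0 with h | h
  · have : (round x : ℝ) ≤ 0 := by exact_mod_cast h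
    exact le_trans (by linarith) (le_abs_self _)
  · have : (1 : ℝ) ≤ round x := by exact_mod_cast h
    exact le_trans (by linarith) (neg_le_abs _)

theorem mul_div_le_distInt {q : ℕ} {b : ℕ} (hb : b < q) :
    (b * (q - b : ℝ)) / q ^ 2 ≤ distInt ((b : ℝ) / q) := by
  have hq : (0 : ℝ) < q := by exact_mod_cast (Nat.zero_le b).trans_lt hb
  have hb' : (b : ℝ) ≤ q := by exact_mod_cast hb.le
  have hb0 : (0 : ℝ) ≤ b := by positivity
  apply le_distInt_of_between
  · rw [div_le_div_iff₀ (by positivity) hq]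
    nlinarith [mul_nonneg hb0 hb0, mul_nonneg (mul_nonneg hb0 hb0) hq.le]
  · rw [le_sub_iff_add_le, ← mul_div_mul_right (b : ℝ) q hq.ne', ← sq, ← add_div, div_le_one (by positivity)]
    nlinarith [mul_nonneg (sub_nonneg.2 hb') (sub_nonneg.2 hb')]

theorem exp_le_prod_range_distInt {ω y : ℝ} {r : ℚ} {R : ℕ} (hR : r.den ≤ R)
    (hω : |ω - r| ≤ 1 / (R * r.den))
    (hsep : ∀ a < r.den, Real.exp (-r.den) ≤ distInt (y + a * ω)) :
    Real.exp (-(10 * r.den)) ≤ ∏ a ∈ Finset.range r.den, distInt (y + a * ω) := by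
  set q := r.den with hq
  set p := r.num with hp
  have hq0 : 0 < q := r.pos
  have hq0' : (0 : ℝ) < q := by exact_mod_cast hq0
  have hr : (r : ℝ) = p / q := by exact_mod_cast (Rat.num_div_den r).symm
  set Y := ⌊q * y⌋ with hY
  set b : ℕ → ℕ := fun a => ((Y + a * p) % (q : ℤ)).toNat with hb
  have hbq : ∀ a, ((b a : ℕ) : ℤ) = (Y + a * p) % (q : ℤ) := fun a =>
    Int.toNat_of_nonneg (Int.emod_nonneg _ (by exact_mod_cast hq0.ne'))
  have hblt : ∀ a, b a < q := fun a => by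
    have := Int.emod_lt_of_pos (Y + a * p) (show (0 : ℤ) < q by exact_mod_cast hq0)
    have h2 := hbq a
    omega
  have hinj : Set.InjOn b (Finset.range q : Set ℕ) := by
    intro a ha a' ha' h
    have h1 : (Y + a * p) ≡ (Y + a' * p) [ZMOD q] := by
      rw [Int.ModEq, ← hbq, ← hbq, h]
    have h2 : (p * a : ℤ) ≡ p * a' [ZMOD q] := by
      have := Int.ModEq.add_left_cancel' Y h1
      rwa [mul_comm (a : ℤ), mul_comm (a' : ℤ)] at this
    have hcop : Int.gcd (q : ℤ) p = 1 := by
      rw [Int.gcd_comm]; exact r.reduced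
    have h3 : (a : ℤ) ≡ a' [ZMOD q] := by
      have h4 := Int.ModEq.cancel_left_div_gcd (show (0 : ℤ) < q by exact_mod_cast hq0) h2
      rwa [hcop, Nat.cast_one, Int.ediv_one] at h4
    have h4 := (Int.natCast_modEq_iff.1 h3)
    rw [Finset.coe_range] at ha ha'
    exact Nat.ModEq.eq_of_lt_of_lt h4 ha ha'
  have himg : (Finset.range q).image b = Finset.range q := by
    refine Finset.eq_of_subset_of_card_le ?_ ?_
    · intro k hk
      obtain ⟨a, -, rfl⟩ := Finset.mem_image.1 hk
      exact Finset.mem_range.2 (hblt a)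
    · rw [Finset.card_image_of_injOn hinj]
  have hdist : ∀ a < q, distInt ((b a : ℝ) / q) - 2 / q ≤ distInt (y + a * ω) := by
    intro a ha
    have ha' : (a : ℝ) ≤ q := by exact_mod_cast ha.le
    obtain ⟨n, hn⟩ : ∃ n : ℤ, (Y + a * p : ℤ) = b a + q * n :=
      ⟨(Y + a * p) / q, by rw [hbq]; exact (Int.emod_add_mul_ediv _ _).symm⟩
    have hn' : (Y + a * p : ℝ) = b a + q * n := by exact_mod_cast hn
    have h1 : (b a : ℝ) / q + n = (y + a * ω) + (-((q * y - Y) / q) - a * (ω - r)) := by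
      rw [hr]; field_simp; linarith
    have h2 : |-((q * y - Y) / q) - a * (ω - r)| ≤ 2 / q := by
      have e1 : |(q * y - Y) / q| ≤ 1 / q := by
        rw [abs_div, abs_of_pos hq0']
        gcongr
        rw [abs_of_nonneg (by linarith [Int.floor_le (q * y)])]
        linarith [Int.lt_floor_add_one (q * y)]
      have e2 : |a * (ω - r)| ≤ 1 / q := by
        rw [abs_mul, abs_of_nonneg (show (0 : ℝ) ≤ a by positivity)]
        have hR' : (q : ℝ) ≤ R := by exact_mod_cast hR
        calc (a : ℝ) * |ω - r| ≤ q * (1 / (R * q)) := by gcongr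
          _ = 1 / R := by field_simp
          _ ≤ 1 / q := by gcongr
      have := abs_sub (-((q * y - Y) / q)) (a * (ω - r))
      rw [abs_neg] at this
      have e3 : (2 : ℝ) / q = 1 / q + 1 / q := by ring
      linarith
    have h3 := distInt_add_le (y + a * ω) (-((q * y - Y) / q) - a * (ω - r))
    rw [← h1, distInt_add_int] at h3
    linarith
  set u : ℕ → ℝ := fun k => if k < 4 ∨ q < k + 4 then Real.exp (-q) else 1 with hu
  set w : ℕ → ℝ := fun k => if k = 0 then 1 else k * (q - k : ℝ) / (2 * q ^ 2) with hw
  have hu0 : ∀ k, 0 ≤ u k := fun k => by simp only [hu]; split_ifs <;> positivity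
  have hw0 : ∀ k, k < q → 0 ≤ w k := fun k hk => by
    have : (0 : ℝ) ≤ q - k := by rw [sub_nonneg]; exact_mod_cast hk.le
    simp only [hw]; split_ifs <;> positivity
  have hw1 : ∀ k, k < q → w k ≤ 1 := fun k hk => by
    have h1 : (0 : ℝ) ≤ q - k := by rw [sub_nonneg]; exact_mod_cast hk.le
    have h2 : (0 : ℝ) ≤ k := by positivity
    simp only [hw]; split_ifs
    · exact le_rfl
    · rw [div_le_one (by positivity)]; nlinarith
  have hterm : ∀ a < q, u (b a) * w (b a) ≤ distInt (y + a * ω) := by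
    intro a ha
    by_cases hc : b a < 4 ∨ q < b a + 4
    · have : u (b a) = Real.exp (-q) := if_pos hc
      rw [this]
      exact (mul_le_of_le_one_right (Real.exp_pos _).le (hw1 _ (hblt a))).trans (hsep a ha)
    · have h1 : u (b a) = 1 := if_neg hc
      push Not at hc
      have h2 : w (b a) = b a * (q - b a : ℝ) / (2 * q ^ 2) := if_neg (by omega)
      rw [h1, one_mul, h2]
      have h4 : (4 : ℝ) ≤ b a := by exact_mod_cast hc.1
      have h5 : (b a : ℝ) + 4 ≤ q := by exact_mod_cast hc.2
      refine le_trans ?_ (hdist a ha)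
      have hd : (4 * (q - b a) + 0 : ℝ) ≤ b a * (q - b a) := by nlinarith
      have h6 : 4 / q ≤ distInt ((b a : ℝ) / q) := by
        apply le_distInt_of_between
        · gcongr
        · rw [le_sub_iff_add_le, ← add_div, div_le_one hq0']; linarith
      have h7 := mul_div_le_distInt (hblt a)
      have h8 : b a * (q - b a : ℝ) / (2 * q ^ 2) = (b a * (q - b a : ℝ) / q ^ 2) / 2 := by
        field_simp
      have h9 : (4 : ℝ) / q = 2 * (2 / q) := by ring
      rw [h8]; linarith
  have hu_prod : Real.exp (-(7 * q)) ≤ ∏ k ∈ Finset.range q, u k := by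
    have h1 : ∏ k ∈ Finset.range q, u k
        = Real.exp (-q) ^ ((Finset.range q).filter fun k => k < 4 ∨ q < k + 4).card := by
      rw [Finset.prod_ite, Finset.prod_const_one, mul_one, Finset.prod_const]
    have h2 : ((Finset.range q).filter fun k => k < 4 ∨ q < k + 4).card ≤ 7 := by
      calc _ ≤ (Finset.range 4 ∪ Finset.Ico (q - 3) q).card := by
            refine Finset.card_le_card fun k hk => ?_
            simp only [Finset.mem_filter, Finset.mem_range, Finset.mem_union, Finset.mem_Ico] at hk ⊢
            omega
        _ ≤ _ := (Finset.card_union_le _ _).trans (by simp; omega)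
    rw [h1]
    calc Real.exp (-(7 * q)) = Real.exp (-q) ^ 7 := by
          rw [← Real.exp_nat_mul]; congr 1; push_cast; ring
      _ ≤ _ := pow_le_pow_of_le_one (Real.exp_pos _).le (Real.exp_le_one_iff.2 (by linarith)) h2
  have hw_prod : Real.exp (-(3 * q)) ≤ ∏ k ∈ Finset.range q, w k := by
    obtain ⟨k, hk⟩ : ∃ k, q = k + 1 := ⟨q - 1, by omega⟩
    have h1 : ∏ i ∈ Finset.range q, w i = ((k.factorial : ℝ) * k.factorial) / (2 * q ^ 2) ^ k := by
      rw [hk, Finset.prod_range_succ']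
      have h2 : ∀ i ∈ Finset.range k, w (i + 1) = ((i + 1 : ℕ) : ℝ) * ((k - 1 - i + 1 : ℕ) : ℝ) / (2 * q ^ 2) := by
        intro i hi
        have hi' := Finset.mem_range.1 hi
        simp only [hw]
        rw [if_neg (by omega), hk]
        congr 2
        have : ((k + 1 : ℕ) : ℝ) - ((i + 1 : ℕ) : ℝ) = ((k + 1 - (i + 1) : ℕ) : ℝ) := by
          rw [Nat.cast_sub (by omega)]
        rw [this]; congr 1; omega
      rw [Finset.prod_congr rfl h2, Finset.prod_div_distrib, Finset.prod_mul_distrib,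
        Finset.prod_range_reflect (fun i => ((i + 1 : ℕ) : ℝ)) k, ← Nat.cast_prod,
        Finset.prod_range_add_one_eq_factorial]
      simp [hw, hk]
    have h3 := Real.pow_div_factorial_le_exp (q : ℝ) hq0'.le k
    have hf : (0 : ℝ) < k.factorial := by exact_mod_cast k.factorial_pos
    rw [div_le_iff₀ hf] at h3
    have h4 : (2 : ℝ) ^ k ≤ Real.exp q := by
      calc (2 : ℝ) ^ k ≤ Real.exp 1 ^ k := by
            gcongr
            linarith [Real.add_one_le_exp (1 : ℝ)]
        _ = Real.exp k := by rw [← Real.exp_nat_mul, mul_one]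
        _ ≤ _ := Real.exp_le_exp.2 (by rw [hk]; push_cast; linarith)
    rw [h1, le_div_iff₀ (by positivity), mul_pow, ← pow_mul, mul_comm 2 k, pow_mul, sq]
    calc Real.exp (-(3 * q)) * (2 ^ k * (q ^ k * q ^ k))
        ≤ Real.exp (-(3 * q)) * (Real.exp q * ((Real.exp q * k.factorial) * (Real.exp q * k.factorial))) := by
          gcongr
      _ = (Real.exp (-(3 * q)) * (Real.exp q * Real.exp q * Real.exp q)) * (k.factorial * k.factorial) := by
          ring
      _ = k.factorial * k.factorial := by
          rw [← Real.exp_add, ← Real.exp_add, ← Real.exp_add]; ring_nf; simp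
      _ ≤ _ := le_rfl
  calc Real.exp (-(10 * q)) = Real.exp (-(7 * q)) * Real.exp (-(3 * q)) := by
        rw [← Real.exp_add]; ring_nf
    _ ≤ (∏ k ∈ Finset.range q, u k) * ∏ k ∈ Finset.range q, w k := by gcongr
    _ = ∏ k ∈ Finset.range q, u k * w k := Finset.prod_mul_distrib.symm
    _ = ∏ k ∈ (Finset.range q).image b, u k * w k := by rw [himg]
    _ = ∏ a ∈ Finset.range q, u (b a) * w (b a) := Finset.prod_image hinj
    _ ≤ _ := Finset.prod_le_prod (fun a _ => mul_nonneg (hu0 _) (hw0 _ (hblt a)))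
        fun a ha => hterm a (Finset.mem_range.1 ha)

end Arithmetic

namespace StripPotential

variable {S : Type} [Fintype S] [MetricSpace S] [DecidableEq S] (P : StripPotential S)

/-- The phases for which all determinants along an orbit segment are atypically small are
contained in few exponentially small intervals. -/
theorem exists_centers :
    ∃ C4 : ℝ, 1 ≤ C4 ∧ ∃ lam1 : ℝ, 1 ≤ lam1 ∧ ∀ lam, lam1 ≤ lam → ∀ (N : ℕ) (ω E : ℝ),
      |E| ≤ lam * P.C1 → ∀ (r : ℚ) (R : ℕ), r.den ≤ R → |ω - r| ≤ 1 / (R * r.den) →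
        ∃ Z : Finset ℝ, (Z.card : ℝ) ≤ C4 * N * R ∧ ∀ x : ℝ,
          (∀ a < R, ‖P.det N lam ω E ((x + a * ω : ℝ) : ℂ)‖ < (lam ^ Fintype.card S / C4) ^ N) →
            ∃ w ∈ Z, distInt (x - w) < Real.exp (-r.den) := by
  classical
  obtain ⟨C3, hC3, lam1, hlam1, H⟩ := P.exists_zeros
  have hexp1 : 1 ≤ Real.exp (10 * C3) := Real.one_le_exp (by linarith)
  have hC34 : C3 ≤ C3 * Real.exp (10 * C3) := le_mul_of_one_le_right (by linarith) hexp1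
  refine ⟨C3 * Real.exp (10 * C3), hC3.trans hC34, lam1, hlam1, ?_⟩
  intro lam hlam N ω E hE r R hR hω
  obtain ⟨Z, hZ, hZb⟩ := H lam hlam N ω E hE
  have hl : 0 < lam := by linarith
  set d := Fintype.card S
  set q := r.den with hq
  have hq0 : 0 < q := r.pos
  refine ⟨(Z.toFinset ×ˢ Finset.range q).image fun t => t.1 - t.2 * ω, ?_, ?_⟩
  · have h1 : (((Z.toFinset ×ˢ Finset.range q).image fun t => t.1 - t.2 * ω).card : ℝ)
        ≤ Z.card * q := by
      have : ((Z.toFinset ×ˢ Finset.range q).image fun t => t.1 - t.2 * ω).card ≤ Z.card * q := by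
        refine Finset.card_image_le.trans ?_
        rw [Finset.card_product, Finset.card_range]
        exact Nat.mul_le_mul_right _ (Multiset.toFinset_card_le Z)
      exact_mod_cast this
    refine h1.trans ?_
    have hR' : (q : ℝ) ≤ R := by exact_mod_cast hR
    calc (Z.card : ℝ) * q ≤ (C3 * N) * R := by gcongr
      _ ≤ _ := by gcongr
  · intro x hx
    by_contra hcon
    push Not at hcon
    have hsep : ∀ w ∈ Z, Real.exp (-(10 * q)) ≤ ∏ a ∈ Finset.range q, distInt (x + a * ω - w) := by
      intro w hw
      have := exp_le_prod_range_distInt (y := x - w) hR hω fun a ha => by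
        have := hcon (w - a * ω) (Finset.mem_image.2 ⟨(w, a), Finset.mem_product.2
          ⟨Multiset.mem_toFinset.2 hw, Finset.mem_range.2 ha⟩, rfl⟩)
        rwa [show x - (w - a * ω) = x - w + a * ω by ring] at this
      refine this.trans (le_of_eq (Finset.prod_congr rfl fun a _ => ?_))
      congr 1; ring
    have h1 : ∏ a ∈ Finset.range q, ((lam ^ d / C3) ^ N * (Z.map fun w => distInt (x + a * ω - w)).prod)
        ≤ ∏ a ∈ Finset.range q, ‖P.det N lam ω E ((x + a * ω : ℝ) : ℂ)‖ :=
      Finset.prod_le_prod (fun a _ => mul_nonneg (by positivity) (Multiset.prod_map_distInt_nonneg _ _))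
        fun a _ => hZb _
    have h2 : ∏ a ∈ Finset.range q, ‖P.det N lam ω E ((x + a * ω : ℝ) : ℂ)‖
        < ∏ _a ∈ Finset.range q, (lam ^ d / (C3 * Real.exp (10 * C3))) ^ N := by
      by_cases h0 : ∃ a ∈ Finset.range q, ‖P.det N lam ω E ((x + a * ω : ℝ) : ℂ)‖ = 0
      · obtain ⟨a, ha, h0⟩ := h0
        rw [Finset.prod_eq_zero ha h0]
        exact Finset.prod_pos fun _ _ => by positivity
      · push Not at h0
        exact Finset.prod_lt_prod_of_nonempty
          (fun a ha => lt_of_le_of_ne (norm_nonneg _) (h0 a ha).symm)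
          (fun a ha => hx a ((Finset.mem_range.1 ha).trans_le hR)) ⟨0, Finset.mem_range.2 hq0⟩
    have h3 : Real.exp (-(10 * q)) ^ Z.card
        ≤ ∏ a ∈ Finset.range q, (Z.map fun w => distInt (x + a * ω - w)).prod := by
      rw [show ∏ a ∈ Finset.range q, (Z.map fun w => distInt (x + a * ω - w)).prod
          = (Z.map fun w => ∏ a ∈ Finset.range q, distInt (x + a * ω - w)).prod from
        Multiset.prod_map_prod_map (Finset.range q).val Z]
      have := Multiset.prod_map_le_prod_map₀ (s := Z) (fun _ => Real.exp (-(10 * q)))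
        (fun w => ∏ a ∈ Finset.range q, distInt (x + a * ω - w))
        (fun _ _ => (Real.exp_pos _).le) hsep
      simpa using this
    have h4 := h1.trans_lt h2
    rw [Finset.prod_mul_distrib, Finset.prod_const, Finset.prod_const, Finset.card_range] at h4
    have h5 : ((lam ^ d / (C3 * Real.exp (10 * C3))) ^ N) ^ q
        ≤ ((lam ^ d / C3) ^ N) ^ q * Real.exp (-(10 * q)) ^ Z.card := by
      have e1 : Real.exp (-(10 * q)) ^ Z.card = Real.exp (-(10 * q * Z.card)) := by
        rw [← Real.exp_nat_mul]; congr 1; ring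
      have e2 : ((lam ^ d / (C3 * Real.exp (10 * C3))) ^ N) ^ q
          = ((lam ^ d / C3) ^ N) ^ q * Real.exp (-(10 * q * (C3 * N))) := by
        rw [← div_div, div_pow, div_pow, div_eq_mul_inv, ← Real.exp_nat_mul, ← Real.exp_nat_mul,
          ← Real.exp_neg]
        congr 2; ring
      rw [e1, e2]
      gcongr
    have h6 := mul_le_mul_of_nonneg_left h3 (show 0 ≤ ((lam ^ d / C3) ^ N) ^ q by positivity)
    linarith

end StripPotential

/-- The character `x ↦ exp (2 π i n x)`. -/
def expChar (n : ℤ) (x : ℝ) : ℂ := Complex.exp (2 * Real.pi * Complex.I * n * x)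

theorem norm_expChar (n : ℤ) (x : ℝ) : ‖expChar n x‖ = 1 := by
  rw [expChar, show 2 * Real.pi * Complex.I * n * x = ((2 * Real.pi * n * x : ℝ) : ℂ) * Complex.I by
    push_cast; ring]
  exact Complex.norm_exp_ofReal_mul_I _

theorem expChar_add (n : ℤ) (x y : ℝ) : expChar n (x + y) = expChar n x * expChar n y := by
  rw [expChar, expChar, expChar, ← Complex.exp_add]; congr 1; push_cast; ring

theorem expChar_add_index (m n : ℤ) (x : ℝ) : expChar (m + n) x = expChar m x * expChar n x := by
  rw [expChar, expChar, expChar, ← Complex.exp_add]; congr 1; push_cast; ring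

theorem expChar_mul_int (n k : ℤ) (x : ℝ) : expChar n (k * x) = expChar (n * k) x := by
  rw [expChar, expChar]; congr 1; push_cast; ring

theorem integral_eq_integral_add_of_periodic {ρ : ℝ} {G : ℂ → ℂ}
    (hG : DifferentiableOn ℂ G {z | |z.im| < ρ}) (hper : ∀ z, G (z + 1) = G z) {y : ℝ}
    (hy : |y| < ρ) :
    ∫ x in (0 : ℝ)..1, G x = ∫ x in (0 : ℝ)..1, G (x + y * Complex.I) := by
  have h := Complex.integral_boundary_rect_eq_zero_of_differentiableOn G 0 (1 + y * Complex.I)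
    (hG.mono fun z hz => by
      have h2 := (Complex.mem_reProdIm.1 hz).2
      simp only [Complex.zero_im, Complex.add_im, Complex.one_im, zero_add,
        Complex.mul_im, Complex.ofReal_re, Complex.I_im, mul_one, Complex.ofReal_im,
        Complex.I_re, mul_zero, add_zero] at h2
      have := Set.abs_sub_left_of_mem_uIcc h2
      simp only [sub_zero] at this
      exact this.trans_lt hy)
  simp only [Complex.zero_re, Complex.zero_im, Complex.add_re, Complex.add_im, Complex.one_re,
    Complex.one_im, Complex.mul_re, Complex.mul_im, Complex.ofReal_re, Complex.ofReal_im,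
    Complex.I_re, Complex.I_im, mul_zero, zero_mul, sub_zero, add_zero, zero_add, mul_one,
    Complex.ofReal_zero, Complex.ofReal_one] at h
  have h3 : ∀ t : ℝ, G (1 + t * Complex.I) = G (t * Complex.I) := fun t => by
    rw [add_comm]; exact hper _
  simp only [h3, add_sub_cancel_right] at h
  exact sub_eq_zero.1 h

theorem norm_integral_mul_expChar_le {ρ B : ℝ} {F : ℂ → ℂ}
    (hF : DifferentiableOn ℂ F {z | |z.im| < ρ}) (hper : ∀ z, F (z + 1) = F z)
    (hB : ∀ z, |z.im| < ρ → ‖F z‖ ≤ B) {y : ℝ} (hy0 : 0 ≤ y) (hy : y < ρ) (n : ℤ) :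
    ‖∫ x in (0 : ℝ)..1, expChar (-n) x * F x‖ ≤ B * Real.exp (-(2 * Real.pi * y)) ^ n.natAbs := by
  set G : ℂ → ℂ := fun z => Complex.exp (2 * Real.pi * Complex.I * (-n : ℤ) * z) * F z with hGdef
  have hG : DifferentiableOn ℂ G {z | |z.im| < ρ} := by
    refine DifferentiableOn.mul ?_ hF
    fun_prop
  have hGper : ∀ z, G (z + 1) = G z := fun z => by
    simp only [hGdef, hper]
    congr 1
    rw [mul_add, Complex.exp_add, mul_one,
      show 2 * Real.pi * Complex.I * ((-n : ℤ) : ℂ) = ((-n : ℤ) : ℂ) * (2 * Real.pi * Complex.I) by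
        ring, Complex.exp_int_mul_two_pi_mul_I, mul_one]
  have key : ∀ t : ℝ, |t| < ρ → ‖∫ x in (0 : ℝ)..1, expChar (-n) x * F x‖
      ≤ Real.exp (2 * Real.pi * n * t) * B := by
    intro t ht
    have h1 := integral_eq_integral_add_of_periodic hG hGper ht
    have h2 : ∫ x in (0 : ℝ)..1, expChar (-n) x * F x = ∫ x in (0 : ℝ)..1, G x := rfl
    rw [h2, h1]
    refine (intervalIntegral.norm_integral_le_of_norm_le_const
      (C := Real.exp (2 * Real.pi * n * t) * B) fun x _ => ?_).trans (by simp)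
    simp only [hGdef, norm_mul]
    refine mul_le_mul (le_of_eq ?_) (hB _ (by simpa using ht)) (norm_nonneg _)
      (Real.exp_pos _).le
    rw [Complex.norm_exp]
    congr 1
    simp [Complex.mul_re, Complex.mul_im]
  rw [← Real.exp_nat_mul]
  rcases le_total 0 n with hn | hn
  · refine (key (-y) (by rwa [abs_neg, abs_of_nonneg hy0])).trans (le_of_eq ?_)
    have : ((n.natAbs : ℕ) : ℝ) = n := by rw [Nat.cast_natAbs, abs_of_nonneg hn]
    rw [this, mul_comm]; congr 2; ring
  · refine (key y (by rwa [abs_of_nonneg hy0])).trans (le_of_eq ?_)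
    have : ((n.natAbs : ℕ) : ℝ) = -n := by
      rw [Nat.cast_natAbs, abs_of_nonpos hn]; push_cast; ring
    rw [this, mul_comm]; congr 2; ring

theorem summable_pow_natAbs {r : ℝ} (hr0 : 0 ≤ r) (hr : r < 1) :
    Summable fun n : ℤ => r ^ n.natAbs := by
  refine Summable.of_nat_of_neg ?_ ?_ <;> simpa using summable_geometric_of_lt_one hr0 hr

/-- Real trigonometric polynomials approximate a periodic analytic function exponentially well. -/
theorem exists_trigPoly_approx {ρ B : ℝ} (hρ : 0 < ρ) (f : ℝ → ℝ) {F : ℂ → ℂ}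
    (hF : DifferentiableOn ℂ F {z | |z.im| < ρ}) (hFf : ∀ x : ℝ, F x = f x)
    (hper : ∀ z, F (z + 1) = F z) (hB : ∀ z, |z.im| < ρ → ‖F z‖ ≤ B) :
    ∃ c > 0, ∃ C, ∀ τ : ℕ, ∃ (g : ℝ → ℝ) (b : ℤ → ℂ),
      (∀ x, (g x : ℂ) = ∑ n ∈ Finset.Icc (-τ : ℤ) τ, b n * expChar n x) ∧
      ∀ x, |f x - g x| ≤ C * Real.exp (-c * τ) := by
  have hcont : Continuous fun x : ℝ => F x := by
    have : Continuous fun x : ℝ => (x : ℂ) := Complex.continuous_ofReal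
    exact hF.continuousOn.comp_continuous this fun x => by simpa using hρ
  have hperR : Function.Periodic (fun x : ℝ => F x) 1 := fun x => by
    simpa using hper x
  let Φ : C(AddCircle (1 : ℝ), ℂ) := ⟨hperR.lift, continuous_coinduced_dom.2 hcont⟩
  have hΦ : ∀ x : ℝ, Φ (x : AddCircle (1 : ℝ)) = F x := fun x => rfl
  have hfour : ∀ (n : ℤ) (x : ℝ), fourier n (x : AddCircle (1 : ℝ)) = expChar n x := fun n x => by
    rw [fourier_coe_apply, expChar]; congr 1; simp
  set r : ℝ := Real.exp (-(Real.pi * (ρ / 2))) with hr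
  have hr0 : 0 < r := Real.exp_pos _
  have hr1 : r < 1 := by
    rw [hr, Real.exp_lt_one_iff]
    have := Real.pi_pos
    have : 0 < Real.pi * (ρ / 2) := by positivity
    linarith
  have hr2 : Real.exp (-(2 * Real.pi * (ρ / 2))) = r * r := by
    rw [hr, ← Real.exp_add]; congr 1; ring
  have hB0 : 0 ≤ B := (norm_nonneg _).trans (hB 0 (by simpa using hρ))
  have hcoef : ∀ n : ℤ, ‖fourierCoeff Φ n‖ ≤ B * (r ^ n.natAbs * r ^ n.natAbs) := by
    intro n
    rw [fourierCoeff_eq_intervalIntegral _ _ 0]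
    have := norm_integral_mul_expChar_le hF hper hB (y := ρ / 2) (by linarith) (by linarith) n
    rw [hr2, mul_pow] at this
    simpa [hΦ, hfour] using this
  have hle1 : ∀ k : ℕ, r ^ k ≤ 1 := fun k => pow_le_one₀ hr0.le hr1.le
  have hsr := summable_pow_natAbs hr0.le hr1
  have hsum : Summable (fourierCoeff Φ) := by
    refine Summable.of_norm_bounded (hsr.mul_left B) fun n => (hcoef n).trans ?_
    have := hle1 n.natAbs
    have h2 : 0 ≤ r ^ n.natAbs := by positivity
    refine mul_le_mul_of_nonneg_left (by nlinarith) hB0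
  refine ⟨Real.pi * (ρ / 2), by positivity, B * ∑' n : ℤ, r ^ n.natAbs, fun τ => ?_⟩
  set p : ℝ → ℂ := fun x => ∑ n ∈ Finset.Icc (-τ : ℤ) τ, fourierCoeff Φ n * expChar n x with hp
  have herr : ∀ x : ℝ, ‖F x - p x‖ ≤ B * (∑' n : ℤ, r ^ n.natAbs) * r ^ τ := by
    intro x
    have h1 := has_pointwise_sum_fourier_series_of_summable hsum (x : AddCircle (1 : ℝ))
    simp only [hΦ, hfour, smul_eq_mul] at h1
    have h2 := h1.sub (hasSum_sum_of_ne_finset_zero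
      (f := fun n => if n ∈ Finset.Icc (-τ : ℤ) τ then fourierCoeff Φ n * expChar n x else 0)
      (s := Finset.Icc (-τ : ℤ) τ) fun n hn => if_neg hn)
    have h3 : ∑ n ∈ Finset.Icc (-τ : ℤ) τ,
        (if n ∈ Finset.Icc (-τ : ℤ) τ then fourierCoeff Φ n * expChar n x else 0) = p x :=
      Finset.sum_congr rfl fun n hn => if_pos hn
    rw [h3] at h2
    have h4 := (hsr.hasSum.mul_left B).mul_right (r ^ τ)
    refine h2.norm_le_of_bounded h4 fun n => ?_
    split_ifs with hn
    · simp only [sub_self, norm_zero]; positivity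
    · rw [sub_zero, norm_mul, norm_expChar, mul_one]
      refine (hcoef n).trans ?_
      rw [mul_assoc]
      refine mul_le_mul_of_nonneg_left (mul_le_mul_of_nonneg_left ?_ (by positivity)) hB0
      refine pow_le_pow_of_le_one hr0.le hr1.le ?_
      rw [Finset.mem_Icc] at hn
      omega
  have hreal : ∀ n x, ((((fourierCoeff Φ n * expChar n x).re : ℝ)) : ℂ)
      = fourierCoeff Φ n / 2 * expChar n x + (starRingEnd ℂ) (fourierCoeff Φ n) / 2 * expChar (-n) x := by
    intro n x
    have : (starRingEnd ℂ) (expChar n x) = expChar (-n) x := by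
      rw [expChar, expChar, ← Complex.exp_conj]; congr 1
      have : (starRingEnd ℂ) 2 = 2 := Complex.conj_ofNat 2
      simp [this]
    rw [Complex.re_eq_add_conj, map_mul, this]; ring
  refine ⟨fun x => (p x).re, fun n => fourierCoeff Φ n / 2
    + (starRingEnd ℂ) (fourierCoeff Φ (-n)) / 2, fun x => ?_, fun x => ?_⟩
  · simp only [hp, Complex.re_sum, Complex.ofReal_sum, hreal, Finset.sum_add_distrib, add_mul]
    congr 1
    refine Finset.sum_nbij' (fun n => -n) (fun n => -n) ?_ ?_ ?_ ?_ ?_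
    · intro n hn; simp only [Finset.mem_Icc] at hn ⊢; omega
    · intro n hn; simp only [Finset.mem_Icc] at hn ⊢; omega
    · simp
    · simp
    · simp
  · have h := (Complex.abs_re_le_norm (F x - p x)).trans (herr x)
    rw [hFf, Complex.sub_re, Complex.ofReal_re] at h
    refine h.trans (le_of_eq ?_)
    rw [hr, ← Real.exp_nat_mul]; congr 2; ring

namespace StripPotential
variable {S : Type} [Fintype S] [MetricSpace S] [DecidableEq S] (P : StripPotential S)

theorem exists_trigPoly_approx :
    ∃ c > 0, ∃ C, 0 ≤ C ∧ ∀ τ : ℕ, ∃ (g : S → ℝ → ℝ) (b : S → ℤ → ℂ),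
      (∀ s x, (g s x : ℂ) = ∑ n ∈ Finset.Icc (-τ : ℤ) τ, b s n * expChar n x) ∧
      ∀ s x, |P.f s x - g s x| ≤ C * Real.exp (-c * τ) := by
  have h := fun s => _root_.exists_trigPoly_approx P.ρ_pos (P.f s) (P.differentiableOn s)
    (P.F_ofReal s) (P.F_add_one s) (P.norm_F_le s)
  choose c hc C hC using h
  rcases isEmpty_or_nonempty S with hS | hS
  · exact ⟨1, one_pos, 0, le_rfl, fun τ => ⟨fun s => isEmptyElim s, fun s => isEmptyElim s,
      fun s => isEmptyElim s, fun s => isEmptyElim s⟩⟩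
  obtain ⟨s0, hs0⟩ := Finite.exists_min c
  refine ⟨c s0, hc s0, ∑ s, |C s|, Finset.sum_nonneg fun _ _ => abs_nonneg _, fun τ => ?_⟩
  choose g b hb hg using fun s => hC s τ
  refine ⟨g, b, hb, fun s x => (hg s x).trans ?_⟩
  have h1 : C s ≤ ∑ s, |C s| := (le_abs_self _).trans
    (Finset.single_le_sum (f := fun s => |C s|) (fun _ _ => abs_nonneg _) (Finset.mem_univ s))
  have h2 : Real.exp (-c s * τ) ≤ Real.exp (-c s0 * τ) := by
    have := hs0 s
    have h3 : (0 : ℝ) ≤ τ := by positivity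
    exact Real.exp_le_exp.2 (by nlinarith)
  exact mul_le_mul h1 h2 (Real.exp_pos _).le (Finset.sum_nonneg fun _ _ => abs_nonneg _)

end StripPotential

/-- A multiplicative filtration of a commutative ring by additive subgroups. -/
structure IsMulFiltration {A : Type*} [CommRing A] (F : ℕ → AddSubgroup A) : Prop where
  one_mem : 1 ∈ F 0
  mono : Monotone F
  mul_mem : ∀ {m n a b}, a ∈ F m → b ∈ F n → a * b ∈ F (m + n)

namespace IsMulFiltration

variable {A : Type*} [CommRing A] {F : ℕ → AddSubgroup A}

theorem prod_mem (hF : IsMulFiltration F) {ι : Type*} (s : Finset ι) {g : ι → A} {D : ℕ}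
    (h : ∀ i ∈ s, g i ∈ F D) : ∏ i ∈ s, g i ∈ F (s.card * D) := by
  classical
  induction s using Finset.induction_on with
  | empty => simpa using hF.one_mem
  | insert a s ha ih =>
    rw [Finset.prod_insert ha, Finset.card_insert_of_notMem ha, add_mul, one_mul, add_comm]
    exact hF.mul_mem (h a (Finset.mem_insert_self _ _)) (ih fun i hi => h i (Finset.mem_insert_of_mem hi))

theorem det_mem (hF : IsMulFiltration F) {n : Type*} [Fintype n] [DecidableEq n]
    {M : Matrix n n A} {D : ℕ} (h : ∀ i j, M i j ∈ F D) : M.det ∈ F (Fintype.card n * D) := by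
  rw [Matrix.det_apply]
  refine sum_mem fun σ _ => ?_
  have : ∏ i, M (σ i) i ∈ F (Fintype.card n * D) := hF.prod_mem Finset.univ fun i _ => h _ _
  rcases Int.units_eq_one_or (Equiv.Perm.sign σ) with h1 | h1 <;> rw [h1]
  · simpa using this
  · simpa using this

theorem matrix_pow_mem (hF : IsMulFiltration F) {n : Type*} [Fintype n] [DecidableEq n]
    {M : Matrix n n A} {D : ℕ} (h : ∀ i j, M i j ∈ F D) (k : ℕ) (i j : n) :
    (M ^ k) i j ∈ F (k * D) := by
  induction k generalizing i j with
  | zero =>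
    rw [pow_zero, zero_mul, Matrix.one_apply]
    split_ifs
    exacts [hF.one_mem, zero_mem _]
  | succ k ih =>
    rw [pow_succ, Matrix.mul_apply, add_mul, one_mul]
    exact sum_mem fun l _ => hF.mul_mem (ih i l) (h l j)

/-- Polynomials all of whose coefficients lie in the given step of the filtration. -/
def poly (F : ℕ → AddSubgroup A) (D : ℕ) : AddSubgroup (Polynomial A) where
  carrier := {p | ∀ i, p.coeff i ∈ F D}
  zero_mem' := fun i => by simp
  add_mem' := fun ha hb i => by simpa using add_mem (ha i) (hb i)
  neg_mem' := fun ha i => by simpa using ha i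

theorem poly_isMulFiltration (hF : IsMulFiltration F) : IsMulFiltration (poly F) where
  one_mem := fun i => by
    rw [Polynomial.coeff_one]
    split_ifs
    exacts [hF.one_mem, zero_mem _]
  mono := fun m n hmn p hp i => hF.mono hmn (hp i)
  mul_mem := fun ha hb i => by
    rw [Polynomial.coeff_mul]
    exact sum_mem fun x _ => hF.mul_mem (ha _) (hb _)

theorem charpoly_mem (hF : IsMulFiltration F) {n : Type*} [Fintype n] [DecidableEq n]
    {M : Matrix n n A} {D : ℕ} (h : ∀ i j, M i j ∈ F D) :
    M.charpoly ∈ poly F (Fintype.card n * D) := by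
  refine hF.poly_isMulFiltration.det_mem fun i j k => ?_
  have h1 : ((if i = j then (Polynomial.X : Polynomial A) else 0).coeff k) ∈ F D := by
    split_ifs
    · rw [Polynomial.coeff_X]
      split_ifs
      exacts [hF.mono (Nat.zero_le _) hF.one_mem, zero_mem _]
    · simp
  have h2 : (Polynomial.C (M i j)).coeff k ∈ F D := by
    rw [Polynomial.coeff_C]
    split_ifs
    exacts [h i j, zero_mem _]
  rw [Matrix.charmatrix_apply, Matrix.diagonal_apply, Polynomial.coeff_sub]
  exact sub_mem h1 h2

theorem aeval_mem (hF : IsMulFiltration F) {n : Type*} [Fintype n] [DecidableEq n]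
    {M : Matrix n n A} {D c N : ℕ} (h : ∀ i j, M i j ∈ F D) {p : Polynomial A} (hp : p ∈ poly F c)
    (hN : p.natDegree ≤ N) (i j : n) : (Polynomial.aeval M p) i j ∈ F (c + N * D) := by
  rw [Polynomial.aeval_eq_sum_range, Matrix.sum_apply]
  refine sum_mem fun k hk => ?_
  rw [Matrix.smul_apply, smul_eq_mul]
  refine hF.mono ?_ (hF.mul_mem (hp k) (hF.matrix_pow_mem h k i j))
  have : k ≤ N := by rw [Finset.mem_range] at hk; omega
  gcongr

end IsMulFiltration

/-- Trigonometric polynomials of degree at most `D`. -/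
def trigPoly (D : ℕ) : Submodule ℂ (ℝ → ℂ) :=
  Submodule.span ℂ {g | ∃ n : ℤ, n.natAbs ≤ D ∧ g = expChar n}

theorem expChar_mem_trigPoly {n : ℤ} {D : ℕ} (h : n.natAbs ≤ D) : expChar n ∈ trigPoly D :=
  Submodule.subset_span ⟨n, h, rfl⟩

theorem isMulFiltration_trigPoly :
    IsMulFiltration fun D => (trigPoly D).toAddSubgroup where
  one_mem := by
    have : (1 : ℝ → ℂ) = expChar 0 := by ext x; simp [expChar]
    rw [this]
    exact expChar_mem_trigPoly (by simp)
  mono := fun m n hmn => Submodule.span_mono fun g ⟨k, hk, hg⟩ => ⟨k, hk.trans hmn, hg⟩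
  mul_mem := fun {m n a b} ha hb => by
    have h : a * b ∈ trigPoly m * trigPoly n := Submodule.mul_mem_mul ha hb
    rw [trigPoly, trigPoly, Submodule.span_mul_span] at h
    refine Submodule.span_mono ?_ h
    rintro _ ⟨_, ⟨k, hk, rfl⟩, _, ⟨l, hl, rfl⟩, rfl⟩
    refine ⟨k + l, (Int.natAbs_add_le k l).trans (by omega), ?_⟩
    ext x
    exact (expChar_add_index k l x).symm

theorem const_mem_trigPoly (c : ℂ) (D : ℕ) : (fun _ => c : ℝ → ℂ) ∈ trigPoly D := by
  have : (fun _ => c : ℝ → ℂ) = c • expChar 0 := by ext x; simp [expChar]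
  rw [this]
  exact Submodule.smul_mem _ _ (expChar_mem_trigPoly (by simp))

theorem exists_polynomial_of_mem_trigPoly {D : ℕ} {g : ℝ → ℂ} (hg : g ∈ trigPoly D) :
    ∃ p : Polynomial ℂ, p.natDegree ≤ 2 * D ∧ ∀ x, expChar D x * g x = p.eval (expChar 1 x) := by
  induction hg using Submodule.span_induction with
  | mem g hg =>
    obtain ⟨n, hn, rfl⟩ := hg
    refine ⟨Polynomial.X ^ (D + n).toNat, ?_, fun x => ?_⟩
    · rw [Polynomial.natDegree_X_pow]; omega
    · rw [← expChar_add_index, Polynomial.eval_pow, Polynomial.eval_X, expChar, expChar,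
        ← Complex.exp_nat_mul]
      congr 1
      have : (((D + n).toNat : ℕ) : ℂ) = ((D + n : ℤ) : ℂ) := by
        rw [← Int.cast_natCast, Int.toNat_of_nonneg (by omega)]
      rw [this]; push_cast; ring
  | zero => exact ⟨0, by simp, by simp⟩
  | add g h _ _ ihg ihh =>
    obtain ⟨p, hp, hp'⟩ := ihg
    obtain ⟨q, hq, hq'⟩ := ihh
    exact ⟨p + q, Polynomial.natDegree_add_le_of_degree_le hp hq, fun x => by
      rw [Polynomial.eval_add, ← hp', ← hq', Pi.add_apply]; ring⟩
  | smul c g _ ih =>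
    obtain ⟨p, hp, hp'⟩ := ih
    exact ⟨c • p, (Polynomial.natDegree_smul_le _ _).trans hp, fun x => by
      rw [Polynomial.eval_smul, ← hp', Pi.smul_apply, smul_eq_mul, smul_eq_mul]; ring⟩

theorem injOn_expChar_one : Set.InjOn (expChar 1) (Set.Ico 0 1) := by
  intro x hx y hy h
  rw [expChar, expChar, Complex.exp_eq_exp_iff_exists_int] at h
  obtain ⟨n, hn⟩ := h
  have h1 : (2 * Real.pi * Complex.I) * (x : ℂ) = (2 * Real.pi * Complex.I) * ((y + n : ℝ) : ℂ) := by
    push_cast at hn ⊢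
    linear_combination hn
  have h2 := mul_left_cancel₀ Complex.two_pi_I_ne_zero h1
  have h3 : x = y + n := by exact_mod_cast h2
  have h4 : (n : ℝ) < 1 := by linarith [hx.2, hy.1]
  have h5 : (-1 : ℝ) < n := by linarith [hx.1, hy.2]
  have h6 : n = 0 := by
    have : n < 1 := by exact_mod_cast h4
    have : -1 < n := by exact_mod_cast h5
    omega
  simpa [h6] using h3

theorem exists_zeros_of_mem_trigPoly {D : ℕ} {g : ℝ → ℂ} (hg : g ∈ trigPoly D)
    (h0 : ∃ x, g x ≠ 0) :
    ∃ Z : Finset ℝ, Z.card ≤ 2 * D ∧ ∀ x ∈ Set.Ico (0 : ℝ) 1, g x = 0 → x ∈ Z := by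
  classical
  obtain ⟨p, hp, hpe⟩ := exists_polynomial_of_mem_trigPoly hg
  obtain ⟨x0, hx0⟩ := h0
  have hp0 : p ≠ 0 := by
    rintro rfl
    have := hpe x0
    rw [Polynomial.eval_zero, mul_eq_zero] at this
    rcases this with h | h
    · have := norm_expChar D x0
      rw [h] at this; simp at this
    · exact hx0 h
  have hmaps : Set.MapsTo (expChar 1) {x | x ∈ Set.Ico (0 : ℝ) 1 ∧ g x = 0} (p.roots.toFinset : Set ℂ) := by
    intro x hx
    simp only [Finset.mem_coe, Multiset.mem_toFinset, Polynomial.mem_roots hp0, Polynomial.IsRoot]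
    rw [← hpe, hx.2, mul_zero]
  have hinj : Set.InjOn (expChar 1) {x | x ∈ Set.Ico (0 : ℝ) 1 ∧ g x = 0} :=
    injOn_expChar_one.mono fun x hx => hx.1
  have hfin : {x | x ∈ Set.Ico (0 : ℝ) 1 ∧ g x = 0}.Finite :=
    Set.Finite.of_injOn hmaps hinj (Finset.finite_toSet _)
  refine ⟨hfin.toFinset, ?_, fun x hx h => by simpa using ⟨hx, h⟩⟩
  calc hfin.toFinset.card ≤ p.roots.toFinset.card :=
        Finset.card_le_card_of_injOn (expChar 1) (fun x hx => hmaps (by simpa using hx))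
          (hinj.mono fun x hx => by simpa using hx)
    _ ≤ p.roots.card := Multiset.toFinset_card_le _
    _ ≤ _ := (Polynomial.card_roots' p).trans hp

open Matrix Topology in
/-- Vanishes iff the square of the characteristic polynomial of `H` takes the value `c` at some
eigenvalue of `M`. -/
def crossDet {A n l : Type*} [CommRing A] [Fintype n] [DecidableEq n] [Fintype l] [DecidableEq l]
    (M : Matrix n n A) (H : Matrix l l A) (c : A) : A :=
  (Polynomial.aeval M (H.charpoly ^ 2) - Matrix.scalar n c).det

section CrossDet

variable {A A' n l : Type*} [CommRing A] [CommRing A'] [Fintype n] [DecidableEq n] [Fintype l]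
  [DecidableEq l]

theorem map_crossDet (φ : A →+* A') (M : Matrix n n A) (H : Matrix l l A) (c : A) :
    φ (crossDet M H c) = crossDet (M.map φ) (H.map φ) (φ c) := by
  rw [crossDet, crossDet, RingHom.map_det]
  congr 1
  rw [map_sub]
  congr 1
  · rw [Matrix.charpoly_map, ← Polynomial.map_pow, Polynomial.aeval_eq_sum_range,
      Polynomial.aeval_def, Polynomial.eval₂_map, Polynomial.eval₂_eq_sum_range, map_sum]
    refine Finset.sum_congr rfl fun i _ => ?_
    ext a b
    simp only [RingHom.mapMatrix_apply, Matrix.map_apply, Matrix.smul_apply, smul_eq_mul, map_mul,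
      RingHom.comp_apply, Matrix.algebraMap_eq_diagonal, Matrix.diagonal_mul, Pi.algebraMap_apply,
      Algebra.algebraMap_self, RingHom.id_apply]
    congr 1
    rw [← Matrix.map_apply (f := φ), ← RingHom.mapMatrix_apply, map_pow]
    rfl
  · ext a b
    by_cases h : a = b <;> simp [Matrix.scalar_apply, h]

theorem IsMulFiltration.crossDet_mem [Nontrivial A] {F : ℕ → AddSubgroup A}
    (hF : IsMulFiltration F) {M : Matrix n n A} {H : Matrix l l A} {c : A} {D D' : ℕ}
    (hM : ∀ i j, M i j ∈ F D) (hH : ∀ i j, H i j ∈ F D') (hc : c ∈ F 0) :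
    crossDet M H c ∈ F (Fintype.card n * (2 * (Fintype.card l * D') + 2 * Fintype.card l * D)) := by
  refine hF.det_mem fun i j => ?_
  rw [Matrix.sub_apply]
  refine sub_mem ?_ ?_
  · refine hF.aeval_mem hM ?_ ?_ i j
    · rw [pow_two, two_mul]
      exact hF.poly_isMulFiltration.mul_mem (hF.charpoly_mem hH) (hF.charpoly_mem hH)
    · refine (Polynomial.natDegree_pow_le).trans ?_
      rw [Matrix.charpoly_natDegree_eq_dim]
  · rw [Matrix.scalar_apply, Matrix.diagonal_apply]
    split_ifs
    exacts [hF.mono (Nat.zero_le _) hc, zero_mem _]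

theorem finite_setOf_crossDet_eq_zero {K : Type*} [Field K] (M : Matrix n n K) (H : Matrix l l K) :
    {c : K | crossDet M H c = 0}.Finite := by
  classical
  set X := Polynomial.aeval M (H.charpoly ^ 2) with hX
  have h0 : X.charpoly ≠ 0 := X.charpoly_monic.ne_zero
  refine (X.charpoly.roots.toFinset.finite_toSet).subset fun c hc => ?_
  have h1 : (X - Matrix.scalar n c).det = 0 := hc
  simp only [Finset.mem_coe, Multiset.mem_toFinset, Polynomial.mem_roots h0, Polynomial.IsRoot]
  rw [Matrix.eval_charpoly, ← neg_sub, Matrix.det_neg, h1, mul_zero]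

theorem crossDet_eq_zero {K : Type*} [Field K] {M : Matrix n n K} {H : Matrix l l K} {E : K}
    {v : n → K} (hv : v ≠ 0) (hE : M.mulVec v = E • v) :
    crossDet M H (H.charpoly.eval E ^ 2) = 0 := by
  refine Matrix.exists_mulVec_eq_zero_iff.1 ⟨v, hv, ?_⟩
  have h1 : ∀ p : Polynomial K, (Polynomial.aeval M p).mulVec v = p.eval E • v := by
    intro p
    induction p using Polynomial.induction_on with
    | C a => simp [Matrix.algebraMap_eq_diagonal, Matrix.mulVec_diagonal, funext_iff]
    | add p q hp hq => rw [map_add, Matrix.add_mulVec, hp, hq, Polynomial.eval_add, add_smul]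
    | monomial k a ih =>
      rw [pow_succ, ← mul_assoc, map_mul, Polynomial.aeval_X, ← Matrix.mulVec_mulVec, hE,
        Matrix.mulVec_smul, ih, Polynomial.eval_mul_X, mul_smul, smul_comm]
  rw [Matrix.sub_mulVec, h1, Polynomial.eval_pow, sub_eq_zero]
  ext i
  simp [Matrix.scalar_apply, Matrix.mulVec_diagonal]

end CrossDet

section Hermitian

variable {n l : Type*} [Fintype n] [DecidableEq n] [Fintype l] [DecidableEq l]

theorem Matrix.IsHermitian.eval_charpoly_sq {H : Matrix l l ℂ} (hH : H.IsHermitian) (E : ℝ) :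
    H.charpoly.eval (E : ℂ) ^ 2 = ((‖(H - (E : ℂ) • (1 : Matrix l l ℂ)).det‖ ^ 2 : ℝ) : ℂ) := by
  set X := H - (E : ℂ) • (1 : Matrix l l ℂ) with hX
  have h1 : H.charpoly.eval (E : ℂ) ^ 2 = X.det ^ 2 := by
    have : Matrix.scalar l (E : ℂ) - H = -X := by
      rw [hX, neg_sub]; congr 1; ext i j; simp [Matrix.scalar_apply, Matrix.one_apply, Matrix.diagonal_apply]
    rw [Matrix.eval_charpoly, this, Matrix.det_neg, mul_pow, ← pow_mul, mul_comm, mul_comm (Fintype.card l),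
      pow_mul]
    simp
  have h2 : (starRingEnd ℂ) X.det = X.det := by
    have h3 : X.IsHermitian := by
      refine hH.sub ?_
      rw [Matrix.IsHermitian, Matrix.conjTranspose_smul, Matrix.conjTranspose_one]
      simp
    have := Matrix.det_conjTranspose X
    rw [h3.eq] at this
    exact this.symm
  obtain ⟨r, hr⟩ := Complex.conj_eq_iff_real.1 h2
  rw [h1, hr, Complex.norm_real, Real.norm_eq_abs, sq_abs]
  push_cast; rfl

theorem Matrix.IsHermitian.crossDet_eq_zero {M : Matrix n n ℂ} {H : Matrix l l ℂ}
    (hM : M.IsHermitian) (hH : H.IsHermitian) (i : n) :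
    crossDet M H ((‖(H - (hM.eigenvalues i : ℂ) • (1 : Matrix l l ℂ)).det‖ ^ 2 : ℝ) : ℂ) = 0 := by
  rw [← hH.eval_charpoly_sq]
  have h0 : (hM.eigenvectorBasis i : n → ℂ) ≠ 0 := by
    intro h
    have := hM.eigenvectorBasis.orthonormal.1 i
    have h2 : hM.eigenvectorBasis i = 0 := by ext j; exact congrFun h j
    rw [h2, norm_zero] at this
    exact zero_ne_one this
  exact _root_.crossDet_eq_zero h0 (hM.mulVec_eigenvectorBasis i)

theorem Matrix.IsHermitian.exists_eigenvalue_sub_le {A B : Matrix n n ℂ} (hA : A.IsHermitian)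
    (hB : B.IsHermitian) {δ : ℝ} (hδ : 0 ≤ δ) (h : ∀ i j, ‖A i j - B i j‖ ≤ δ) (i : n) :
    ∃ j, |hB.eigenvalues j - hA.eigenvalues i| ≤ Fintype.card n * δ := by
  set v : n → ℂ := ⇑(hA.eigenvectorBasis i) with hv
  have h0 : v ≠ 0 := by
    intro h
    have := hA.eigenvectorBasis.orthonormal.1 i
    have h2 : hA.eigenvectorBasis i = 0 := by ext j; exact congrFun h j
    rw [h2, norm_zero] at this
    exact zero_ne_one this
  refine hB.exists_eigenvalue_near h0 ?_ (by positivity)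
  have h1 : ∀ k, ‖(B.mulVec v) k - hA.eigenvalues i * v k‖ ^ 2 ≤ Fintype.card n * δ ^ 2 * ∑ j, ‖v j‖ ^ 2 := by
    intro k
    have e1 : (hA.eigenvalues i : ℂ) * v k = (A.mulVec v) k := by
      have := congrFun (hA.mulVec_eigenvectorBasis i) k
      rw [← hv] at this
      rw [this]; rfl
    have e2 : (B.mulVec v) k - hA.eigenvalues i * v k = ∑ j, (B k j - A k j) * v j := by
      rw [e1, Matrix.mulVec, Matrix.mulVec, dotProduct, dotProduct, ← Finset.sum_sub_distrib]
      exact Finset.sum_congr rfl fun j _ => by ring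
    have e3 : ‖(B.mulVec v) k - hA.eigenvalues i * v k‖ ≤ ∑ j, δ * ‖v j‖ := by
      rw [e2]
      refine (norm_sum_le _ _).trans (Finset.sum_le_sum fun j _ => ?_)
      rw [norm_mul]
      have := h k j
      rw [norm_sub_rev] at this
      gcongr
    calc _ ≤ (∑ j, δ * ‖v j‖) ^ 2 := by gcongr
      _ ≤ (∑ _j : n, δ ^ 2) * ∑ j, ‖v j‖ ^ 2 := Finset.sum_mul_sq_le_sq_mul_sq _ _ _
      _ = _ := by simp
  calc _ ≤ ∑ _k : n, Fintype.card n * δ ^ 2 * ∑ j, ‖v j‖ ^ 2 := Finset.sum_le_sum fun k _ => h1 k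
    _ = _ := by simp; ring

/-- Some eigenvalue `E` of `M` satisfies `|det (H a - E)| ≤ κ` for all `a < R`. -/
def HasCommonSmallDet {M : Matrix n n ℂ} (hM : M.IsHermitian) (R : ℕ) (H : ℕ → Matrix l l ℂ)
    (κ : ℝ) : Prop :=
  ∃ i, ∀ a < R, ‖(H a - (hM.eigenvalues i : ℂ) • (1 : Matrix l l ℂ)).det‖ ≤ κ

open Topology in
theorem eventually_eigenvalues_close {M : ℝ → Matrix n n ℂ} (hM : ∀ t, (M t).IsHermitian)
    (hMc : Continuous M) (t₀ : ℝ) {ε : ℝ} (hε : 0 < ε) :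
    ∀ᶠ t in 𝓝 t₀, (∀ i, ∃ j, |(hM t).eigenvalues j - (hM t₀).eigenvalues i| ≤ ε) ∧
      ∀ j, ∃ i, |(hM t).eigenvalues j - (hM t₀).eigenvalues i| ≤ ε := by
  set δ : ℝ := ε / (Fintype.card n + 1) with hδ
  have hδ0 : 0 < δ := by positivity
  have hle : Fintype.card n * δ ≤ ε := by
    rw [hδ, mul_div_assoc', div_le_iff₀ (by positivity)]; nlinarith
  have h : ∀ i j, ∀ᶠ t in 𝓝 t₀, ‖M t i j - M t₀ i j‖ ≤ δ := by
    intro i j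
    have h1 : Continuous fun t => M t i j := hMc.matrix_elem i j
    have h2 : Continuous fun t => ‖M t i j - M t₀ i j‖ := (h1.sub continuous_const).norm
    have h3 := h2.continuousAt (x := t₀)
    have : ∀ᶠ t in 𝓝 t₀, ‖M t i j - M t₀ i j‖ < δ := h3.eventually_lt_const (by simpa using hδ0)
    exact this.mono fun _ h => h.le
  filter_upwards [eventually_all.2 fun i => eventually_all.2 (h i)] with t ht
  refine ⟨fun i => ?_, fun j => ?_⟩
  · obtain ⟨j, hj⟩ := (hM t₀).exists_eigenvalue_sub_le (hM t) hδ0.le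
      (fun a b => by rw [norm_sub_rev]; exact ht a b) i
    exact ⟨j, hj.trans hle⟩
  · obtain ⟨i, hi⟩ := (hM t).exists_eigenvalue_sub_le (hM t₀) hδ0.le ht j
    exact ⟨i, by rw [abs_sub_comm]; exact hi.trans hle⟩

open Topology in
theorem hasCommonSmallDet_iff_of_isPreconnected {M : ℝ → Matrix n n ℂ}
    (hM : ∀ t, (M t).IsHermitian) (hMc : Continuous M) {R : ℕ} {H : ℕ → ℝ → Matrix l l ℂ}
    (hH : ∀ a t, (H a t).IsHermitian) (hHc : ∀ a, Continuous (H a)) {κ : ℝ}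
    {I : Set ℝ} (hI : IsPreconnected I)
    (hne : ∀ t ∈ I, ∀ a < R, crossDet (M t) (H a t) ((κ ^ 2 : ℝ) : ℂ) ≠ 0) {s t : ℝ}
    (hs : s ∈ I) (ht : t ∈ I) :
    HasCommonSmallDet (hM s) R (fun a => H a s) κ ↔ HasCommonSmallDet (hM t) R (fun a => H a t) κ := by
  classical
  set Φ : ℕ → ℝ × ℝ → ℝ := fun a p => ‖(H a p.1 - (p.2 : ℂ) • (1 : Matrix l l ℂ)).det‖ with hΦ
  have hΦc : ∀ a, Continuous (Φ a) := by
    intro a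
    refine (Continuous.matrix_det ?_).norm
    refine ((hHc a).comp continuous_fst).sub ?_
    exact (Complex.continuous_ofReal.comp continuous_snd).smul continuous_const
  have hball : ∀ (U : Set (ℝ × ℝ)) (t₀ E : ℝ), U ∈ 𝓝 (t₀, E) → ∃ ε > 0, ∀ t' E', |t' - t₀| ≤ ε →
      |E' - E| ≤ ε → (t', E') ∈ U := by
    intro U t₀ E hU
    obtain ⟨ε, hε, hsub⟩ := Metric.nhds_basis_closedBall.mem_iff.1 hU
    exact ⟨ε, hε, fun t' E' h1 h2 => hsub (by
      rw [Metric.mem_closedBall, Prod.dist_eq, Real.dist_eq, Real.dist_eq]; exact max_le h1 h2)⟩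
  have habs : ∀ (t₀ ε : ℝ), 0 < ε → ∀ᶠ t' in 𝓝 t₀, |t' - t₀| ≤ ε := fun t₀ ε hε => by
    filter_upwards [Metric.closedBall_mem_nhds t₀ hε] with t' ht'
    rwa [Metric.mem_closedBall, Real.dist_eq] at ht'
  have hcont : ContinuousOn (fun t => decide (HasCommonSmallDet (hM t) R (fun a => H a t) κ)) I := by
    intro t₀ ht₀
    refine ContinuousAt.continuousWithinAt ?_
    rw [ContinuousAt, nhds_discrete Bool, tendsto_pure]
    by_cases hmem : HasCommonSmallDet (hM t₀) R (fun a => H a t₀) κ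
    · obtain ⟨i, hi⟩ := hmem
      have hlt : ∀ a < R, Φ a (t₀, (hM t₀).eigenvalues i) < κ := by
        intro a ha
        refine lt_of_le_of_ne (hi a ha) fun h => hne t₀ ht₀ a ha ?_
        rw [← h]
        exact (hM t₀).crossDet_eq_zero (hH a t₀) i
      have hU : {p | ∀ a ∈ Finset.range R, Φ a p < κ} ∈ 𝓝 (t₀, (hM t₀).eigenvalues i) := by
        have : ∀ᶠ p in 𝓝 (t₀, (hM t₀).eigenvalues i), ∀ a ∈ Finset.range R, Φ a p < κ :=
          (Finset.eventually_all _).2 fun a ha =>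
            ((hΦc a).continuousAt).eventually_lt_const (hlt a (Finset.mem_range.1 ha))
        exact this
      obtain ⟨ε, hε, hεU⟩ := hball _ _ _ hU
      filter_upwards [eventually_eigenvalues_close hM hMc t₀ hε, habs t₀ ε hε] with t' h1 h2
      obtain ⟨j, hj⟩ := h1.1 i
      have : HasCommonSmallDet (hM t') R (fun a => H a t') κ :=
        ⟨j, fun a ha => (hεU _ _ h2 hj a (Finset.mem_range.2 ha)).le⟩
      rw [decide_eq_true this, decide_eq_true ⟨i, hi⟩]
    · have hmem' := hmem
      unfold HasCommonSmallDet at hmem'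
      push Not at hmem'
      choose a haR ha using hmem'
      have hU : ∀ i, {p | κ < Φ (a i) p} ∈ 𝓝 (t₀, (hM t₀).eigenvalues i) := fun i =>
        ((hΦc (a i)).continuousAt).eventually_const_lt (ha i)
      choose ε hε hεU using fun i => hball _ _ _ (hU i)
      obtain ⟨ε', hε', hle⟩ : ∃ ε' > 0, ∀ i, ε' ≤ ε i := by
        rcases isEmpty_or_nonempty n with h | h
        · exact ⟨1, one_pos, fun i => isEmptyElim i⟩
        · obtain ⟨i, hi⟩ := Finite.exists_min ε
          exact ⟨ε i, hε i, hi⟩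
      filter_upwards [eventually_eigenvalues_close hM hMc t₀ hε', habs t₀ ε' hε'] with t' h1 h2
      have : ¬ HasCommonSmallDet (hM t') R (fun a => H a t') κ := by
        rintro ⟨j, hj⟩
        obtain ⟨i, hi⟩ := h1.2 j
        have h3 := hεU i _ _ (h2.trans (hle i)) (hi.trans (hle i))
        exact absurd (hj (a i) (haR i)) (not_le.2 h3)
      rw [decide_eq_false this, decide_eq_false hmem]
  have h := hI.constant hcont hs ht
  exact decide_eq_decide.1 h

end Hermitian

section TrigMat

variable {S : Type} [Fintype S] [MetricSpace S] [DecidableEq S]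

/-- The strip operator with potential `lam * g` on columns `k, …, k + N - 1` of the orbit of `x`
under the rotation by `ω`. -/
def windowMat (N : ℕ) (g : S → ℝ → ℝ) (lam x : ℝ) (k : ℤ) (ω : ℝ) :
    Matrix (Fin N × S) (Fin N × S) ℂ :=
  stripMat N fun i s => ((lam * g s (x + (k + i) * ω) : ℝ) : ℂ)

theorem windowMat_isHermitian (N : ℕ) (g : S → ℝ → ℝ) (lam x : ℝ) (k : ℤ) (ω : ℝ) :
    (windowMat N g lam x k ω).IsHermitian := stripMat_isHermitian _ _

theorem windowMat_add_mul (N : ℕ) (g : S → ℝ → ℝ) (lam x : ℝ) (k l : ℤ) (ω : ℝ) :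
    windowMat N g lam (x + k * ω) l ω = windowMat N g lam x (k + l) ω := by
  have : ∀ i : ℕ, x + k * ω + (l + i) * ω = x + ((k + l : ℤ) + i) * ω := fun i => by push_cast; ring
  simp only [windowMat, this]

theorem continuous_windowMat (N : ℕ) {g : S → ℝ → ℝ} (hg : ∀ s, Continuous (g s)) (lam x : ℝ)
    (k : ℤ) : Continuous (windowMat N g lam x k) := by
  refine continuous_matrix fun p q => ?_
  rcases eq_or_ne p q with rfl | h
  · simp only [windowMat, stripMat_self]
    have := hg p.2
    fun_prop
  · simp only [windowMat, stripMat_of_ne _ h]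
    exact continuous_const

variable {τ : ℕ} {g : S → ℝ → ℝ} {b : S → ℤ → ℂ}

theorem continuous_of_trigSum
    (hg : ∀ s x, (g s x : ℂ) = ∑ n ∈ Finset.Icc (-τ : ℤ) τ, b s n * expChar n x) (s : S) :
    Continuous (g s) := by
  have h : Continuous fun x => ((g s x : ℝ) : ℂ) := by
    simp only [hg, expChar]
    fun_prop
  exact Complex.continuous_re.comp h

theorem windowMat_mem_trigPoly
    (hg : ∀ s x, (g s x : ℂ) = ∑ n ∈ Finset.Icc (-τ : ℤ) τ, b s n * expChar n x)
    (N : ℕ) (lam x : ℝ) (k : ℤ) {D : ℕ} (hD : ∀ i < N, (k + i).natAbs ≤ D) (p q : Fin N × S) :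
    (fun ω => windowMat N g lam x k ω p q) ∈ trigPoly (τ * D) := by
  rcases eq_or_ne p q with rfl | h
  · have h1 : (fun ω => windowMat N g lam x k ω p p)
        = ∑ n ∈ Finset.Icc (-τ : ℤ) τ, (lam * b p.2 n * expChar n x) • expChar (n * (k + (p.1 : ℕ))) := by
      ext ω
      simp only [windowMat, stripMat_self, Finset.sum_apply, Pi.smul_apply, smul_eq_mul]
      rw [Complex.ofReal_mul, hg, Finset.mul_sum]
      refine Finset.sum_congr rfl fun n _ => ?_
      rw [expChar_add, ← expChar_mul_int]
      push_cast; ring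
    rw [h1]
    refine Submodule.sum_mem _ fun n hn => Submodule.smul_mem _ _ (expChar_mem_trigPoly ?_)
    rw [Int.natAbs_mul]
    rw [Finset.mem_Icc] at hn
    exact Nat.mul_le_mul (by omega) (hD _ p.1.2)
  · have h1 : (fun ω => windowMat N g lam x k ω p q) = fun _ => stripHop S N p q := by
      ext ω; simp only [windowMat, stripMat_of_ne _ h]
    rw [h1]
    exact const_mem_trigPoly _ _

/-- Some eigenvalue of the operator on the window `-m, …, L - m - 1` of the orbit of `θ` makes all
characteristic determinants of length `N` at `x, x + ω, …, x + (R - 1) ω` small. -/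
def SmallDetAt (g : S → ℝ → ℝ) (lam θ : ℝ) (m L N R : ℕ) (κ ω x : ℝ) : Prop :=
  HasCommonSmallDet (windowMat_isHermitian L g lam θ (-m) ω) R
    (fun a => windowMat N g lam x a ω) κ

/-- Bound for the degree of the trigonometric polynomials detecting a change of `SmallDetAt` along
a line of slope `k`. -/
def crossDeg (d τ m L N R k : ℕ) : ℕ :=
  L * d * (2 * (N * d * (τ * (k + R + N))) + 2 * (N * d) * (τ * (m + L)))

theorem smallDetAt_iff_of_line
    (hg : ∀ s x, (g s x : ℂ) = ∑ n ∈ Finset.Icc (-τ : ℤ) τ, b s n * expChar n x)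
    (lam θ : ℝ) (m L N R : ℕ) (x : ℝ) (k : ℤ) :
    {κ : ℝ | 0 < κ ∧ ¬ ∃ Z : Finset ℝ, Z.card ≤ R * (2 * crossDeg (Fintype.card S) τ m L N R k.natAbs) ∧
      ∀ I ⊆ Set.Ico (0 : ℝ) 1, IsPreconnected I → Disjoint I Z → ∀ s ∈ I, ∀ t ∈ I,
        (SmallDetAt g lam θ m L N R κ s (x + k * s) ↔
          SmallDetAt g lam θ m L N R κ t (x + k * t))}.Finite := by
  classical
  set M : ℝ → Matrix (Fin L × S) (Fin L × S) ℂ := windowMat L g lam θ (-m) with hM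
  set H : ℕ → ℝ → Matrix (Fin N × S) (Fin N × S) ℂ := fun a => windowMat N g lam x (k + a) with hH
  have hfin : (⋃ a ∈ Finset.range R, {κ : ℝ | 0 < κ ∧ crossDet (M 0) (H a 0) ((κ ^ 2 : ℝ) : ℂ) = 0}).Finite := by
    refine Set.Finite.biUnion (Finset.finite_toSet _) fun a _ => ?_
    refine Set.Finite.of_injOn (f := fun κ : ℝ => ((κ ^ 2 : ℝ) : ℂ)) (fun κ hκ => hκ.2) ?_
      (finite_setOf_crossDet_eq_zero (M 0) (H a 0))
    intro κ hκ κ' hκ' h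
    have h1 : κ ^ 2 = κ' ^ 2 := Complex.ofReal_injective h
    exact (pow_left_inj₀ hκ.1.le hκ'.1.le two_ne_zero).1 h1
  refine hfin.subset ?_
  rintro κ ⟨hκ, hbad⟩
  by_contra hgood
  simp only [Set.mem_iUnion, not_exists, Set.mem_ofPred_eq, not_and, Finset.mem_range] at hgood
  refine hbad ?_
  set Mf : Matrix (Fin L × S) (Fin L × S) (ℝ → ℂ) := fun p q ω => M ω p q
  set Hf : ℕ → Matrix (Fin N × S) (Fin N × S) (ℝ → ℂ) := fun a p q ω => H a ω p q
  have heval : ∀ a ω, crossDet Mf (Hf a) (fun _ => ((κ ^ 2 : ℝ) : ℂ)) ω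
      = crossDet (M ω) (H a ω) ((κ ^ 2 : ℝ) : ℂ) := fun a ω =>
    map_crossDet (Pi.evalRingHom (fun _ : ℝ => ℂ) ω) Mf (Hf a) fun _ => ((κ ^ 2 : ℝ) : ℂ)
  have hmem : ∀ a < R, crossDet Mf (Hf a) (fun _ => ((κ ^ 2 : ℝ) : ℂ))
      ∈ trigPoly (crossDeg (Fintype.card S) τ m L N R k.natAbs) := by
    intro a ha
    have := isMulFiltration_trigPoly.crossDet_mem (M := Mf) (H := Hf a)
      (c := fun _ => ((κ ^ 2 : ℝ) : ℂ)) (D := τ * (m + L)) (D' := τ * (k.natAbs + R + N))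
      (fun p q => windowMat_mem_trigPoly hg L lam θ _ (fun i hi => by omega) p q)
      (fun p q => windowMat_mem_trigPoly hg N lam x _ (fun i hi => by omega) p q)
      (const_mem_trigPoly _ _)
    simp only [Fintype.card_prod, Fintype.card_fin] at this
    exact this
  have hZ : ∀ a, ∃ Z : Finset ℝ, a < R → Z.card ≤ 2 * crossDeg (Fintype.card S) τ m L N R k.natAbs ∧
      ∀ t ∈ Set.Ico (0 : ℝ) 1, crossDet (M t) (H a t) ((κ ^ 2 : ℝ) : ℂ) = 0 → t ∈ Z := by
    intro a
    by_cases ha : a < R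
    · obtain ⟨Z, h1, h2⟩ := exists_zeros_of_mem_trigPoly (hmem a ha)
        ⟨0, by rw [heval]; exact hgood a ha hκ⟩
      exact ⟨Z, fun _ => ⟨h1, fun t ht h => h2 t ht (by rw [heval]; exact h)⟩⟩
    · exact ⟨∅, fun h => absurd h ha⟩
  choose Z hZ using hZ
  refine ⟨(Finset.range R).biUnion Z, ?_, fun I hI hpre hdisj s hs t ht => ?_⟩
  · refine (Finset.card_biUnion_le_card_mul _ _ _ fun a ha => (hZ a (Finset.mem_range.1 ha)).1).trans ?_
    rw [Finset.card_range]
  · have := hasCommonSmallDet_iff_of_isPreconnected (M := M) (H := H)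
      (windowMat_isHermitian L g lam θ (-m)) (continuous_windowMat L (continuous_of_trigSum hg) _ _ _)
      (R := R) (κ := κ) (fun a t => windowMat_isHermitian _ _ _ _ _ _)
      (fun a => continuous_windowMat N (continuous_of_trigSum hg) _ _ _) hpre
      (fun t ht a ha h => Set.disjoint_left.1 hdisj ht (Finset.mem_coe.2 (Finset.mem_biUnion.2
        ⟨a, Finset.mem_range.2 ha, (hZ a ha).2 t (hI ht) h⟩))) hs ht
    simpa only [SmallDetAt, hH, ← windowMat_add_mul] using this

/-- Only boundedly many disjoint intervals can see a change of `SmallDetAt` along a horizontal. -/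
theorem card_le_of_horizontal
    (hg : ∀ s x, (g s x : ℂ) = ∑ n ∈ Finset.Icc (-τ : ℤ) τ, b s n * expChar n x)
    (lam θ : ℝ) (m L N R : ℕ) (x : ℝ) {κ : ℝ} (hκ : 0 < κ) {ι : Type*} (T : Finset ι)
    (I : ι → Set ℝ) (hI : ∀ i ∈ T, I i ⊆ Set.Ico (0 : ℝ) 1) (hpre : ∀ i ∈ T, IsPreconnected (I i))
    (hdisj : (T : Set ι).PairwiseDisjoint I)
    (hch : ∀ i ∈ T, (∃ ω ∈ I i, SmallDetAt g lam θ m L N R κ ω x) ∧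
      ∃ ω ∈ I i, ¬ SmallDetAt g lam θ m L N R κ ω x) :
    T.card ≤ R * (2 * crossDeg (Fintype.card S) τ m L N R 0) := by
  classical
  have hnon : ∀ ω, ¬ SmallDetAt g lam θ m L N R κ ω x → ∃ κ' > κ, ∀ κ'' < κ',
      ¬ SmallDetAt g lam θ m L N R κ'' ω x := by
    intro ω hω
    unfold SmallDetAt HasCommonSmallDet at hω
    push Not at hω
    choose a ha hlt using hω
    obtain ⟨κ', h1, h2⟩ : ∃ κ' > κ, ∀ i, κ' ≤ ‖(windowMat N g lam x (a i) ω
        - ((windowMat_isHermitian L g lam θ (-m) ω).eigenvalues i : ℂ) • (1 : Matrix (Fin N × S) (Fin N × S) ℂ)).det‖ := by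
      rcases isEmpty_or_nonempty (Fin L × S) with h | h
      · exact ⟨κ + 1, by linarith, fun i => isEmptyElim i⟩
      · obtain ⟨i, hi⟩ := Finite.exists_min fun i => ‖(windowMat N g lam x (a i) ω
          - ((windowMat_isHermitian L g lam θ (-m) ω).eigenvalues i : ℂ) • (1 : Matrix (Fin N × S) (Fin N × S) ℂ)).det‖
        exact ⟨_, hlt i, hi⟩
    refine ⟨κ', h1, fun κ'' h3 => ?_⟩
    rintro ⟨i, hi⟩
    exact absurd ((hi (a i) (ha i)).trans_lt h3) (not_lt.2 (h2 i))
  choose! u hu hus using fun i hi => (hch i hi).1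
  choose! v hv hvs using fun i hi => (hch i hi).2
  have hκ' : ∃ κ' > κ, ∀ i ∈ T, ∀ κ'' < κ', ¬ SmallDetAt g lam θ m L N R κ'' (v i) x := by
    choose! c hc hcn using fun ω h => hnon ω h
    rcases T.eq_empty_or_nonempty with rfl | hT
    · exact ⟨κ + 1, by linarith, by simp⟩
    · obtain ⟨i, hi, hmin⟩ := T.exists_min_image (fun i => c (v i)) hT
      exact ⟨c (v i), hc _ (hvs i hi), fun j hj κ'' h => hcn _ (hvs j hj) κ'' (h.trans_le (hmin j hj))⟩
  obtain ⟨κ', hκκ', hκ'⟩ := hκ'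
  have hfin := smallDetAt_iff_of_line hg lam θ m L N R x 0
  obtain ⟨κ'', hκ''1, hκ''2⟩ := (Set.Ioo_infinite hκκ').exists_notMem_finite hfin
  simp only [Set.mem_ofPred_eq, not_and, not_not] at hκ''2
  obtain ⟨Z, hZc, hZ⟩ := hκ''2 (hκ.trans hκ''1.1)
  refine le_trans ?_ hZc
  have hmeet : ∀ i ∈ T, ∃ z ∈ Z, z ∈ I i := by
    intro i hi
    by_contra hcon
    push Not at hcon
    have h := hZ (I i) (hI i hi) (hpre i hi)
      (Set.disjoint_left.2 fun t ht htZ => hcon t htZ ht) (u i) (hu i hi) (v i) (hv i hi)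
    simp only [Int.cast_zero, zero_mul, add_zero] at h
    obtain ⟨j, hj⟩ := hus i hi
    exact hκ' i hi κ'' hκ''1.2 (h.1 ⟨j, fun a ha => (hj a ha).trans hκ''1.1.le⟩)
  choose! z hz hzI using hmeet
  refine Finset.card_le_card_of_injOn z hz fun i hi j hj hij => ?_
  by_contra hne
  exact Set.disjoint_left.1 (hdisj hi hj hne) (hzI i hi) (hij ▸ hzI j hj)

end TrigMat

/-- The interval between `z` and the next point of `Z ∪ {1}`. -/
def gapInterval (Z : Finset ℝ) (z : ℝ) : Set ℝ := {t | z < t ∧ t < 1 ∧ ∀ z' ∈ Z, z < z' → t < z'}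

theorem ordConnected_gapInterval (Z : Finset ℝ) (z : ℝ) : (gapInterval Z z).OrdConnected :=
  ⟨fun _ hx _ hy _ ht => ⟨hx.1.trans_le ht.1, ht.2.trans_lt hy.2.1,
    fun z' hz' h => ht.2.trans_lt (hy.2.2 z' hz' h)⟩⟩

theorem disjoint_gapInterval (Z : Finset ℝ) (z : ℝ) : Disjoint (gapInterval Z z) Z :=
  Set.disjoint_left.2 fun t ht htZ => lt_irrefl t (ht.2.2 t htZ ht.1)

theorem pairwiseDisjoint_gapInterval (Z : Finset ℝ) :
    (Z : Set ℝ).PairwiseDisjoint (gapInterval Z) := by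
  have key : ∀ x ∈ Z, ∀ y ∈ Z, x < y → Disjoint (gapInterval Z x) (gapInterval Z y) :=
    fun x _ y hy hxy => Set.disjoint_left.2 fun t htx hty => lt_asymm hty.1 (htx.2.2 y hy hxy)
  intro x hx y hy hne
  rcases lt_or_gt_of_ne hne with h | h
  · exact key x hx y hy h
  · exact (key y hy x hx h).symm

theorem exists_mem_gapInterval {Z : Finset ℝ} (h0 : 0 ∈ Z) {t : ℝ} (ht : t ∈ Set.Ico (0 : ℝ) 1)
    (htZ : t ∉ Z) : ∃ z ∈ Z, 0 ≤ z ∧ t ∈ gapInterval Z z := by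
  have ht0 : 0 < t := lt_of_le_of_ne ht.1 fun h => htZ (h ▸ h0)
  have h0' : 0 ∈ Z.filter (· < t) := Finset.mem_filter.2 ⟨h0, ht0⟩
  obtain ⟨hzZ, hzt⟩ := Finset.mem_filter.1 (Finset.max'_mem (Z.filter (· < t)) ⟨0, h0'⟩)
  refine ⟨_, hzZ, Finset.le_max' _ _ h0', hzt, ht.2, fun z' hz' hlt => ?_⟩
  by_contra hcon
  rcases (not_lt.1 hcon).lt_or_eq with h | h
  · exact absurd (Finset.le_max' _ _ (Finset.mem_filter.2 ⟨hz', h⟩)) (not_le.2 hlt)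
  · exact htZ (h ▸ hz')

theorem gapInterval_subset {Z : Finset ℝ} {z : ℝ} (hz : 0 ≤ z) :
    gapInterval Z z ⊆ Set.Ico (0 : ℝ) 1 := fun _ ht => ⟨hz.trans ht.1.le, ht.2.1⟩

theorem sum_volume_le_of_card_le {ι : Type*} (T : Finset ι) (A : ι → Set ℝ)
    (hA : ∀ i ∈ T, MeasurableSet (A i)) (hsub : ∀ i ∈ T, A i ⊆ Set.Ico (0 : ℝ) 1) {B : ℕ}
    (hB : ∀ x, ∀ T' ⊆ T, (∀ i ∈ T', x ∈ A i) → T'.card ≤ B) :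
    ∑ i ∈ T, volume (A i) ≤ B := by
  classical
  calc ∑ i ∈ T, volume (A i) = ∑ i ∈ T, ∫⁻ x, (A i).indicator 1 x :=
        Finset.sum_congr rfl fun i hi => (lintegral_indicator_one (hA i hi)).symm
    _ = ∫⁻ x, ∑ i ∈ T, (A i).indicator 1 x :=
        (lintegral_finsetSum' _ fun i hi => (measurable_one.indicator (hA i hi)).aemeasurable).symm
    _ ≤ ∫⁻ x, (Set.Ico (0 : ℝ) 1).indicator (fun _ => (B : ENNReal)) x := by
        refine lintegral_mono fun x => ?_
        by_cases hx : x ∈ Set.Ico (0 : ℝ) 1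
        · rw [Set.indicator_of_mem hx]
          have : ∑ i ∈ T, (A i).indicator (1 : ℝ → ENNReal) x = ((T.filter fun i => x ∈ A i).card : ENNReal) := by
            rw [Finset.card_filter]
            push_cast
            refine Finset.sum_congr rfl fun i _ => ?_
            by_cases h : x ∈ A i <;> simp [h]
          rw [this]
          exact Nat.cast_le.2 (hB x _ (Finset.filter_subset _ _) fun i hi => (Finset.mem_filter.1 hi).2)
        · rw [Set.indicator_of_notMem hx]
          refine (Finset.sum_eq_zero fun i hi => ?_).le
          exact Set.indicator_of_notMem (fun h => hx (hsub i hi h)) _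
    _ = B := by
        rw [lintegral_indicator measurableSet_Ico, setLIntegral_const, Real.volume_Ico]; simp

/-- Steep lines rarely meet a set of bounded horizontal complexity with small vertical sections. -/
theorem volume_le_of_steep_lines {Sm : ℝ → ℝ → Prop}
    (hper : ∀ ω x (n : ℤ), Sm ω (x + n) → Sm ω x) (θ : ℝ) (ks : Finset ℤ) {K : ℕ} (hK : 0 < K)
    (hks : ∀ k ∈ ks, K ≤ k.natAbs) (Z : Finset ℝ) (h0 : 0 ∈ Z)
    (hcross : ∀ k ∈ ks, ∀ t ∈ Set.Ico (0 : ℝ) 1, ∀ n : ℤ, θ + k * t = n → t ∈ Z)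
    (hline : ∀ k ∈ ks, ∀ I ⊆ Set.Ico (0 : ℝ) 1, IsPreconnected I → Disjoint I Z → ∀ s ∈ I, ∀ t ∈ I,
      (Sm s (θ + k * s) ↔ Sm t (θ + k * t))) {B : ℕ}
    (hhor : ∀ x, ∀ (T : Finset ℝ) (I : ℝ → Set ℝ), (∀ i ∈ T, I i ⊆ Set.Ico (0 : ℝ) 1) →
      (∀ i ∈ T, IsPreconnected (I i)) → (T : Set ℝ).PairwiseDisjoint I →
      (∀ i ∈ T, (∃ ω ∈ I i, Sm ω x) ∧ ∃ ω ∈ I i, ¬ Sm ω x) → T.card ≤ B)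
    (G : Set ℝ) {η : ENNReal}
    (hvert : ∀ ω ∈ G, ω ∈ Set.Ico (0 : ℝ) 1 → volume {x ∈ Set.Ico (0 : ℝ) 1 | Sm ω x} ≤ η) :
    K * volume {ω ∈ Set.Ico (0 : ℝ) 1 | ω ∈ G ∧ ∃ k ∈ ks, Sm ω (θ + k * ω)} ≤ B + Z.card * η := by
  classical
  set X := {ω ∈ Set.Ico (0 : ℝ) 1 | ω ∈ G ∧ ∃ k ∈ ks, Sm ω (θ + k * ω)} with hX
  set T := Z.filter fun z => 0 ≤ z ∧ (X ∩ gapInterval Z z).Nonempty with hT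
  have hcover : X ⊆ (Z : Set ℝ) ∪ ⋃ z ∈ T, gapInterval Z z := by
    intro ω hω
    by_cases hωZ : ω ∈ Z
    · exact Or.inl hωZ
    · obtain ⟨z, hz, hz0, hmem⟩ := exists_mem_gapInterval h0 hω.1 hωZ
      exact Or.inr (Set.mem_biUnion (Finset.mem_filter.2 ⟨hz, hz0, ω, hω, hmem⟩) hmem)
  have hTmem : ∀ z ∈ T, ∃ ω ∈ gapInterval Z z, ω ∈ X ∧ ∃ k ∈ ks, Sm ω (θ + k * ω) := by
    intro z hz
    obtain ⟨ω, hω, hωI⟩ := (Finset.mem_filter.1 hz).2.2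
    exact ⟨ω, hωI, hω, hω.2.2⟩
  have hT0 : ∀ z ∈ T, 0 ≤ z := fun z hz => (Finset.mem_filter.1 hz).2.1
  choose! w hwI hwX k hk hwk using hTmem
  have hpre : ∀ z, IsPreconnected (gapInterval Z z) := fun z =>
    (ordConnected_gapInterval Z z).isPreconnected
  have hmeas : ∀ z, MeasurableSet (gapInterval Z z) := fun z =>
    (ordConnected_gapInterval Z z).measurableSet
  set m : ℝ → ℤ := fun z => ⌊θ + k z * w z⌋ with hm
  set J : ℝ → Set ℝ := fun z => {x | ((k z : ℝ))⁻¹ * (x + (m z - θ)) ∈ gapInterval Z z} with hJ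
  set V : ℝ → Set ℝ := fun z => toMeasurable volume {x ∈ Set.Ico (0 : ℝ) 1 | Sm (w z) x} with hV
  have hk0 : ∀ z ∈ T, (k z : ℝ) ≠ 0 := by
    intro z hz h
    have h1 : k z = 0 := by exact_mod_cast h
    have := hks _ (hk z hz)
    rw [h1] at this
    simp at this; omega
  have hJmeas : ∀ z, MeasurableSet (J z) := fun z =>
    (show Measurable fun x : ℝ => ((k z : ℝ))⁻¹ * (x + (m z - θ)) by fun_prop) (hmeas z)
  have hJvol : ∀ z ∈ T, K * volume (gapInterval Z z) ≤ volume (J z) := by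
    intro z hz
    have h1 : J z = (fun x => x + ((m z : ℝ) - θ)) ⁻¹' ((fun x => ((k z : ℝ))⁻¹ * x) ⁻¹' gapInterval Z z) := rfl
    rw [h1, measure_preimage_add_right, Real.volume_preimage_mul_left (inv_ne_zero (hk0 z hz)), inv_inv]
    gcongr
    have h2 : ENNReal.ofReal |(k z : ℝ)| = ((k z).natAbs : ENNReal) := by
      rw [← Int.cast_abs, ← Nat.cast_natAbs, ENNReal.ofReal_natCast]
    rw [h2]
    exact_mod_cast hks _ (hk z hz)
  have hfloor : ∀ z ∈ T, ∀ t ∈ gapInterval Z z, ⌊θ + k z * t⌋ = m z := by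
    intro z hz
    have key : ∀ s ∈ gapInterval Z z, ∀ t ∈ gapInterval Z z, θ + k z * s ≤ θ + k z * t →
        ⌊θ + k z * s⌋ = ⌊θ + k z * t⌋ := by
      intro s hs t ht hle
      by_contra hne
      have hlt : ⌊θ + k z * s⌋ < ⌊θ + k z * t⌋ := lt_of_le_of_ne (Int.floor_mono hle) hne
      have hmem : (⌊θ + k z * t⌋ : ℝ) ∈ Set.uIcc (θ + k z * s) (θ + k z * t) := by
        rw [Set.uIcc_of_le hle]
        exact ⟨(Int.floor_lt.1 hlt).le, Int.floor_le _⟩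
      have hc : ContinuousOn (fun u => θ + k z * u) (Set.uIcc s t) := by fun_prop
      obtain ⟨u, hu, hue⟩ := intermediate_value_uIcc hc hmem
      have huI := (ordConnected_gapInterval Z z).uIcc_subset hs ht hu
      exact Set.disjoint_left.1 (disjoint_gapInterval Z z) huI
        (hcross _ (hk z hz) u (gapInterval_subset (hT0 z hz) huI) _ hue)
    intro t ht
    rcases le_total (θ + k z * t) (θ + k z * w z) with h | h
    · exact key t ht _ (hwI z hz) h
    · exact (key _ (hwI z hz) t ht h).symm
  have hJe : ∀ z ∈ T, ∀ x ∈ J z, ∃ t ∈ gapInterval Z z, θ + k z * t = x + m z := by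
    intro z hz x hx
    refine ⟨_, hx, ?_⟩
    have := hk0 z hz
    field_simp
    ring
  have hJsub : ∀ z ∈ T, J z ⊆ Set.Ico (0 : ℝ) 1 := by
    intro z hz x hx
    obtain ⟨t, ht, hte⟩ := hJe z hz x hx
    have h1 := hfloor z hz t ht
    rw [hte, Int.floor_add_intCast] at h1
    have h2 : ⌊x⌋ = 0 := by omega
    simpa using Int.floor_eq_iff.1 h2
  have hsum : ∑ z ∈ T, volume (J z \ V z) ≤ B := by
    refine sum_volume_le_of_card_le T _ (fun z _ => (hJmeas z).diff (measurableSet_toMeasurable _ _))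
      (fun z hz => Set.sdiff_subset.trans (hJsub z hz)) fun x T' hT' hx => ?_
    refine hhor x T' (gapInterval Z) (fun z hz => gapInterval_subset (hT0 z (hT' hz)))
      (fun z _ => hpre z) ((pairwiseDisjoint_gapInterval Z).subset fun z hz =>
        (Finset.mem_filter.1 (hT' hz)).1) fun z hz => ⟨?_, ?_⟩
    · obtain ⟨t, ht, hte⟩ := hJe z (hT' hz) x (hx z hz).1
      refine ⟨t, ht, hper t x (m z) ?_⟩
      rw [← hte]
      exact (hline _ (hk z (hT' hz)) _ (gapInterval_subset (hT0 z (hT' hz))) (hpre z)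
        (disjoint_gapInterval Z z) _ (hwI z (hT' hz)) _ ht).1 (hwk z (hT' hz))
    · refine ⟨w z, hwI z (hT' hz), fun h => (hx z hz).2 (subset_toMeasurable _ _ ⟨?_, h⟩)⟩
      exact hJsub z (hT' hz) (hx z hz).1
  have hbound : ∀ z ∈ T, K * volume (gapInterval Z z) ≤ η + volume (J z \ V z) := by
    intro z hz
    refine (hJvol z hz).trans ((measure_mono (show J z ⊆ V z ∪ (J z \ V z) by
      rw [Set.union_sdiff_self]; exact Set.subset_union_right)).trans
      ((measure_union_le _ _).trans (add_le_add ?_ le_rfl)))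
    rw [hV]
    simp only [measure_toMeasurable]
    exact hvert _ (hwX z hz).2.1 (hwX z hz).1
  calc K * volume X ≤ K * ∑ z ∈ T, volume (gapInterval Z z) := by
        gcongr
        refine (measure_mono hcover).trans ((measure_union_le _ _).trans ?_)
        rw [(Finset.countable_toSet Z).measure_zero, zero_add]
        exact measure_biUnion_finset_le _ _
    _ = ∑ z ∈ T, K * volume (gapInterval Z z) := Finset.mul_sum _ _ _
    _ ≤ ∑ z ∈ T, (η + volume (J z \ V z)) := Finset.sum_le_sum hbound
    _ = T.card * η + ∑ z ∈ T, volume (J z \ V z) := by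
        rw [Finset.sum_add_distrib, Finset.sum_const, nsmul_eq_mul]
    _ ≤ Z.card * η + B := by
        gcongr
        exact Finset.filter_subset _ _
    _ = _ := add_comm _ _

section Diophantine

/-- The Diophantine condition with exponent `2` and constant `1 / j`. -/
def Diophantine (j : ℕ) (ω : ℝ) : Prop :=
  ∀ q : ℕ, 0 < q → ∀ p : ℤ, 1 ≤ j * (q : ℝ) ^ 2 * |q * ω - p|

theorem exists_diophantine_of_not_liouvilleWith {ω : ℝ} (hirr : Irrational ω)
    (h : ¬ LiouvilleWith 3 ω) : ∃ j, 0 < j ∧ Diophantine j ω := by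
  unfold LiouvilleWith at h
  push Not at h
  obtain ⟨n0, hn0⟩ := eventually_atTop.1 (h 1)
  have hne : ∀ q : ℕ, 0 < q → ∀ p : ℤ, ω ≠ p / q := fun q _ p h' =>
    (irrational_iff_ne_rational ω).1 hirr p q (by positivity) (by simpa using h')
  have hd : ∀ q : ℕ, 0 < q → 0 < distInt (q * ω) := by
    intro q hq
    refine abs_pos.2 (sub_ne_zero.2 fun h' => hne q hq (round (q * ω)) ?_)
    rw [← h']; field_simp
  have hfin : ∃ δ : ℝ, 0 < δ ∧ ∀ q : ℕ, 0 < q → q < n0 → δ ≤ distInt (q * ω) := by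
    have h1 : ∀ n : ℕ, ∃ δ : ℝ, 0 < δ ∧ ∀ q : ℕ, 0 < q → q < n → δ ≤ distInt (q * ω) := by
      intro n
      induction n with
      | zero => exact ⟨1, one_pos, fun q _ h => absurd h (by omega)⟩
      | succ n ih =>
        obtain ⟨δ, hδ, ih⟩ := ih
        rcases Nat.eq_zero_or_pos n with rfl | hn
        · exact ⟨1, one_pos, fun q _ h => absurd h (by omega)⟩
        · refine ⟨min δ (distInt (n * ω)), lt_min hδ (hd n hn), fun q hq hqn => ?_⟩
          rcases Nat.lt_succ_iff_lt_or_eq.1 hqn with h | rfl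
          · exact (min_le_left _ _).trans (ih q hq h)
          · exact min_le_right _ _
    exact h1 n0
  obtain ⟨δ, hδ, hfin⟩ := hfin
  obtain ⟨j, hj⟩ := exists_nat_gt (max 1 δ⁻¹)
  have hj1 : (1 : ℝ) < j := (le_max_left _ _).trans_lt hj
  refine ⟨j, by exact_mod_cast one_pos.trans hj1, fun q hq p => ?_⟩
  have hq1 : (1 : ℝ) ≤ q := by exact_mod_cast hq
  have hq0 : (0 : ℝ) < q := by positivity
  rcases lt_or_ge q n0 with hlt | hge
  · have h1 : δ ≤ |q * ω - p| := (hfin q hq hlt).trans (distInt_le_abs_sub _ _)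
    have h2 : 1 ≤ (j : ℝ) * δ := by
      have := (le_max_right 1 δ⁻¹).trans hj.le
      calc (1 : ℝ) = δ⁻¹ * δ := by field_simp
        _ ≤ _ := by gcongr
    calc (1 : ℝ) ≤ j * 1 * δ := by simpa using h2
      _ ≤ _ := by gcongr; exact one_le_pow₀ hq1
  · have h1 := hn0 q hge p (hne q hq p)
    have h2 : |ω - p / q| = |q * ω - p| / q := by
      rw [← abs_of_pos hq0, ← abs_div, abs_of_pos hq0]; congr 1; field_simp
    rw [h2, show ((q : ℝ) ^ (3 : ℝ)) = (q : ℝ) ^ 3 by norm_cast, div_le_div_iff₀ (by positivity) hq0] at h1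
    have h3 : 1 ≤ (q : ℝ) ^ 2 * |q * ω - p| := by
      have : 1 * (q : ℝ) ≤ ((q : ℝ) ^ 2 * |q * ω - p|) * q := by nlinarith
      exact le_of_mul_le_mul_right this hq0
    calc (1 : ℝ) ≤ 1 * ((q : ℝ) ^ 2 * |q * ω - p|) := by simpa using h3
      _ ≤ j * ((q : ℝ) ^ 2 * |q * ω - p|) := by gcongr
      _ = _ := by ring

theorem ae_exists_diophantine : ∀ᵐ ω : ℝ, ∃ j, 0 < j ∧ Diophantine j ω := by
  have hirr : ∀ᵐ ω : ℝ, Irrational ω := by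
    refine (Set.countable_range ((↑) : ℚ → ℝ)).ae_notMem volume
  filter_upwards [ae_not_liouvilleWith, hirr] with ω h1 h2
  exact exists_diophantine_of_not_liouvilleWith h2 (h1 3 (by norm_num))

theorem Diophantine.exists_rat {j : ℕ} {ω : ℝ} (h : Diophantine j ω) {R : ℕ} (hR : 0 < R) :
    ∃ r : ℚ, r.den ≤ R ∧ |ω - r| ≤ 1 / (R * r.den) ∧ (R : ℝ) ≤ j * (r.den : ℝ) ^ 2 := by
  obtain ⟨r, h1, h2⟩ := Real.exists_rat_abs_sub_le_and_den_le ω hR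
  have hd : (0 : ℝ) < r.den := by exact_mod_cast r.pos
  have hR' : (0 : ℝ) < R := by exact_mod_cast hR
  refine ⟨r, h2, h1.trans (one_div_le_one_div_of_le (by positivity) (by gcongr; linarith)), ?_⟩
  have h3 := h r.den r.pos r.num
  have h4 : |r.den * ω - r.num| = r.den * |ω - r| := by
    rw [← abs_of_pos hd, ← abs_mul, abs_of_pos hd]
    congr 1
    rw [mul_sub]
    congr 1
    exact_mod_cast (Rat.den_mul_eq_num r).symm
  have h5 : r.den * |ω - r| * (R + 1) ≤ 1 := by
    calc r.den * |ω - r| * (R + 1) ≤ r.den * (1 / ((R + 1) * r.den)) * (R + 1) := by gcongr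
      _ = 1 := by field_simp
  rw [h4] at h3
  have h6 : 0 ≤ (j : ℝ) * (r.den : ℝ) ^ 2 := by positivity
  have h7 : 0 ≤ (r.den : ℝ) * |ω - r| := by positivity
  have h8 : (R + 1 : ℝ) * 1 ≤ (R + 1) * (j * (r.den : ℝ) ^ 2 * (r.den * |ω - r|)) := by gcongr
  have h9 : (j * (r.den : ℝ) ^ 2) * (r.den * |ω - r| * (R + 1)) ≤ (j * (r.den : ℝ) ^ 2) * 1 := by
    gcongr
  nlinarith

end Diophantine

section Eigenvalues

variable {S : Type} [Fintype S] [MetricSpace S] [DecidableEq S]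

theorem abs_eigenvalues_windowMat_le (N : ℕ) {g : S → ℝ → ℝ} (lam x : ℝ) (k : ℤ) (ω : ℝ) {V : ℝ}
    (hV : ∀ s x, |lam * g s x| ≤ V) (i : Fin N × S) :
    |(windowMat_isHermitian N g lam x k ω).eigenvalues i| ≤ V + 2 + Fintype.card S := by
  set hH := windowMat_isHermitian N g lam x k ω
  have hev : Module.End.HasEigenvalue (Matrix.toLin' (windowMat N g lam x k ω))
      ((hH.eigenvalues i : ℝ) : ℂ) := by
    refine Module.End.hasEigenvalue_of_hasEigenvector (x := (hH.eigenvectorBasis i).ofLp)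
      ⟨Module.End.mem_eigenspace_iff.2 ?_, ?_⟩
    · rw [Matrix.toLin'_apply, hH.mulVec_eigenvectorBasis i]
      rfl
    · intro h0
      have := hH.eigenvectorBasis.orthonormal.ne_zero i
      exact this (by ext j; exact congrFun h0 j)
  obtain ⟨p, hp⟩ := eigenvalue_mem_ball hev
  rw [mem_closedBall_iff_norm] at hp
  have h1 : ‖windowMat N g lam x k ω p p‖ ≤ V := by
    rw [windowMat, stripMat_self, Complex.norm_real]
    exact hV _ _
  have h2 : ∑ q ∈ Finset.univ.erase p, ‖windowMat N g lam x k ω p q‖ ≤ 2 + Fintype.card S := by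
    refine le_trans ?_ (sum_norm_stripHop_le N p)
    refine le_trans (Finset.sum_le_sum fun q hq => ?_)
      (Finset.sum_le_sum_of_subset_of_nonneg (Finset.erase_subset p _) fun _ _ _ => norm_nonneg _)
    rw [windowMat, stripMat_of_ne _ (Finset.ne_of_mem_erase hq).symm]
  have h3 := norm_sub_norm_le (((hH.eigenvalues i : ℝ) : ℂ)) (windowMat N g lam x k ω p p)
  rw [Complex.norm_real, Real.norm_eq_abs] at h3
  linarith

end Eigenvalues

namespace StripPotential

variable {S : Type} [Fintype S] [MetricSpace S] [DecidableEq S] (P : StripPotential S)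

theorem abs_f_le (s : S) (x : ℝ) : |P.f s x| ≤ P.B := by
  have := P.norm_F_le s x (by simpa using P.ρ_pos)
  rwa [P.F_ofReal, Complex.norm_real] at this

theorem det_eq_windowMat (N : ℕ) (lam x : ℝ) (k : ℤ) (ω E : ℝ) :
    P.det N lam ω E ((x + k * ω : ℝ) : ℂ)
      = (windowMat N P.f lam x k ω - (E : ℂ) • (1 : Matrix (Fin N × S) (Fin N × S) ℂ)).det := by
  rw [windowMat, stripMat_sub_smul_one, det]
  congr 2
  ext i s
  rw [show ((x + k * ω : ℝ) : ℂ) + i * ω = ((x + (k + i) * ω : ℝ) : ℂ) by push_cast; ring,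
    P.F_ofReal]
  push_cast; ring

theorem abs_eigenvalues_windowMat_le {lam : ℝ} (hl : 1 ≤ lam) {g : S → ℝ → ℝ}
    (hg : ∀ s x, lam * |P.f s x - g s x| ≤ 1)
    (N : ℕ) (x : ℝ) (k : ℤ) (ω : ℝ) (i : Fin N × S) :
    |(windowMat_isHermitian N g lam x k ω).eigenvalues i| ≤ lam * P.C1 := by
  have hV : ∀ s x, |lam * g s x| ≤ lam * P.B + 1 := by
    intro s x
    have h1 := P.abs_f_le s x
    have h2 := hg s x
    rw [abs_mul, abs_of_nonneg (by linarith : 0 ≤ lam)]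
    have h3 : |g s x| ≤ |P.f s x| + |P.f s x - g s x| := by
      have := abs_sub_abs_le_abs_sub (g s x) (P.f s x)
      rw [abs_sub_comm] at this; linarith
    nlinarith
  refine (_root_.abs_eigenvalues_windowMat_le N lam x k ω hV i).trans ?_
  have : (0 : ℝ) ≤ Fintype.card S := by positivity
  unfold C1; nlinarith

theorem norm_windowMat_sub_smul_le {lam : ℝ} (hl : 1 ≤ lam) {g : S → ℝ → ℝ}
    (hg : ∀ s x, lam * |P.f s x - g s x| ≤ 1) {E : ℝ} (hE : |E| ≤ lam * P.C1)
    (N : ℕ) (x : ℝ) (k : ℤ) (ω : ℝ) (p q : Fin N × S) :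
    ‖(windowMat N g lam x k ω - (E : ℂ) • (1 : Matrix (Fin N × S) (Fin N × S) ℂ)) p q‖
      ≤ (P.C2 + 1) * lam := by
  rw [windowMat, stripMat_sub_smul_one]
  refine (norm_stripMat_le (V := lam * P.B + 1 + lam * P.C1) N _ (fun i s => ?_) p q).trans ?_
  · have h1 := P.abs_f_le s (x + (k + i) * ω)
    have h2 := hg s (x + (k + i) * ω)
    refine (norm_sub_le _ _).trans (add_le_add ?_ (by rwa [Complex.norm_real]))
    rw [Complex.norm_real, Real.norm_eq_abs, abs_mul, abs_of_nonneg (by linarith : 0 ≤ lam)]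
    have h3 := abs_sub_abs_le_abs_sub (g s (x + (k + i) * ω)) (P.f s (x + (k + i) * ω))
    rw [abs_sub_comm] at h3
    nlinarith
  · have : (0 : ℝ) ≤ Fintype.card S := by positivity
    unfold C2; nlinarith

/-- Stability of the determinants under a change of potential and energy. -/
theorem norm_det_windowMat_sub_le {lam : ℝ} (hl : 1 ≤ lam) {g g' : S → ℝ → ℝ} {δ : ℝ}
    (hg : ∀ s x, lam * |P.f s x - g s x| ≤ 1) (hg' : ∀ s x, lam * |P.f s x - g' s x| ≤ 1)
    {E E' : ℝ} (hE : |E| ≤ lam * P.C1) (hE' : |E'| ≤ lam * P.C1)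
    (hgg : ∀ s x, lam * |g s x - g' s x| + |E - E'| ≤ δ)
    (N : ℕ) (x : ℝ) (k : ℤ) (ω : ℝ) :
    ‖(windowMat N g lam x k ω - (E : ℂ) • (1 : Matrix (Fin N × S) (Fin N × S) ℂ)).det
      - (windowMat N g' lam x k ω - (E' : ℂ) • (1 : Matrix (Fin N × S) (Fin N × S) ℂ)).det‖
    ≤ (N * Fintype.card S).factorial * ((N * Fintype.card S : ℕ) * δ
      * ((P.C2 + 1) * lam) ^ (N * Fintype.card S)) := by
  have h1 : (1 : ℝ) ≤ (P.C2 + 1) * lam := by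
    have := P.one_le_C2
    nlinarith
  have h := norm_det_sub_det_le _ _ (δ := δ) h1 (P.norm_windowMat_sub_smul_le hl hg hE N x k ω)
    (P.norm_windowMat_sub_smul_le hl hg' hE' N x k ω) (fun p q => ?_)
  · simpa [Fintype.card_prod] using h
  · rw [windowMat, windowMat, stripMat_sub_smul_one, stripMat_sub_smul_one]
    rcases eq_or_ne p q with rfl | hpq
    · rw [stripMat_self, stripMat_self]
      refine le_trans ?_ (hgg p.2 (x + (k + (p.1 : ℕ)) * ω))
      rw [← Complex.ofReal_sub, ← Complex.ofReal_sub, ← Complex.ofReal_sub, Complex.norm_real,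
        Real.norm_eq_abs]
      set y := x + (k + (p.1 : ℕ)) * ω
      rw [show lam * g p.2 y - E - (lam * g' p.2 y - E')
        = lam * (g p.2 y - g' p.2 y) - (E - E') by ring]
      refine (abs_sub _ _).trans ?_
      rw [abs_mul, abs_of_nonneg (by linarith : 0 ≤ lam)]
    · rw [stripMat_of_ne _ hpq, stripMat_of_ne _ hpq, sub_self, norm_zero]
      have : 0 ≤ lam * |g p.2 x - g' p.2 x| := by positivity
      exact le_trans (add_nonneg this (abs_nonneg _)) (hgg p.2 x)

end StripPotential

theorem volume_setOf_distInt_sub_lt_le (w r : ℝ) :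
    volume {x ∈ Set.Ico (0 : ℝ) 1 | distInt (x - w) < r} ≤ ENNReal.ofReal (4 * r) := by
  have hsub : {x ∈ Set.Ico (0 : ℝ) 1 | distInt (x - w) < r} ⊆
      Set.Icc (w + round (-w) - r) (w + round (-w) + r) ∪
        Set.Icc (w + round (-w) + 1 - r) (w + round (-w) + 1 + r) := by
    rintro x ⟨⟨h0, h1⟩, hx⟩
    have hx' := abs_lt.1 hx
    have h2 : round (-w) ≤ round (x - w) := by
      rw [round_eq, round_eq]; exact Int.floor_mono (by linarith)
    have h3 : round (x - w) ≤ round (-w) + 1 := by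
      rw [← round_add_one, round_eq, round_eq]; exact Int.floor_mono (by linarith)
    obtain h | h : round (x - w) = round (-w) ∨ round (x - w) = round (-w) + 1 := by omega
    · left; rw [h] at hx'; constructor <;> linarith [hx'.1, hx'.2]
    · right; rw [h] at hx'; push_cast at hx'; constructor <;> linarith [hx'.1, hx'.2]
  rcases le_or_gt r 0 with hr | hr
  · refine le_trans (le_of_eq ?_) zero_le
    convert measure_empty (μ := (volume : Measure ℝ))
    ext x
    simp only [Set.mem_ofPred_eq, Set.mem_empty_iff_false, iff_false, not_and, not_lt]
    exact fun _ => hr.trans (distInt_nonneg _)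
  refine (measure_mono hsub).trans ((measure_union_le _ _).trans (le_of_eq ?_))
  rw [Real.volume_Icc, Real.volume_Icc, ← ENNReal.ofReal_add (by linarith) (by linarith)]
  congr 1; ring

theorem exp_neg_le_of_le_mul_sq {R j : ℝ} {q : ℕ} (hR : 0 < R) (h : R ≤ j * (q : ℝ) ^ 2)
    (M : ℕ) : Real.exp (-q) ≤ (2 * M).factorial * j ^ M / R ^ M := by
  have h1 := Real.pow_div_factorial_le_exp (q : ℝ) (by positivity) (2 * M)
  rw [Real.exp_neg, inv_le_comm₀ (Real.exp_pos _) (by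
    have : 0 < j := by
      by_contra hj
      nlinarith [sq_nonneg (q : ℝ)]
    positivity)]
  refine le_trans ?_ h1
  rw [inv_div, div_le_div_iff₀ ?_ (by positivity)]
  · have : R ^ M ≤ (j * (q : ℝ) ^ 2) ^ M := pow_le_pow_left₀ hR.le h M
    rw [mul_pow, ← pow_mul] at this
    calc R ^ M * ((2 * M).factorial : ℝ) ≤ (j ^ M * q ^ (2 * M)) * (2 * M).factorial := by gcongr
      _ = _ := by ring
  · have : 0 < j := by
      by_contra hj
      nlinarith [sq_nonneg (q : ℝ)]
    positivity

theorem eventually_pow_mul_factorial_mul_exp_le (A : ℝ) (hA : 0 ≤ A) (d : ℕ) :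
    ∀ᶠ N : ℕ in atTop, A ^ N * (N * d).factorial * (N * d : ℕ) * Real.exp (-(N : ℝ) ^ 2) ≤ 1 := by
  have h1 := eventually_ge_atTop (32 * (d + 1) ^ 3)
  have h2 := tendsto_natCast_atTop_atTop.eventually_ge_atTop (4 * A)
  filter_upwards [h1, h2, eventually_ge_atTop 1] with N h1 h2 h3
  have h1' : (32 * (d + 1) ^ 3 : ℝ) ≤ N := by exact_mod_cast h1
  have h3' : (1 : ℝ) ≤ N := by exact_mod_cast h3
  have hd : (0 : ℝ) ≤ d := by positivity
  set u := (N : ℝ) / (4 * (d + 1)) with hu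
  have hu0 : 0 ≤ u := by positivity
  have hexp : ((N * d : ℕ) : ℝ) ≤ Real.exp u := by
    have := Real.pow_div_factorial_le_exp u hu0 2
    refine le_trans ?_ this
    rw [hu, div_pow, Nat.factorial_two]
    push_cast
    rw [le_div_iff₀ (by norm_num), le_div_iff₀ (by positivity)]
    have : (N : ℝ) * d * 2 * (4 * (d + 1)) ^ 2 ≤ N * (32 * (d + 1) ^ 3) := by
      have : (d : ℝ) * (d + 1) ^ 2 ≤ (d + 1) ^ 3 := by nlinarith [sq_nonneg (d + 1 : ℝ)]
      nlinarith
    nlinarith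
  have hfac : ((N * d).factorial : ℝ) * (N * d : ℕ) ≤ Real.exp ((N : ℝ) ^ 2 / 4) := by
    calc ((N * d).factorial : ℝ) * (N * d : ℕ) ≤ ((N * d : ℕ) : ℝ) ^ (N * d) * (N * d : ℕ) := by
          gcongr
          exact_mod_cast Nat.factorial_le_pow _
      _ ≤ Real.exp u ^ (N * d) * Real.exp u := by gcongr
      _ = Real.exp ((N * d + 1) * u) := by
          rw [← Real.exp_nat_mul, ← Real.exp_add]; push_cast; ring_nf
      _ ≤ _ := by
          refine Real.exp_le_exp.2 ?_
          calc (N * d + 1 : ℝ) * u ≤ (N * d + N) * u := by gcongr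
            _ = _ := by rw [hu]; field_simp
  have hAN : A ^ N ≤ Real.exp ((N : ℝ) ^ 2 / 4) := by
    calc A ^ N ≤ Real.exp A ^ N := by gcongr; linarith [Real.add_one_le_exp A]
      _ = Real.exp (N * A) := by rw [← Real.exp_nat_mul]
      _ ≤ _ := Real.exp_le_exp.2 (by nlinarith)
  calc A ^ N * (N * d).factorial * (N * d : ℕ) * Real.exp (-(N : ℝ) ^ 2)
      = A ^ N * ((N * d).factorial * (N * d : ℕ)) * Real.exp (-(N : ℝ) ^ 2) := by ring
    _ ≤ Real.exp ((N : ℝ) ^ 2 / 4) * Real.exp ((N : ℝ) ^ 2 / 4) * Real.exp (-(N : ℝ) ^ 2) := by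
        gcongr
    _ = Real.exp (-((N : ℝ) ^ 2 / 2)) := by rw [← Real.exp_add, ← Real.exp_add]; ring_nf
    _ ≤ 1 := Real.exp_le_one_iff.2 (by nlinarith)

namespace StripPotential

variable {S : Type} [Fintype S] [MetricSpace S] [DecidableEq S] (P : StripPotential S)

/-- At scale `N`, perturbations of size `2 exp (-N ^ 2)` change the determinants by at most
`(lam ^ d / C4) ^ N / 8`. -/
def StableAt (lam C4 : ℝ) (N : ℕ) : Prop :=
  (N * Fintype.card S).factorial * ((N * Fintype.card S : ℕ) * (2 * Real.exp (-(N : ℝ) ^ 2))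
      * ((P.C2 + 1) * lam) ^ (N * Fintype.card S)) ≤ (lam ^ Fintype.card S / C4) ^ N / 8

theorem eventually_stableAt {lam C4 : ℝ} (hl : 1 ≤ lam) (hC4 : 1 ≤ C4) :
    ∀ᶠ N : ℕ in atTop, P.StableAt lam C4 N := by
  have hC2 := P.one_le_C2
  set d := Fintype.card S with hd
  have hl0 : 0 < lam := by linarith
  have hC40 : 0 < C4 := by linarith
  set A := 16 * (((P.C2 + 1) * lam) ^ d * (C4 / lam ^ d)) with hA
  filter_upwards [eventually_pow_mul_factorial_mul_exp_le A (by positivity) d,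
    eventually_ge_atTop 1] with N hN hN1
  have h16 : (16 : ℝ) ≤ 16 ^ N := le_self_pow₀ (by norm_num) (by omega)
  unfold StableAt
  rw [← hd, le_div_iff₀ (by norm_num), ← div_le_one (by positivity)]
  refine le_trans ?_ hN
  have hAe : A ^ N
      = 16 ^ N * (((P.C2 + 1) * lam) ^ (N * d) * (C4 ^ N / lam ^ (d * N))) := by
    rw [hA, mul_pow 16, mul_pow _ (C4 / lam ^ d), ← pow_mul, mul_comm d N, div_pow, ← pow_mul,
      mul_comm d N]
  rw [hAe, div_pow, ← pow_mul]
  calc _ = 16 * (((P.C2 + 1) * lam) ^ (N * d) * (C4 ^ N / lam ^ (d * N))) * (N * d).factorial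
        * (N * d : ℕ) * Real.exp (-(N : ℝ) ^ 2) := by field_simp; ring
    _ ≤ _ := by gcongr

theorem exists_approx_seq {lam : ℝ} (hl : 1 ≤ lam) :
    ∃ (g : ℕ → S → ℝ → ℝ) (b : ℕ → S → ℤ → ℂ),
      (∀ N s x, (g N s x : ℂ) = ∑ n ∈ Finset.Icc (-(N ^ 3 : ℕ) : ℤ) (N ^ 3 : ℕ), b N s n * expChar n x) ∧
      ∀ᶠ N : ℕ in atTop, ∀ s x, lam * |P.f s x - g N s x| ≤ Real.exp (-(2 * (N : ℝ) ^ 2)) := by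
  obtain ⟨c, hc, C, hC, h⟩ := P.exists_trigPoly_approx
  choose g b hb hg using fun N : ℕ => h (N ^ 3)
  refine ⟨g, b, hb, ?_⟩
  have hl0 : 0 < lam := by linarith
  filter_upwards [tendsto_natCast_atTop_atTop.eventually_ge_atTop ((lam * C + 2) / c),
    eventually_ge_atTop 1] with N hN hN1 s x
  have hN1' : (1 : ℝ) ≤ N := by exact_mod_cast hN1
  rw [div_le_iff₀ hc] at hN
  calc lam * |P.f s x - g N s x| ≤ lam * (C * Real.exp (-c * (N ^ 3 : ℕ))) := by
        gcongr; exact hg N s x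
    _ = (lam * C) * Real.exp (-c * (N ^ 3 : ℕ)) := by ring
    _ ≤ Real.exp (lam * C) * Real.exp (-c * (N ^ 3 : ℕ)) := by
        gcongr; linarith [Real.add_one_le_exp (lam * C)]
    _ = Real.exp (lam * C - c * N ^ 3) := by rw [← Real.exp_add]; push_cast; ring_nf
    _ ≤ _ := by
        refine Real.exp_le_exp.2 ?_
        have h1 : (lam * C + 2) * (N : ℝ) ^ 2 ≤ N * c * N ^ 2 := by gcongr
        have h2 : lam * C * 1 ≤ lam * C * (N : ℝ) ^ 2 := by gcongr; exact one_le_pow₀ hN1'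
        nlinarith

/-- The conclusion of `StripPotential.exists_centers` for a given coupling. -/
def HasCenters (lam C4 : ℝ) : Prop :=
  ∀ (N : ℕ) (ω E : ℝ), |E| ≤ lam * P.C1 → ∀ (r : ℚ) (R : ℕ), r.den ≤ R → |ω - r| ≤ 1 / (R * r.den) →
    ∃ Z : Finset ℝ, (Z.card : ℝ) ≤ C4 * N * R ∧ ∀ x : ℝ,
      (∀ a < R, ‖P.det N lam ω E ((x + a * ω : ℝ) : ℂ)‖ < (lam ^ Fintype.card S / C4) ^ N) →
        ∃ w ∈ Z, distInt (x - w) < Real.exp (-r.den)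

theorem volume_smallDetAt_le {lam C4 : ℝ} (hl : 1 ≤ lam) (hC4 : 1 ≤ C4) (hcen : P.HasCenters lam C4)
    {N R : ℕ} (hR : 0 < R) (hst : P.StableAt lam C4 N) {g : S → ℝ → ℝ}
    (hg : ∀ s x, lam * |P.f s x - g s x| ≤ Real.exp (-(N : ℝ) ^ 2)) (θ : ℝ) (m L : ℕ) {κ : ℝ}
    (hκ : κ ≤ (lam ^ Fintype.card S / C4) ^ N / 2) {j : ℕ} {ω : ℝ} (hω : Diophantine j ω) :
    ∃ q : ℕ, (R : ℝ) ≤ j * (q : ℝ) ^ 2 ∧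
      volume {x ∈ Set.Ico (0 : ℝ) 1 | SmallDetAt g lam θ m L N R κ ω x}
        ≤ ENNReal.ofReal ((L * Fintype.card S : ℕ) * (C4 * N * R) * (4 * Real.exp (-q))) := by
  classical
  obtain ⟨r, h1, h2, h3⟩ := hω.exists_rat hR
  refine ⟨r.den, h3, ?_⟩
  have hl0 : 0 < lam := by linarith
  have hg1 : ∀ s x, lam * |P.f s x - g s x| ≤ 1 := fun s x =>
    (hg s x).trans (Real.exp_le_one_iff.2 (by nlinarith))
  have hf1 : ∀ s x, lam * |P.f s x - P.f s x| ≤ 1 := fun s x => by simp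
  set hM := windowMat_isHermitian L g lam θ (-m) ω
  have hE := P.abs_eigenvalues_windowMat_le hl hg1 L θ (-m) ω
  choose Z hZc hZ using fun i => hcen N ω (hM.eigenvalues i) (hE i) r R h1 h2
  have hsub : {x ∈ Set.Ico (0 : ℝ) 1 | SmallDetAt g lam θ m L N R κ ω x} ⊆
      ⋃ i ∈ (Finset.univ : Finset (Fin L × S)), ⋃ w ∈ Z i,
        {x ∈ Set.Ico (0 : ℝ) 1 | distInt (x - w) < Real.exp (-r.den)} := by
    rintro x ⟨hx, i, hi⟩
    obtain ⟨w, hw, hxw⟩ := hZ i x fun a ha => by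
      have h4 := P.norm_det_windowMat_sub_le hl hf1 hg1 (hE i) (hE i)
        (δ := 2 * Real.exp (-(N : ℝ) ^ 2)) (fun s x => by
          have := hg s x
          have := Real.exp_pos (-(N : ℝ) ^ 2)
          rw [sub_self, abs_zero]; linarith) N x a ω
      have h5 := hi a ha
      have h6 := P.det_eq_windowMat N lam x a ω (hM.eigenvalues i)
      rw [Int.cast_natCast] at h6
      rw [h6]
      have h7 := norm_sub_norm_le (windowMat N P.f lam x a ω
        - ((hM.eigenvalues i : ℝ) : ℂ) • (1 : Matrix (Fin N × S) (Fin N × S) ℂ)).det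
        (windowMat N g lam x a ω
        - ((hM.eigenvalues i : ℝ) : ℂ) • (1 : Matrix (Fin N × S) (Fin N × S) ℂ)).det
      unfold StableAt at hst
      have : 0 < (lam ^ Fintype.card S / C4) ^ N := by positivity
      linarith
    simp only [Set.mem_iUnion]
    exact ⟨i, Finset.mem_univ _, w, hw, hx, hxw⟩
  refine (measure_mono hsub).trans ((measure_biUnion_finset_le _ _).trans ?_)
  calc _ ≤ ∑ i : Fin L × S, ENNReal.ofReal (C4 * N * R * (4 * Real.exp (-r.den))) := by
        refine Finset.sum_le_sum fun i _ => ?_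
        refine (measure_biUnion_finset_le _ _).trans
          ((Finset.sum_le_sum fun w _ => volume_setOf_distInt_sub_lt_le w _).trans ?_)
        rw [Finset.sum_const, nsmul_eq_mul, ← ENNReal.ofReal_natCast,
          ← ENNReal.ofReal_mul (by positivity)]
        exact ENNReal.ofReal_le_ofReal (by gcongr; exact hZc i)
    _ = _ := by
        rw [Finset.sum_const, nsmul_eq_mul, ← ENNReal.ofReal_natCast,
          ← ENNReal.ofReal_mul (by positivity)]
        congr 1
        simp [Fintype.card_prod]; ring

end StripPotential

theorem expChar_add_one (n : ℤ) (x : ℝ) : expChar n (x + 1) = expChar n x := by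
  rw [expChar_add]
  have : expChar n 1 = 1 := by
    rw [expChar, Complex.exp_eq_one_iff]
    exact ⟨n, by push_cast; ring⟩
  rw [this, mul_one]

/-- The integers of size between `K` and `8 * K`. -/
def dyadicShell (K : ℕ) : Finset ℤ :=
  (Finset.Icc (-(8 * K : ℕ) : ℤ) (8 * K : ℕ)).filter fun k => K ≤ k.natAbs

theorem mem_dyadicShell {K : ℕ} {k : ℤ} : k ∈ dyadicShell K ↔ K ≤ k.natAbs ∧ k.natAbs ≤ 8 * K := by
  simp only [dyadicShell, Finset.mem_filter, Finset.mem_Icc]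
  omega

theorem card_dyadicShell_le (K : ℕ) : (dyadicShell K).card ≤ 16 * K + 1 := by
  refine (Finset.card_filter_le _ _).trans ?_
  rw [Int.card_Icc]; omega

theorem exists_finset_crossings (θ : ℝ) (k : ℤ) (hk : k ≠ 0) : ∃ Z : Finset ℝ,
    Z.card ≤ 2 * k.natAbs + 2 ∧ ∀ t ∈ Set.Ico (0 : ℝ) 1, ∀ n : ℤ, θ + k * t = n → t ∈ Z := by
  classical
  refine ⟨(Finset.Icc (⌈θ⌉ - k.natAbs - 1) (⌈θ⌉ + k.natAbs)).image fun n : ℤ => (n - θ) / k,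
    Finset.card_image_le.trans ?_, fun t ht n h => Finset.mem_image.2 ⟨n, ?_, ?_⟩⟩
  · rw [Int.card_Icc]; omega
  · have h1 : |(k : ℝ) * t| ≤ (k.natAbs : ℤ) := by
      rw [abs_mul, abs_of_nonneg ht.1, Int.natCast_natAbs, Int.cast_abs]
      exact mul_le_of_le_one_right (abs_nonneg _) ht.2.le
    obtain ⟨h2, h3⟩ := abs_le.1 h1
    have h4 := Int.le_ceil θ
    have h5 := Int.ceil_lt_add_one θ
    rw [Finset.mem_Icc]
    constructor
    · have : ((⌈θ⌉ - k.natAbs - 1 : ℤ) : ℝ) ≤ n := by push_cast at *; linarith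
      exact_mod_cast this
    · have : ((n : ℤ) : ℝ) ≤ (⌈θ⌉ + k.natAbs : ℤ) := by push_cast at *; linarith
      exact_mod_cast this
  · have : (k : ℝ) ≠ 0 := by exact_mod_cast hk
    rw [← h]; field_simp; ring

section Windows

variable {S : Type} [Fintype S] [MetricSpace S] [DecidableEq S]

theorem SmallDetAt.mono {g : S → ℝ → ℝ} {lam θ : ℝ} {m L N R : ℕ} {κ κ' ω x : ℝ}
    (h : SmallDetAt g lam θ m L N R κ ω x) (hκ : κ ≤ κ') : SmallDetAt g lam θ m L N R κ' ω x :=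
  let ⟨i, hi⟩ := h
  ⟨i, fun a ha => (hi a ha).trans hκ⟩

theorem SmallDetAt.of_add_int {g : S → ℝ → ℝ} (hg : ∀ s, Function.Periodic (g s) 1) {lam θ : ℝ}
    {m L N R : ℕ} {κ ω x : ℝ} {n : ℤ} (h : SmallDetAt g lam θ m L N R κ ω (x + n)) :
    SmallDetAt g lam θ m L N R κ ω x := by
  have : ∀ k, windowMat N g lam (x + n) k ω = windowMat N g lam x k ω := by
    intro k
    unfold windowMat
    congr 1
    ext i s
    rw [show x + n + (k + i) * ω = x + (k + i) * ω + n * 1 by ring, (hg s).int_mul n]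
  simpa only [SmallDetAt, this] using h

theorem crossDeg_zero_le {d m L N R : ℕ} (hN : 1 ≤ N) (hm : m ≤ N ^ 6) (hL : L ≤ 2 * N ^ 6 + 1)
    (hR : R ≤ N) : crossDeg d (N ^ 3) m L N R 0 ≤ 36 * d ^ 2 * N ^ 16 := by
  have h6 : 1 ≤ N ^ 6 := Nat.one_le_pow _ _ hN
  have h1 : 2 * (N * d * (N ^ 3 * (0 + R + N))) + 2 * (N * d) * (N ^ 3 * (m + L))
      ≤ 12 * d * N ^ 10 := by
    calc _ ≤ 2 * (N * d * (N ^ 3 * (0 + N + N))) + 2 * (N * d) * (N ^ 3 * (N ^ 6 + 3 * N ^ 6)) := by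
          gcongr; omega
      _ = 4 * d * N ^ 5 * 1 + 8 * d * N ^ 10 := by ring
      _ ≤ 4 * d * N ^ 5 * N ^ 5 + 8 * d * N ^ 10 := by gcongr; exact Nat.one_le_pow _ _ hN
      _ = _ := by ring
  calc crossDeg d (N ^ 3) m L N R 0 ≤ (3 * N ^ 6) * d * (12 * d * N ^ 10) := by
        unfold crossDeg; gcongr; omega
    _ = _ := by ring

theorem crossDeg_le {d m L N R k : ℕ} (hN : 1 ≤ N) (hm : m ≤ N ^ 6) (hL : L ≤ 2 * N ^ 6 + 1)
    (hR : R ≤ N) (hk : k ≤ 8 * N ^ 31) :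
    crossDeg d (N ^ 3) m L N R k ≤ 84 * d ^ 2 * N ^ 41 := by
  have h6 : 1 ≤ N ^ 6 := Nat.one_le_pow _ _ hN
  have h1 : 2 * (N * d * (N ^ 3 * (k + R + N))) + 2 * (N * d) * (N ^ 3 * (m + L))
      ≤ 28 * d * N ^ 35 := by
    calc _ ≤ 2 * (N * d * (N ^ 3 * (8 * N ^ 31 + N + N))) + 2 * (N * d) * (N ^ 3 * (N ^ 6 + 3 * N ^ 6)) := by
          gcongr; omega
      _ = 16 * d * N ^ 35 + 4 * d * N ^ 5 * 1 + 8 * d * N ^ 10 * 1 := by ring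
      _ ≤ 16 * d * N ^ 35 + 4 * d * N ^ 5 * N ^ 30 + 8 * d * N ^ 10 * N ^ 25 := by
          gcongr <;> exact Nat.one_le_pow _ _ hN
      _ = _ := by ring
  calc crossDeg d (N ^ 3) m L N R k ≤ (3 * N ^ 6) * d * (28 * d * N ^ 35) := by
        unfold crossDeg; gcongr; omega
    _ = _ := by ring

end Windows

namespace StripPotential

variable {S : Type} [Fintype S] [MetricSpace S] [DecidableEq S] (P : StripPotential S)

/-- A bound for `exp (-q) * n ^ M` when `n ≤ 4 * j * q ^ 2`. -/
@[irreducible] def expConst (M j : ℕ) : ℝ := (2 * M).factorial * (4 * j) ^ M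

theorem expConst_nonneg (M j : ℕ) : 0 ≤ expConst M j := by unfold expConst; positivity

theorem exp_neg_le_expConst {N R j q : ℕ} (hN : 1 ≤ N) (hNR : N ≤ 4 * R)
    (hq : (R : ℝ) ≤ j * (q : ℝ) ^ 2) (M : ℕ) : Real.exp (-q) ≤ expConst M j / N ^ M := by
  have h2 : (N : ℝ) ≤ 4 * j * (q : ℝ) ^ 2 := by
    have : (N : ℝ) ≤ 4 * R := by exact_mod_cast hNR
    linarith
  rw [expConst]
  exact exp_neg_le_of_le_mul_sq (by exact_mod_cast hN) h2 M

/-- The constant in the bound for the measure of resonant frequencies. -/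
def resConst (C4 : ℝ) (j : ℕ) : ℝ :=
  72 * (Fintype.card S : ℝ) ^ 2 + (2856 * (Fintype.card S : ℝ) ^ 2 + 307)
    * (12 * Fintype.card S * C4 * expConst 64 j)

theorem volume_resonant_le_of_window {lam C4 : ℝ} (hl : 1 ≤ lam) (hC4 : 1 ≤ C4)
    (hcen : P.HasCenters lam C4) {N R : ℕ} (hN : 1 ≤ N) (hR : 1 ≤ R) (hRN : R ≤ N) (hNR : N ≤ 4 * R)
    (hst : P.StableAt lam C4 N) {g : S → ℝ → ℝ} {b : S → ℤ → ℂ}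
    (hb : ∀ s x, (g s x : ℂ) = ∑ n ∈ Finset.Icc (-(N ^ 3 : ℕ) : ℤ) (N ^ 3 : ℕ), b s n * expChar n x)
    (hg : ∀ s x, lam * |P.f s x - g s x| ≤ Real.exp (-(N : ℝ) ^ 2)) (θ : ℝ) {m L : ℕ}
    (hm : m ≤ N ^ 6) (hL : L ≤ 2 * N ^ 6 + 1) {κ : ℝ} (hκ0 : 0 < κ)
    (hκ : κ ≤ (lam ^ Fintype.card S / C4) ^ N / 2)
    (hκgen : ∀ k ∈ dyadicShell (N ^ 31), ∃ Z : Finset ℝ,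
      Z.card ≤ R * (2 * crossDeg (Fintype.card S) (N ^ 3) m L N R k.natAbs) ∧
      ∀ I ⊆ Set.Ico (0 : ℝ) 1, IsPreconnected I → Disjoint I Z → ∀ s ∈ I, ∀ t ∈ I,
        (SmallDetAt g lam θ m L N R κ s (θ + k * s) ↔ SmallDetAt g lam θ m L N R κ t (θ + k * t)))
    (j : ℕ) :
    volume {ω ∈ Set.Ico (0 : ℝ) 1 | Diophantine j ω ∧
        ∃ k ∈ dyadicShell (N ^ 31), SmallDetAt g lam θ m L N R κ ω (θ + k * ω)}
      ≤ ENNReal.ofReal (resConst (S := S) C4 j / N ^ 14) := by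
  classical
  set d := Fintype.card S with hd
  have hK : 1 ≤ N ^ 31 := Nat.one_le_pow _ _ hN
  have hN0 : (0 : ℝ) < N := by exact_mod_cast hN
  have hR0 : (0 : ℝ) < R := by exact_mod_cast hR
  have hgper : ∀ s, Function.Periodic (g s) 1 := fun s x => by
    have : (g s (x + 1) : ℂ) = g s x := by simp only [hb, expChar_add_one]
    exact_mod_cast this
  choose! Zl hZlc hZl using hκgen
  choose! Zc hZcc hZc using fun k : ℤ => exists_finset_crossings θ k
  set ks := dyadicShell (N ^ 31) with hks
  have hk0 : ∀ k ∈ ks, k ≠ 0 := by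
    rintro k hk rfl
    have := (mem_dyadicShell.1 hk).1
    simp at this
    omega
  set Z : Finset ℝ := insert 0 (ks.biUnion fun k => Zl k ∪ Zc k) with hZ
  have hZcard : Z.card ≤ (2856 * d ^ 2 + 307) * N ^ 73 := by
    have h1 : ∀ k ∈ ks, (Zl k ∪ Zc k).card ≤ 168 * d ^ 2 * N ^ 42 + 18 * N ^ 31 := by
      intro k hk
      have hk8 := (mem_dyadicShell.1 hk).2
      refine (Finset.card_union_le _ _).trans (add_le_add ((hZlc k hk).trans ?_)
        ((hZcc k (hk0 k hk)).trans (by omega)))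
      calc R * (2 * crossDeg d (N ^ 3) m L N R k.natAbs) ≤ N * (2 * (84 * d ^ 2 * N ^ 41)) := by
            gcongr; exact crossDeg_le hN hm hL hRN hk8
        _ = _ := by ring
    calc Z.card ≤ (ks.biUnion fun k => Zl k ∪ Zc k).card + 1 := Finset.card_insert_le _ _
      _ ≤ ks.card * (168 * d ^ 2 * N ^ 42 + 18 * N ^ 31) + 1 := by
          gcongr
          exact Finset.card_biUnion_le_card_mul _ _ _ h1
      _ ≤ (17 * N ^ 31) * (168 * d ^ 2 * N ^ 42 + 18 * N ^ 31) + 1 := by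
          gcongr
          exact (card_dyadicShell_le _).trans (by omega)
      _ = 2856 * d ^ 2 * N ^ 73 + 306 * N ^ 62 * 1 + 1 := by ring
      _ ≤ 2856 * d ^ 2 * N ^ 73 + 306 * N ^ 62 * N ^ 11 + N ^ 73 := by
          gcongr <;> exact Nat.one_le_pow _ _ hN
      _ = _ := by ring
  set η : ℝ := 12 * d * C4 * expConst 64 j * N ^ 8 / N ^ 64 with hη
  have hec := expConst_nonneg 64 j
  have hη0 : 0 ≤ η := by positivity
  have main := volume_le_of_steep_lines (Sm := fun ω x => SmallDetAt g lam θ m L N R κ ω x)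
    (fun ω x n h => h.of_add_int hgper) θ ks hK (fun k hk => (mem_dyadicShell.1 hk).1) Z
    (Finset.mem_insert_self _ _)
    (fun k hk t ht n h => Finset.mem_insert_of_mem (Finset.mem_biUnion.2
      ⟨k, hk, Finset.mem_union_right _ (hZc k (hk0 k hk) t ht n h)⟩))
    (fun k hk I hI hpre hdis => hZl k hk I hI hpre (hdis.mono_right (by
      intro z hz
      exact Finset.mem_insert_of_mem (Finset.mem_biUnion.2 ⟨k, hk, Finset.mem_union_left _ hz⟩))))
    (B := R * (2 * crossDeg d (N ^ 3) m L N R 0))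
    (fun x T I hI hpre hdisj hch => card_le_of_horizontal hb lam θ m L N R x hκ0 T I hI hpre hdisj hch)
    {ω | Diophantine j ω} (η := ENNReal.ofReal η) (fun ω hω _ => by
      obtain ⟨q, hq, hvol⟩ := P.volume_smallDetAt_le hl hC4 hcen hR hst hg θ m L hκ hω
      refine hvol.trans (ENNReal.ofReal_le_ofReal ?_)
      have h1 := exp_neg_le_expConst hN hNR hq 64
      have h4 : ((L * d : ℕ) : ℝ) ≤ 3 * N ^ 6 * d := by
        have : L ≤ 3 * N ^ 6 := by
          have : 1 ≤ N ^ 6 := Nat.one_le_pow _ _ hN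
          omega
        exact_mod_cast Nat.mul_le_mul_right d this
      calc ((L * d : ℕ) : ℝ) * (C4 * N * R) * (4 * Real.exp (-q))
          ≤ (3 * N ^ 6 * d) * (C4 * N * N) * (4 * (expConst 64 j / N ^ 64)) := by
            gcongr
        _ = η := by rw [hη]; ring)
  have hB : ((R * (2 * crossDeg d (N ^ 3) m L N R 0) : ℕ) : ℝ) ≤ 72 * d ^ 2 * N ^ 17 := by
    have : R * (2 * crossDeg d (N ^ 3) m L N R 0) ≤ 72 * d ^ 2 * N ^ 17 := by
      calc R * (2 * crossDeg d (N ^ 3) m L N R 0) ≤ N * (2 * (36 * d ^ 2 * N ^ 16)) := by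
            gcongr; exact crossDeg_zero_le hN hm hL hRN
        _ = _ := by ring
    exact_mod_cast this
  have hZc' : (Z.card : ℝ) ≤ (2856 * d ^ 2 + 307) * N ^ 73 := by exact_mod_cast hZcard
  have hfin : ((N ^ 31 : ℕ) : ENNReal) * volume {ω ∈ Set.Ico (0 : ℝ) 1 | Diophantine j ω ∧
        ∃ k ∈ dyadicShell (N ^ 31), SmallDetAt g lam θ m L N R κ ω (θ + k * ω)}
      ≤ ((N ^ 31 : ℕ) : ENNReal) * ENNReal.ofReal (resConst (S := S) C4 j / N ^ 14) := by
    refine main.trans ?_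
    rw [← ENNReal.ofReal_natCast, ← ENNReal.ofReal_natCast, ← ENNReal.ofReal_natCast,
      ← ENNReal.ofReal_mul (by positivity), ← ENNReal.ofReal_mul (by positivity),
      ← ENNReal.ofReal_add (by positivity) (by positivity)]
    refine ENNReal.ofReal_le_ofReal ?_
    calc _ ≤ 72 * d ^ 2 * (N : ℝ) ^ 17 + (2856 * d ^ 2 + 307) * N ^ 73 * η := by gcongr
      _ = _ := by
        rw [hη, resConst]
        push_cast
        field_simp
        ring
  have hK0 : ((N ^ 31 : ℕ) : ENNReal) ≠ 0 := by exact_mod_cast (by omega : N ^ 31 ≠ 0)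
  exact (ENNReal.mul_le_mul_iff_right hK0 (ENNReal.natCast_ne_top _)).1 hfin

theorem volume_resonant_le {lam C4 : ℝ} (hl : 1 ≤ lam) (hC4 : 1 ≤ C4)
    (hcen : P.HasCenters lam C4) {N R : ℕ} (hN : 1 ≤ N) (hR : 1 ≤ R) (hRN : R ≤ N) (hNR : N ≤ 4 * R)
    (hst : P.StableAt lam C4 N) {g : S → ℝ → ℝ} {b : S → ℤ → ℂ}
    (hb : ∀ s x, (g s x : ℂ) = ∑ n ∈ Finset.Icc (-(N ^ 3 : ℕ) : ℤ) (N ^ 3 : ℕ), b s n * expChar n x)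
    (hg : ∀ s x, lam * |P.f s x - g s x| ≤ Real.exp (-(N : ℝ) ^ 2)) (θ : ℝ) (j : ℕ) :
    volume {ω ∈ Set.Ico (0 : ℝ) 1 | Diophantine j ω ∧ ∃ m ≤ N ^ 6, ∃ L ≤ 2 * N ^ 6 + 1,
        ∃ k ∈ dyadicShell (N ^ 31),
          SmallDetAt g lam θ m L N R ((lam ^ Fintype.card S / C4) ^ N / 4) ω (θ + k * ω)}
      ≤ ENNReal.ofReal (8 * resConst (S := S) C4 j / N ^ 2) := by
  classical
  set κ0 := (lam ^ Fintype.card S / C4) ^ N with hκ0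
  have hl0 : 0 < lam := by linarith
  have hC40 : 0 < C4 := by linarith
  have hN0 : (0 : ℝ) < N := by exact_mod_cast hN
  have hκ0pos : 0 < κ0 := by positivity
  have hfin : (⋃ m ∈ Finset.range (N ^ 6 + 1), ⋃ L ∈ Finset.range (2 * N ^ 6 + 2),
      ⋃ k ∈ dyadicShell (N ^ 31), {κ : ℝ | 0 < κ ∧ ¬ ∃ Z : Finset ℝ,
        Z.card ≤ R * (2 * crossDeg (Fintype.card S) (N ^ 3) m L N R k.natAbs) ∧
        ∀ I ⊆ Set.Ico (0 : ℝ) 1, IsPreconnected I → Disjoint I Z → ∀ s ∈ I, ∀ t ∈ I,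
        (SmallDetAt g lam θ m L N R κ s (θ + k * s) ↔
          SmallDetAt g lam θ m L N R κ t (θ + k * t))}).Finite :=
    Set.Finite.biUnion (Finset.finite_toSet _) fun m _ =>
      Set.Finite.biUnion (Finset.finite_toSet _) fun L _ =>
        Set.Finite.biUnion (Finset.finite_toSet _) fun k _ =>
          smallDetAt_iff_of_line hb lam θ m L N R θ k
  obtain ⟨κ, hκ, hκgen⟩ := (Set.Ioo_infinite (show κ0 / 4 < κ0 / 2 by linarith)).exists_notMem_finite hfin
  have hκ1 : 0 < κ := by linarith [hκ.1]
  replace hκgen : ∀ m < N ^ 6 + 1, ∀ L < 2 * N ^ 6 + 2, ∀ k ∈ dyadicShell (N ^ 31), ∃ Z : Finset ℝ,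
        Z.card ≤ R * (2 * crossDeg (Fintype.card S) (N ^ 3) m L N R k.natAbs) ∧
        ∀ I ⊆ Set.Ico (0 : ℝ) 1, IsPreconnected I → Disjoint I Z → ∀ s ∈ I, ∀ t ∈ I,
        (SmallDetAt g lam θ m L N R κ s (θ + k * s) ↔
          SmallDetAt g lam θ m L N R κ t (θ + k * t)) := by
    intro m hm L hL k hk
    by_contra hbad
    exact hκgen (Set.mem_biUnion (Finset.mem_coe.2 (Finset.mem_range.2 hm))
      (Set.mem_biUnion (Finset.mem_coe.2 (Finset.mem_range.2 hL)) (Set.mem_biUnion hk ⟨hκ1, hbad⟩)))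
  have hsub : {ω ∈ Set.Ico (0 : ℝ) 1 | Diophantine j ω ∧ ∃ m ≤ N ^ 6, ∃ L ≤ 2 * N ^ 6 + 1,
        ∃ k ∈ dyadicShell (N ^ 31), SmallDetAt g lam θ m L N R (κ0 / 4) ω (θ + k * ω)} ⊆
      ⋃ m ∈ Finset.range (N ^ 6 + 1), ⋃ L ∈ Finset.range (2 * N ^ 6 + 2),
        {ω ∈ Set.Ico (0 : ℝ) 1 | Diophantine j ω ∧
        ∃ k ∈ dyadicShell (N ^ 31), SmallDetAt g lam θ m L N R κ ω (θ + k * ω)} := by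
    rintro ω ⟨h0, h1, m, hm, L, hL, k, hk, h2⟩
    simp only [Set.mem_iUnion, Finset.mem_range]
    exact ⟨m, by omega, L, by omega, h0, h1, k, hk, h2.mono hκ.1.le⟩
  refine (measure_mono hsub).trans ((measure_biUnion_finset_le _ _).trans ?_)
  have hc0 : 0 ≤ resConst (S := S) C4 j := by
    have := expConst_nonneg 64 j
    unfold resConst; positivity
  calc _ ≤ ∑ m ∈ Finset.range (N ^ 6 + 1), ∑ L ∈ Finset.range (2 * N ^ 6 + 2),
        ENNReal.ofReal (resConst (S := S) C4 j / N ^ 14) := by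
        refine Finset.sum_le_sum fun m hm => (measure_biUnion_finset_le _ _).trans
          (Finset.sum_le_sum fun L hL => ?_)
        rw [Finset.mem_range] at hm hL
        exact P.volume_resonant_le_of_window hl hC4 hcen hN hR hRN hNR hst hb hg θ (by omega)
          (by omega) hκ1 hκ.2.le (fun k hk => hκgen m hm L hL k hk) j
    _ = ENNReal.ofReal ((N ^ 6 + 1 : ℕ) * ((2 * N ^ 6 + 2 : ℕ) * (resConst (S := S) C4 j / N ^ 14))) := by
        rw [Finset.sum_const, Finset.sum_const, Finset.card_range, Finset.card_range, nsmul_eq_mul,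
          nsmul_eq_mul, ENNReal.ofReal_mul (by positivity), ENNReal.ofReal_mul (by positivity),
          ENNReal.ofReal_natCast, ENNReal.ofReal_natCast]
    _ ≤ _ := by
        refine ENNReal.ofReal_le_ofReal ?_
        have h6 : 1 ≤ N ^ 6 := Nat.one_le_pow _ _ hN
        have h1 : ((N ^ 6 + 1 : ℕ) : ℝ) ≤ 2 * N ^ 6 := by exact_mod_cast (by omega)
        have h2 : ((2 * N ^ 6 + 2 : ℕ) : ℝ) ≤ 4 * N ^ 6 := by exact_mod_cast (by omega)
        calc _ ≤ (2 * N ^ 6) * ((4 * N ^ 6) * (resConst (S := S) C4 j / N ^ 14)) := by gcongr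
          _ = _ := by field_simp; ring

end StripPotential

theorem ENNReal.tsum_ofReal_div_sq_ne_top (c : ℝ) :
    ∑' ν : ℕ, ENNReal.ofReal (c / ((8 * ν : ℕ) : ℝ) ^ 2) ≠ ⊤ := by
  have h : Summable fun ν : ℕ => c / ((8 * ν : ℕ) : ℝ) ^ 2 := by
    have := ((Real.summable_one_div_nat_pow (p := 2)).2 (by norm_num)).mul_left (c / 64)
    refine this.congr fun ν => ?_
    push_cast
    rcases eq_or_ne (ν : ℝ) 0 with h | h
    · simp [h]
    · field_simp; norm_num
  exact h.tsum_ofReal_ne_top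

namespace StripPotential

variable {S : Type} [Fintype S] [MetricSpace S] [DecidableEq S] (P : StripPotential S)

/-- No determinant of length `N` on the shell `N ^ 31 ≤ |k| ≤ 8 * N ^ 31` resonates with an
eigenvalue of a window of length at most `2 * N ^ 6 + 1` around the origin. -/
def NonresonantAt (g : S → ℝ → ℝ) (lam C4 θ ω : ℝ) (N R : ℕ) : Prop :=
  ∀ m ≤ N ^ 6, ∀ L ≤ 2 * N ^ 6 + 1, ∀ k ∈ dyadicShell (N ^ 31),
    ¬ SmallDetAt g lam θ m L N R ((lam ^ Fintype.card S / C4) ^ N / 4) ω (θ + k * ω)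

/-- The functions `g N` approximate the potential superexponentially well. -/
def IsApprox (g : ℕ → S → ℝ → ℝ) (lam : ℝ) : Prop :=
  ∀ᶠ N : ℕ in atTop, ∀ s x, lam * |P.f s x - g N s x| ≤ Real.exp (-(2 * (N : ℝ) ^ 2))

theorem ae_eventually_nonresonantAt {lam C4 : ℝ} (hl : 1 ≤ lam) (hC4 : 1 ≤ C4)
    (hcen : P.HasCenters lam C4) {g : ℕ → S → ℝ → ℝ} {b : ℕ → S → ℤ → ℂ}
    (hb : ∀ N s x, (g N s x : ℂ)
      = ∑ n ∈ Finset.Icc (-(N ^ 3 : ℕ) : ℤ) (N ^ 3 : ℕ), b N s n * expChar n x)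
    (hg : P.IsApprox g lam) (θ : ℝ) :
    ∀ᵐ ω : ℝ, ω ∈ Set.Ico (0 : ℝ) 1 → ∃ j, 0 < j ∧ Diophantine j ω ∧
      ∀ᶠ ν : ℕ in atTop, NonresonantAt (g (8 * ν)) lam C4 θ ω (8 * ν) (2 * ν) := by
  have h8 : Tendsto (fun ν : ℕ => 8 * ν) atTop atTop :=
    tendsto_id.const_mul_atTop' (by norm_num)
  have hall : ∀ᵐ ω : ℝ, ∀ j : ℕ, ω ∈ Set.Ico (0 : ℝ) 1 → Diophantine j ω →
      ∀ᶠ ν : ℕ in atTop, NonresonantAt (g (8 * ν)) lam C4 θ ω (8 * ν) (2 * ν) := by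
    refine ae_all_iff.2 fun j => ?_
    obtain ⟨ν0, hν0⟩ := eventually_atTop.1 ((h8.eventually hg).and
      ((h8.eventually (P.eventually_stableAt hl hC4)).and (eventually_ge_atTop 1)))
    set X : ℕ → Set ℝ := fun ν => {ω | ν0 ≤ ν ∧ ω ∈ Set.Ico (0 : ℝ) 1 ∧ Diophantine j ω ∧
        ∃ m ≤ (8 * ν) ^ 6, ∃ L ≤ 2 * (8 * ν) ^ 6 + 1, ∃ k ∈ dyadicShell ((8 * ν) ^ 31),
          SmallDetAt (g (8 * ν)) lam θ m L (8 * ν) (2 * ν)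
            ((lam ^ Fintype.card S / C4) ^ (8 * ν) / 4) ω (θ + k * ω)} with hX
    have hXvol : ∀ ν, volume (X ν)
        ≤ ENNReal.ofReal (8 * resConst (S := S) C4 j / ((8 * ν : ℕ) : ℝ) ^ 2) := by
      intro ν
      by_cases hν : ν0 ≤ ν
      · obtain ⟨h1, h2, h3⟩ := hν0 ν hν
        refine (measure_mono ?_).trans (P.volume_resonant_le hl hC4 hcen (N := 8 * ν) (R := 2 * ν)
          (by omega) (by omega) (by omega) (by omega) h2 (hb _) (fun s x => (h1 s x).trans ?_) θ j)
        · rintro ω ⟨-, h4, h5⟩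
          exact ⟨h4, h5⟩
        · exact Real.exp_le_exp.2 (by nlinarith)
      · simp [hX, hν]
    have hsum : ∑' ν, volume (X ν) ≠ ⊤ :=
      ne_top_of_le_ne_top (ENNReal.tsum_ofReal_div_sq_ne_top _) (ENNReal.tsum_le_tsum hXvol)
    filter_upwards [ae_eventually_notMem hsum] with ω hω hω1 hωj
    filter_upwards [hω, eventually_ge_atTop ν0] with ν hν hν' m hm L hL k hk hbad
    exact hν ⟨hν', hω1, hωj, m, hm, L, hL, k, hk, hbad⟩
  filter_upwards [hall, ae_exists_diophantine] with ω h1 ⟨j, hj, h2⟩ h3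
  exact ⟨j, hj, h2, h1 j h3 h2⟩

/-- One of the `2 * ν` windows of length `8 * ν` starting at `k, k + 1, …` has a determinant that
is not too small. -/
def GoodAt (lam C4 θ ω E : ℝ) (ν : ℕ) (k : ℤ) : Prop :=
  ∃ a < 2 * ν, (lam ^ Fintype.card S / C4) ^ (8 * ν) / 8 ≤
    ‖(windowMat (8 * ν) P.f lam θ (k + a) ω
      - (E : ℂ) • (1 : Matrix (Fin (8 * ν) × S) (Fin (8 * ν) × S) ℂ)).det‖

theorem one_lt_mul_of_diophantine {j : ℕ} {ω : ℝ} (hω : Diophantine j ω) {n : ℤ} (hn : n ≠ 0) {M : ℕ}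
    (hM : n.natAbs ≤ M) : 1 ≤ j * (M : ℝ) ^ 2 * distInt (n * ω) := by
  have h : ∃ p : ℤ, |(n.natAbs : ℝ) * ω - p| = distInt (n * ω) := by
    rcases Int.natAbs_eq n with h | h
    · refine ⟨round (n * ω), ?_⟩
      have : ((n : ℤ) : ℝ) = (n.natAbs : ℝ) := by rw [h]; simp
      rw [distInt, this]
    · refine ⟨-round (n * ω), ?_⟩
      have : ((n.natAbs : ℕ) : ℝ) = -(n : ℝ) := by
        have : ((n.natAbs : ℕ) : ℤ) = -n := by omega
        rw [← Int.cast_natCast, this, Int.cast_neg]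
      rw [distInt, this, ← abs_neg]
      congr 1; push_cast; ring
  obtain ⟨p, hp⟩ := h
  have h1 := hω n.natAbs (by omega) p
  rw [hp] at h1
  refine h1.trans ?_
  have := distInt_nonneg (n * ω)
  gcongr

/-- Bad positions are so sparse that long runs of good ones exist. -/
theorem eventually_exists_good_run {lam C4 : ℝ} (hl : 1 ≤ lam) (hC4 : 1 ≤ C4)
    (hcen : P.HasCenters lam C4) (θ : ℝ) {j : ℕ} {ω : ℝ} (hω : Diophantine j ω) :
    ∀ᶠ ν : ℕ in atTop, ∀ E, |E| ≤ lam * P.C1 → ∀ A : ℤ, ∃ c : ℤ,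
      A + (8 * ν : ℕ) ^ 3 ≤ c ∧ c + (8 * ν : ℕ) ^ 3 ≤ A + (8 * ν : ℕ) ^ 6 ∧
      ∀ n, |n - c| ≤ (8 * ν : ℕ) ^ 3 → P.GoodAt lam C4 θ ω E ν n := by
  have h8 : Tendsto (fun ν : ℕ => 8 * ν) atTop atTop :=
    tendsto_id.const_mul_atTop' (by norm_num)
  have h8' := (tendsto_natCast_atTop_atTop (R := ℝ)).comp h8
  filter_upwards [h8'.eventually_gt_atTop (2 * j * expConst 13 j), h8'.eventually_ge_atTop (3 * (C4 + 1)),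
    eventually_ge_atTop 1] with ν hν1 hν2 hν3 E hE A
  set N := 8 * ν with hN
  simp only [Function.comp] at hν1 hν2
  have hN1 : 1 ≤ N := by omega
  have hN0 : (1 : ℝ) ≤ N := by exact_mod_cast hN1
  have hl0 : 0 < lam := by linarith
  have hC40 : 0 < C4 := by linarith
  obtain ⟨r, h1, h2, h3⟩ := hω.exists_rat (R := 2 * ν) (by omega)
  obtain ⟨Z, hZc, hZ⟩ := hcen N ω E hE r (2 * ν) h1 h2
  have hbad : ∀ k, ¬ P.GoodAt lam C4 θ ω E ν k →
      ∃ w ∈ Z, distInt (θ + k * ω - w) < Real.exp (-r.den) := by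
    intro k hk
    refine hZ _ fun a ha => ?_
    unfold GoodAt at hk
    push Not at hk
    have h4 := hk a ha
    rw [← P.det_eq_windowMat] at h4
    have h5 : (θ + k * ω + a * ω : ℝ) = θ + ((k + a : ℤ) : ℝ) * ω := by push_cast; ring
    rw [h5]
    refine h4.trans_le ?_
    have : 0 < (lam ^ Fintype.card S / C4) ^ (8 * ν) := by positivity
    linarith
  have hsep : ∀ k k' : ℤ, k ≠ k' → |k - k'| ≤ (N : ℕ) ^ 6 → ∀ w,
      distInt (θ + k * ω - w) < Real.exp (-r.den) →
      distInt (θ + k' * ω - w) < Real.exp (-r.den) → False := by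
    intro k k' hne hle w hk hk'
    have h4 := one_lt_mul_of_diophantine hω (sub_ne_zero.2 hne) (M := N ^ 6) (by
      zify; exact_mod_cast hle)
    have h5 : distInt ((k - k' : ℤ) * ω) < 2 * Real.exp (-r.den) := by
      set n := round (θ + k * ω - w)
      set n' := round (θ + k' * ω - w)
      have h6 := distInt_le_abs_sub ((k - k' : ℤ) * ω) (n - n')
      have h7 : ((k - k' : ℤ) * ω - (n - n' : ℤ)) = (θ + k * ω - w - n) - (θ + k' * ω - w - n') := by
        push_cast; ring
      rw [h7] at h6
      have h8 := abs_sub (θ + k * ω - w - n) (θ + k' * ω - w - n')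
      unfold distInt at hk hk'
      linarith
    have h6 := exp_neg_le_expConst (N := N) hN1 (by omega) h3 13
    have hc := expConst_nonneg 13 j
    have h7 : (j : ℝ) * ((N ^ 6 : ℕ) : ℝ) ^ 2 * distInt ((k - k' : ℤ) * ω)
        ≤ (j : ℝ) * ((N ^ 6 : ℕ) : ℝ) ^ 2 * (2 * (expConst 13 j / N ^ 13)) := by
      gcongr
      linarith
    have h8 : (j : ℝ) * ((N ^ 6 : ℕ) : ℝ) ^ 2 * (2 * (expConst 13 j / N ^ 13))
        = 2 * j * expConst 13 j / N := by
      push_cast; field_simp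
    rw [h8] at h7
    have h9 : 2 * j * expConst 13 j / N < 1 := by
      rw [div_lt_one (by linarith)]; exact hν1
    linarith
  set l : ℤ := 2 * (N : ℤ) ^ 3 + 1 with hl_def
  have hl1 : 0 < l := by positivity
  have hblocks : ((Z.card + 1 : ℕ) : ℤ) * l ≤ (N : ℤ) ^ 6 := by
    have : ((Z.card : ℝ) + 1) * (2 * (N : ℝ) ^ 3 + 1) ≤ (N : ℝ) ^ 6 := by
      have h4 : (Z.card : ℝ) + 1 ≤ (C4 + 1) * N ^ 2 := by
        have h5 : ((2 * ν : ℕ) : ℝ) ≤ N := by exact_mod_cast (by omega)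
        have h6 : C4 * N * ((2 * ν : ℕ) : ℝ) ≤ C4 * N * N := by gcongr
        nlinarith
      have h5 : 2 * (N : ℝ) ^ 3 + 1 ≤ 3 * N ^ 3 := by
        linarith [one_le_pow₀ hN0 (n := 3)]
      calc _ ≤ (C4 + 1) * N ^ 2 * (3 * N ^ 3) := by gcongr
        _ = 3 * (C4 + 1) * N ^ 5 := by ring
        _ ≤ N * N ^ 5 := by gcongr
        _ = _ := by ring
    rw [hl_def]
    exact_mod_cast this
  by_contra hcon
  push Not at hcon
  have hblock : ∀ i ∈ Finset.range (Z.card + 1), ∃ k : ℤ, A + i * l ≤ k ∧ k < A + (i + 1) * l ∧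
      ∃ w ∈ Z, distInt (θ + k * ω - w) < Real.exp (-r.den) := by
    intro i hi
    have hi' : ((i : ℤ) + 1) * l ≤ (N : ℤ) ^ 6 := by
      refine le_trans ?_ hblocks
      gcongr
      have := Finset.mem_range.1 hi
      push_cast; omega
    have hil : 0 ≤ (i : ℤ) * l := by positivity
    obtain ⟨n, hn, hng⟩ := hcon (A + i * l + (N : ℤ) ^ 3) (by omega) (by
      have : (i + 1 : ℤ) * l = i * l + 2 * (N : ℤ) ^ 3 + 1 := by rw [hl_def]; ring
      omega)
    obtain ⟨hn1, hn2⟩ := abs_le.1 hn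
    refine ⟨n, by omega, ?_, hbad n hng⟩
    have : (i + 1 : ℤ) * l = i * l + 2 * (N : ℤ) ^ 3 + 1 := by rw [hl_def]; ring
    omega
  choose! k hk1 hk2 w hwZ hw using hblock
  obtain ⟨i, hi, i', hi', hne, heq⟩ := Finset.exists_ne_map_eq_of_card_lt_of_maps_to
    (s := Finset.range (Z.card + 1)) (t := Z) (by simp) hwZ
  have hkey : ∀ i ∈ Finset.range (Z.card + 1), ∀ i' ∈ Finset.range (Z.card + 1), i < i' →
      w i = w i' → False := by
    intro i hi i' hi' hlt heq
    have h4 : (i + 1 : ℤ) * l ≤ i' * l := by gcongr; omega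
    have h5 := hk2 i hi
    have h6 := hk1 i' hi'
    have h7 := hk1 i hi
    have h8 := hk2 i' hi'
    have h9 : (i' + 1 : ℤ) * l ≤ (N : ℤ) ^ 6 := by
      refine le_trans ?_ hblocks
      gcongr
      have := Finset.mem_range.1 hi'
      push_cast; omega
    have h10 : 0 ≤ (i : ℤ) * l := by positivity
    refine hsep (k i') (k i) (by omega) ?_ (w i') (hw i' hi') (heq ▸ hw i hi)
    rw [abs_of_nonneg (by omega)]
    omega
  rcases lt_or_gt_of_ne hne with h | h
  · exact hkey i hi i' hi' h heq
  · exact hkey i' hi' i hi h heq.symm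

end StripPotential

namespace StripPotential

variable {S : Type} [Fintype S] [MetricSpace S] [DecidableEq S] (P : StripPotential S)

/-- A polynomially bounded solution of the eigenvalue equation. -/
structure IsGenEigenfunction (lam θ ω E X : ℝ) (ψ : ℤ → S → ℂ) : Prop where
  eq_zero : ∀ n s, ψ (n + 1) s + ψ (n - 1) s + (∑ s', if dist s s' = 1 then ψ n s' else 0)
      + (((lam * P.f s (θ + n * ω) : ℝ) : ℂ) - E) * ψ n s = 0
  norm_le : ∀ n, ‖ψ n‖ ≤ X * (1 + |(n : ℝ)|)

/-- The largeness condition on the coupling that makes the good windows contract. -/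
def IsLargeCoupling (lam C4 : ℝ) : Prop :=
  (16 * Fintype.card S + 1) * (Real.exp 1 * (P.C2 ^ Fintype.card S * C4)) ^ 8 ≤ lam ^ 2

variable {P}

theorem stripMat_eq_windowMat_sub (N : ℕ) (lam θ ω E : ℝ) (k : ℤ) :
    stripMat N (fun i s => ((lam * P.f s (θ + ((k + i : ℤ) : ℝ) * ω) : ℝ) : ℂ) - E)
      = windowMat N P.f lam θ k ω - (E : ℂ) • (1 : Matrix (Fin N × S) (Fin N × S) ℂ) := by
  rw [windowMat, stripMat_sub_smul_one]
  push_cast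
  rfl

theorem IsGenEigenfunction.exists_decay {lam C4 θ ω E X : ℝ} {ψ : ℤ → S → ℂ}
    (h : P.IsGenEigenfunction lam θ ω E X ψ) (hl : 1 ≤ lam) (hC4 : 1 ≤ C4)
    (hlam : P.IsLargeCoupling lam C4) (hE : |E| ≤ lam * P.C1) {ν : ℕ} (hν : 1 ≤ ν) {n : ℤ}
    (hgood : P.GoodAt lam C4 θ ω E ν (n - 4 * ν)) :
    ∃ n1 n2 : ℤ, |n1 - n| ≤ (8 * ν : ℕ) ∧ |n2 - n| ≤ (8 * ν : ℕ) ∧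
      ‖ψ n‖ ≤ Real.exp (-(8 * ν : ℕ)) * max ‖ψ n1‖ ‖ψ n2‖ := by
  have := exists_decay_of_good_window hν
    (fun n s => ((lam * P.f s (θ + n * ω) : ℝ) : ℂ) - E) ψ hl (C2 := P.C2) (C4 := C4)
    (by linarith [P.one_le_C2]) hC4 (fun n s => by
      have := P.norm_potential_le hl hE s (z := ((θ + n * ω : ℝ) : ℂ)) (by simpa using P.ρ_pos)
      rw [P.F_ofReal] at this
      push_cast at this ⊢
      exact this) hlam h.eq_zero n (by
      obtain ⟨a, ha, hd⟩ := hgood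
      refine ⟨a, ha, ?_⟩
      rw [← stripMat_eq_windowMat_sub] at hd
      exact_mod_cast hd)
  exact_mod_cast this

theorem IsGenEigenfunction.norm_le_exp {lam C4 θ ω E X Y : ℝ} {ψ : ℤ → S → ℂ}
    (h : P.IsGenEigenfunction lam θ ω E X ψ) (hl : 1 ≤ lam) (hC4 : 1 ≤ C4)
    (hlam : P.IsLargeCoupling lam C4) (hE : |E| ≤ lam * P.C1) {ν : ℕ} (hν : 1 ≤ ν) {c r : ℤ}
    (hgood : ∀ n, |n - c| ≤ r → P.GoodAt lam C4 θ ω E ν (n - 4 * ν))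
    (hY : ∀ n, |n - c| ≤ r + (8 * ν : ℕ) → ‖ψ n‖ ≤ Y) {j : ℕ}
    (hj : (j * (8 * ν : ℕ) : ℤ) ≤ r + (8 * ν : ℕ)) :
    ‖ψ c‖ ≤ Real.exp (-((j * (8 * ν) : ℕ) : ℝ)) * Y := by
  have := le_exp_mul_of_iterate_decay (m := fun n => ‖ψ n‖) (N := 8 * ν) (c := c) (r := r) (X := Y)
    (fun n hn => h.exists_decay hl hC4 hlam hE hν (hgood n hn)) hY j c (by simpa using hj)
  rw [← Real.exp_nat_mul] at this
  convert this using 3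
  push_cast
  ring

end StripPotential

namespace StripPotential

variable {S : Type} [Fintype S] [MetricSpace S] [DecidableEq S] {P : StripPotential S}

theorem IsGenEigenfunction.exists_windowMat_eigenvalue_near {lam θ ω E X : ℝ} {ψ : ℤ → S → ℂ}
    (h : P.IsGenEigenfunction lam θ ω E X ψ) {c1 n0 : ℤ} {L : ℕ} {s0 : S} {β δ η : ℝ}
    (h1 : ‖ψ c1‖ ≤ β) (h2 : ‖ψ (c1 + 1 + L)‖ ≤ β) (hn1 : c1 < n0) (hn2 : n0 < c1 + 1 + L)
    (hη : 0 < η) (hηψ : η ≤ ‖ψ n0 s0‖) (hδ : 0 ≤ δ)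
    (hβ : (L * Fintype.card S : ℕ) * (2 * β) ≤ δ * η) :
    ∃ i, |(windowMat_isHermitian L P.f lam θ (c1 + 1) ω).eigenvalues i - E| ≤ δ := by
  set v : Fin L × S → ℂ := fun q => ψ (c1 + 1 + (q.1 : ℕ)) q.2 with hv
  obtain ⟨k, hk⟩ : ∃ k : Fin L, n0 = c1 + 1 + (k : ℕ) :=
    ⟨⟨(n0 - c1 - 1).toNat, by omega⟩, by simp only []; omega⟩
  have hvk : η ≤ ‖v (k, s0)‖ := by simpa [hv, ← hk] using hηψ
  have hβ0 : 0 ≤ β := (norm_nonneg _).trans h1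
  refine Matrix.IsHermitian.exists_eigenvalue_near (v := v) _ ?_ ?_ hδ
  · intro h0
    rw [h0] at hvk
    simp at hvk
    linarith
  · have hres : ∀ p, ‖(windowMat L P.f lam θ (c1 + 1) ω).mulVec v p - E * v p‖ ≤ 2 * β := by
      intro p
      have e1 : (windowMat L P.f lam θ (c1 + 1) ω).mulVec v p - E * v p
          = ((windowMat L P.f lam θ (c1 + 1) ω
            - (E : ℂ) • (1 : Matrix (Fin L × S) (Fin L × S) ℂ)).mulVec v) p := by
        simp [Matrix.sub_mulVec, Matrix.smul_mulVec]
      rw [e1, ← stripMat_eq_windowMat_sub]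
      have := stripMat_mulVec_of_eq L (fun n s => ((lam * P.f s (θ + n * ω) : ℝ) : ℂ) - E) ψ (c1 + 1)
        h.eq_zero p
      rw [this, norm_neg]
      refine (norm_add_le _ _).trans ?_
      have a1 : ‖if (p.1 : ℕ) = 0 then ψ (c1 + 1 - 1) p.2 else 0‖ ≤ β := by
        split_ifs
        · rw [add_sub_cancel_right]
          exact (norm_le_pi_norm _ _).trans h1
        · simpa using hβ0
      have a2 : ‖if (p.1 : ℕ) + 1 = L then ψ (c1 + 1 + L) p.2 else 0‖ ≤ β := by
        split_ifs
        · exact (norm_le_pi_norm _ _).trans h2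
        · simpa using hβ0
      linarith
    calc _ ≤ ∑ _p : Fin L × S, (2 * β) ^ 2 :=
          Finset.sum_le_sum fun p _ => pow_le_pow_left₀ (norm_nonneg _) (hres p) 2
      _ = (L * Fintype.card S : ℕ) * (2 * β) ^ 2 := by simp
      _ ≤ ((L * Fintype.card S : ℕ) * (2 * β)) ^ 2 := by
          rw [mul_pow _ (2 * β)]
          refine mul_le_mul_of_nonneg_right ?_ (by positivity)
          exact_mod_cast Nat.le_self_pow (by norm_num) _
      _ ≤ (δ * η) ^ 2 := by gcongr
      _ = δ ^ 2 * η ^ 2 := mul_pow _ _ _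
      _ ≤ _ := by
          gcongr
          refine (pow_le_pow_left₀ hη.le hvk 2).trans ?_
          exact Finset.single_le_sum (f := fun p => ‖v p‖ ^ 2) (fun p _ => by positivity)
            (Finset.mem_univ (k, s0))

theorem exists_windowMat_eigenvalue_sub_le {g : S → ℝ → ℝ} {lam θ ω E : ℝ} {L : ℕ} {k : ℤ}
    (hl : 0 ≤ lam) {δ δ' : ℝ} (hδ' : 0 ≤ δ') (hg : ∀ s x, lam * |P.f s x - g s x| ≤ δ')
    (h : ∃ i, |(windowMat_isHermitian L P.f lam θ k ω).eigenvalues i - E| ≤ δ) :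
    ∃ i, |(windowMat_isHermitian L g lam θ k ω).eigenvalues i - E|
      ≤ δ + (L * Fintype.card S : ℕ) * δ' := by
  obtain ⟨i, hi⟩ := h
  have hentry : ∀ p q, ‖windowMat L P.f lam θ k ω p q - windowMat L g lam θ k ω p q‖ ≤ δ' := by
    intro p q
    rcases eq_or_ne p q with rfl | hpq
    · rw [windowMat, windowMat, stripMat_self, stripMat_self, ← Complex.ofReal_sub, Complex.norm_real,
        ← mul_sub, Real.norm_eq_abs, abs_mul, abs_of_nonneg hl]
      exact hg _ _
    · rw [windowMat, windowMat, stripMat_of_ne _ hpq, stripMat_of_ne _ hpq, sub_self, norm_zero]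
      exact hδ'
  obtain ⟨j, hj⟩ := (windowMat_isHermitian L P.f lam θ k ω).exists_eigenvalue_sub_le
    (windowMat_isHermitian L g lam θ k ω) hδ' hentry i
  rw [Fintype.card_prod, Fintype.card_fin] at hj
  exact ⟨j, (abs_sub_le _ _ _).trans (by linarith)⟩

end StripPotential

namespace StripPotential

variable {S : Type} [Fintype S] [MetricSpace S] [DecidableEq S] {P : StripPotential S}

theorem IsGenEigenfunction.exists_small {lam C4 θ ω E X : ℝ} {ψ : ℤ → S → ℂ}
    (h : P.IsGenEigenfunction lam θ ω E X ψ) (hl : 1 ≤ lam) (hC4 : 1 ≤ C4)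
    (hlam : P.IsLargeCoupling lam C4) (hE : |E| ≤ lam * P.C1) (hX : 0 ≤ X) {ν N : ℕ} (hN : N = 8 * ν)
    (hν : 1 ≤ ν) {A : ℤ} (hA1 : -(N : ℤ) ^ 6 ≤ A) (hA2 : A ≤ 0)
    (hrun : ∃ c : ℤ, A + (N : ℤ) ^ 3 ≤ c ∧ c + (N : ℤ) ^ 3 ≤ A + (N : ℤ) ^ 6 ∧
      ∀ n, |n - c| ≤ (N : ℤ) ^ 3 → P.GoodAt lam C4 θ ω E ν n) :
    ∃ c : ℤ, A + (N : ℤ) ^ 3 ≤ c ∧ c + (N : ℤ) ^ 3 ≤ A + (N : ℤ) ^ 6 + N ∧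
      ‖ψ c‖ ≤ Real.exp (-(N : ℝ) ^ 3) * (X * (4 * (N : ℝ) ^ 6)) := by
  obtain ⟨c, hc1, hc2, hg⟩ := hrun
  have hN1 : 8 ≤ N := by omega
  have hN3 : (N : ℤ) ≤ (N : ℤ) ^ 3 := by exact_mod_cast Nat.le_self_pow (by norm_num) N
  have hN6 : (N : ℤ) ^ 3 ≤ (N : ℤ) ^ 6 := by
    exact_mod_cast Nat.pow_le_pow_right (by omega) (by norm_num)
  refine ⟨c + 4 * ν, by omega, by omega, ?_⟩
  have hY : ∀ n : ℤ, |n - (c + 4 * ν)| ≤ (N : ℤ) ^ 3 + (8 * ν : ℕ) →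
      ‖ψ n‖ ≤ X * (4 * (N : ℝ) ^ 6) := by
    intro n hn
    refine (h.norm_le n).trans (mul_le_mul_of_nonneg_left ?_ hX)
    have : 1 + |n| ≤ 4 * (N : ℤ) ^ 6 := by
      rw [abs_le] at hn
      have : |n| ≤ 4 * (N : ℤ) ^ 6 - 1 := abs_le.2 ⟨by omega, by omega⟩
      omega
    exact_mod_cast this
  have := h.norm_le_exp hl hC4 hlam hE hν (c := c + 4 * ν) (r := (N : ℤ) ^ 3)
    (fun n hn => hg _ (by rwa [show n - 4 * ν - c = n - (c + 4 * ν) by ring])) hY (j := N ^ 2) (by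
      rw [← hN]
      push_cast
      nlinarith)
  convert this using 3
  rw [← hN]
  push_cast
  ring

/-- The energy of a polynomially bounded solution is very close to an eigenvalue of a window around
the origin. -/
theorem IsGenEigenfunction.exists_window_eigenvalue_close {lam C4 θ ω E X : ℝ} {ψ : ℤ → S → ℂ}
    (h : P.IsGenEigenfunction lam θ ω E X ψ) (hl : 1 ≤ lam) (hC4 : 1 ≤ C4)
    (hlam : P.IsLargeCoupling lam C4) (hE : |E| ≤ lam * P.C1) (hX : 0 ≤ X) {ν N : ℕ} (hN : N = 8 * ν)
    (hν : 1 ≤ ν)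
    (hrun : ∀ A : ℤ, ∃ c : ℤ, A + (N : ℤ) ^ 3 ≤ c ∧ c + (N : ℤ) ^ 3 ≤ A + (N : ℤ) ^ 6 ∧
      ∀ n, |n - c| ≤ (N : ℤ) ^ 3 → P.GoodAt lam C4 θ ω E ν n)
    {g : S → ℝ → ℝ} (hg : ∀ s x, lam * |P.f s x - g s x| ≤ Real.exp (-(2 * (N : ℝ) ^ 2)))
    {n0 : ℤ} {s0 : S} {η : ℝ} (hη : 0 < η) (hηψ : η ≤ ‖ψ n0 s0‖) (hn0 : |n0| + N < (N : ℤ) ^ 3)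
    (hs1 : 3 * (N : ℝ) ^ 6 * Fintype.card S
      * (2 * (Real.exp (-(N : ℝ) ^ 3) * (X * (4 * (N : ℝ) ^ 6)))) ≤ Real.exp (-(N : ℝ) ^ 2) / 2 * η)
    (hs2 : 3 * (N : ℝ) ^ 6 * Fintype.card S * Real.exp (-(2 * (N : ℝ) ^ 2))
      ≤ Real.exp (-(N : ℝ) ^ 2) / 2) :
    ∃ m ≤ N ^ 6, ∃ L ≤ 2 * N ^ 6 + 1, ∃ i,
      |(windowMat_isHermitian L g lam θ (-(m : ℕ)) ω).eigenvalues i - E|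
        ≤ Real.exp (-(N : ℝ) ^ 2) := by
  have hN1 : 8 ≤ N := by omega
  have hN36 : (N : ℤ) ^ 3 ≤ (N : ℤ) ^ 6 := by
    exact_mod_cast Nat.pow_le_pow_right (by omega) (by norm_num)
  obtain ⟨c1, h11, h12, h13⟩ := h.exists_small hl hC4 hlam hE hX hN hν (A := -(N : ℤ) ^ 6) le_rfl
    (by simp) (hrun _)
  obtain ⟨c2, h21, h22, h23⟩ := h.exists_small hl hC4 hlam hE hX hN hν (A := 0)
    (by simp) le_rfl (hrun _)
  have hn0' := abs_nonneg n0
  have hn01 := le_abs_self n0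
  have hn02 := neg_abs_le n0
  obtain ⟨m, hm⟩ : ∃ m : ℕ, c1 + 1 = -(m : ℤ) := ⟨(-(c1 + 1)).toNat, by omega⟩
  obtain ⟨L, hL⟩ : ∃ L : ℕ, c2 = c1 + 1 + (L : ℤ) := ⟨(c2 - (c1 + 1)).toNat, by omega⟩
  have hm6 : (m : ℤ) ≤ (N : ℤ) ^ 6 := by omega
  have hL6 : (L : ℤ) ≤ 2 * (N : ℤ) ^ 6 + 1 := by omega
  refine ⟨m, by exact_mod_cast hm6, L, by exact_mod_cast hL6, ?_⟩
  have hLr : ((L * Fintype.card S : ℕ) : ℝ) ≤ 3 * (N : ℝ) ^ 6 * Fintype.card S := by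
    push_cast
    gcongr
    have : (L : ℤ) ≤ 3 * (N : ℤ) ^ 6 := by omega
    exact_mod_cast this
  have key := h.exists_windowMat_eigenvalue_near h13 (hL ▸ h23) (n0 := n0) (by omega) (by omega) hη hηψ
    (δ := Real.exp (-(N : ℝ) ^ 2) / 2) (by positivity)
    ((mul_le_mul_of_nonneg_right hLr (by positivity)).trans hs1)
  obtain ⟨i, hi⟩ := exists_windowMat_eigenvalue_sub_le (by linarith) (Real.exp_pos _).le hg key
  rw [hm] at *
  refine ⟨i, hi.trans ?_⟩
  have := mul_le_mul_of_nonneg_right hLr (Real.exp_pos (-(2 * (N : ℝ) ^ 2))).le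
  linarith

/-- A non-resonant shell consists of good sites. -/
theorem goodAt_of_mem_dyadicShell {lam C4 θ ω E : ℝ} (hl : 1 ≤ lam) (hE : |E| ≤ lam * P.C1)
    {ν N : ℕ} (hN : N = 8 * ν) {g : S → ℝ → ℝ}
    (hg : ∀ s x, lam * |P.f s x - g s x| ≤ Real.exp (-(2 * (N : ℝ) ^ 2)))
    (hC4 : 1 ≤ C4)
    (hstab : P.StableAt lam C4 N) (hnr : NonresonantAt g lam C4 θ ω N (2 * ν))
    (hclose : ∃ m ≤ N ^ 6, ∃ L ≤ 2 * N ^ 6 + 1, ∃ i,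
      |(windowMat_isHermitian L g lam θ (-(m : ℕ)) ω).eigenvalues i - E| ≤ Real.exp (-(N : ℝ) ^ 2))
    {k : ℤ} (hk : k ∈ dyadicShell (N ^ 31)) : P.GoodAt lam C4 θ ω E ν k := by
  obtain ⟨m, hm, L, hL, i, hi⟩ := hclose
  have h1 := hnr m hm L hL k hk
  set e := (windowMat_isHermitian L g lam θ (-(m : ℕ)) ω).eigenvalues i with he
  have hg1 : ∀ s x, lam * |P.f s x - g s x| ≤ 1 := fun s x =>
    (hg s x).trans (Real.exp_le_one_iff.2 (by nlinarith [sq_nonneg (N : ℝ)]))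
  simp only [SmallDetAt, HasCommonSmallDet, not_exists, not_forall] at h1
  obtain ⟨a, ha, hdet⟩ := h1 i
  rw [not_le, windowMat_add_mul] at hdet
  have h2 := P.norm_det_windowMat_sub_le hl (g := P.f) (g' := g) (δ := 2 * Real.exp (-(N : ℝ) ^ 2))
    (by simp) hg1 hE (P.abs_eigenvalues_windowMat_le hl hg1 L θ (-(m : ℕ)) ω i) (fun s x => by
      rw [← he, abs_sub_comm E e]
      have h3 : Real.exp (-(2 * (N : ℝ) ^ 2)) ≤ Real.exp (-(N : ℝ) ^ 2) :=
        Real.exp_le_exp.2 (by nlinarith [sq_nonneg (N : ℝ)])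
      linarith [hg s x]) N θ (k + a) ω
  refine ⟨a, ha, ?_⟩
  have h3 := h2.trans hstab
  rw [← hN]
  have h4 := norm_sub_norm_le
    (windowMat N g lam θ (k + a) ω - (e : ℂ) • (1 : Matrix (Fin N × S) (Fin N × S) ℂ)).det
    (windowMat N P.f lam θ (k + a) ω - (E : ℂ) • (1 : Matrix (Fin N × S) (Fin N × S) ℂ)).det
  rw [norm_sub_rev] at h4
  subst hN
  linarith

end StripPotential

theorem eventually_mul_pow_mul_exp_neg_le (C : ℝ) (k : ℕ) {ε : ℝ} (hε : 0 < ε) :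
    ∀ᶠ ν : ℕ in atTop, C * ((8 * ν : ℕ) : ℝ) ^ k * Real.exp (-((8 * ν : ℕ) : ℝ)) ≤ ε := by
  have h8 : Tendsto (fun ν : ℕ => 8 * ν) atTop atTop :=
    tendsto_id.const_mul_atTop' (by norm_num)
  have h1 := ((Real.tendsto_pow_mul_exp_neg_atTop_nhds_zero k).comp
    ((tendsto_natCast_atTop_atTop (R := ℝ)).comp h8)).const_mul C
  rw [mul_zero] at h1
  filter_upwards [h1.eventually_lt_const hε] with ν hν
  simp only [Function.comp_apply] at hν
  rw [mul_assoc]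
  exact hν.le

theorem succ_pow_le_two_mul_pow {ν : ℕ} (hν : 62 ≤ ν) :
    (8 * (ν + 1)) ^ 31 ≤ 2 * (8 * ν) ^ 31 := by
  have h0 : (62 : ℝ) ≤ ν := by exact_mod_cast hν
  have h1 : ((8 * (ν + 1) : ℕ) : ℝ) = (1 / ν + 1) * (8 * ν : ℕ) := by
    push_cast; field_simp; ring
  have h2 : (1 / (ν : ℝ) + 1) ^ 31 ≤ 2 := by
    calc _ ≤ Real.exp (1 / ν) ^ 31 := by
          gcongr
          exact Real.add_one_le_exp _
      _ = Real.exp (31 / ν) := by rw [← Real.exp_nat_mul]; congr 1; push_cast; ring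
      _ ≤ Real.exp (Real.log 2) := by
          refine Real.exp_le_exp.2 ?_
          have : 31 / (ν : ℝ) ≤ 1 / 2 := by
            rw [div_le_div_iff₀ (by linarith) (by norm_num)]; linarith
          linarith [Real.log_two_gt_d9]
      _ = 2 := Real.exp_log (by norm_num)
  have h3 : ((8 * (ν + 1) : ℕ) : ℝ) ^ 31 ≤ 2 * ((8 * ν : ℕ) : ℝ) ^ 31 := by
    rw [h1, mul_pow]
    gcongr
  exact_mod_cast h3

theorem exists_shell_index {ν1 n : ℕ} (h1 : 62 ≤ ν1) (hn : 2 * (8 * ν1) ^ 31 ≤ n) :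
    ∃ ν, ν1 ≤ ν ∧ 2 * (8 * ν) ^ 31 ≤ n ∧ n ≤ 4 * (8 * ν) ^ 31 := by
  have hle : ∀ ν, ν ≤ 2 * (8 * ν) ^ 31 := fun ν => by
    have := Nat.le_self_pow (n := 31) (by norm_num) (8 * ν)
    omega
  set ν := Nat.findGreatest (fun ν => 2 * (8 * ν) ^ 31 ≤ n) n
  have h2 : ν1 ≤ ν := Nat.le_findGreatest ((hle ν1).trans hn) hn
  refine ⟨ν, h2, Nat.findGreatest_spec (P := fun ν => 2 * (8 * ν) ^ 31 ≤ n) ((hle ν1).trans hn) hn, ?_⟩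
  by_contra hc
  have h3 := succ_pow_le_two_mul_pow (h1.trans h2)
  have h4 : ν + 1 ≤ ν := Nat.le_findGreatest (P := fun ν => 2 * (8 * ν) ^ 31 ≤ n)
    ((hle (ν + 1)).trans (by omega)) (by omega)
  omega

namespace StripPotential

variable {S : Type} [Fintype S] [MetricSpace S] [DecidableEq S] {P : StripPotential S}

theorem IsGenEigenfunction.norm_le_of_good_shell {lam C4 θ ω E X : ℝ} {ψ : ℤ → S → ℂ}
    (h : P.IsGenEigenfunction lam θ ω E X ψ) (hl : 1 ≤ lam) (hC4 : 1 ≤ C4)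
    (hlam : P.IsLargeCoupling lam C4) (hE : |E| ≤ lam * P.C1) (hX : 0 ≤ X) {ν : ℕ}
    (hν : 1 ≤ ν)
    (hgood : ∀ k ∈ dyadicShell ((8 * ν) ^ 31), P.GoodAt lam C4 θ ω E ν k) {n : ℤ}
    (hn1 : 2 * (8 * ν) ^ 31 ≤ n.natAbs) (hn2 : n.natAbs ≤ 4 * (8 * ν) ^ 31) :
    ‖ψ n‖ ≤ 24 * X * Real.exp (-(1 / 16) * |(n : ℝ)|) := by
  set K := (8 * ν) ^ 31 with hK
  have hj : 2 * (4 * ν * (8 * ν) ^ 29 * (8 * ν)) = K := by rw [hK]; ring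
  set j := 4 * ν * (8 * ν) ^ 29 with hj_def
  have h8K : 8 * ν ≤ j * (8 * ν) := Nat.le_mul_of_pos_left _ (by positivity)
  have hY : ∀ n' : ℤ, |n' - n| ≤ ((j * (8 * ν) : ℕ) - (8 * ν : ℕ) : ℤ) + (8 * ν : ℕ) →
      ‖ψ n'‖ ≤ X * (6 * (K : ℝ)) := by
    intro n' hn'
    refine (h.norm_le n').trans (mul_le_mul_of_nonneg_left ?_ hX)
    have : 1 + |n'| ≤ 6 * (K : ℤ) := by
      rw [abs_le] at hn'
      have : |n'| ≤ 6 * (K : ℤ) - 1 := abs_le.2 ⟨by omega, by omega⟩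
      omega
    exact_mod_cast this
  have key := h.norm_le_exp hl hC4 hlam hE hν (c := n) (r := (j * (8 * ν) : ℕ) - (8 * ν : ℕ))
    (fun n' hn' => hgood _ (mem_dyadicShell.2 (by rw [abs_le] at hn'; omega))) hY (j := j) (by
      push_cast; linarith)
  have hnr : |(n : ℝ)| ≤ 4 * (K : ℝ) := by
    have : |n| ≤ 4 * (K : ℤ) := by rw [Int.abs_eq_natAbs]; exact_mod_cast hn2
    exact_mod_cast this
  have hjr : ((j * (8 * ν) : ℕ) : ℝ) = K / 2 := by rw [← hj]; push_cast; ring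
  have hK0 : (0 : ℝ) ≤ K := Nat.cast_nonneg _
  refine key.trans ?_
  rw [hjr]
  have e1 : (K : ℝ) ≤ 4 * Real.exp (K / 4) := by linarith [Real.add_one_le_exp ((K : ℝ) / 4)]
  calc _ ≤ Real.exp (-(K / 2)) * (X * (6 * (4 * Real.exp (K / 4)))) := by gcongr
    _ = 24 * X * Real.exp (-(K / 2) + K / 4) := by rw [Real.exp_add]; ring
    _ ≤ _ := by
      gcongr
      linarith

/-- Polynomially bounded solutions decay exponentially for non-resonant frequencies. -/
theorem IsGenEigenfunction.exists_norm_le_exp {lam C4 θ ω E X : ℝ} {ψ : ℤ → S → ℂ}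
    (h : P.IsGenEigenfunction lam θ ω E X ψ) (hl : 1 ≤ lam) (hC4 : 1 ≤ C4)
    (hlam : P.IsLargeCoupling lam C4) (hcen : P.HasCenters lam C4) (hE : |E| ≤ lam * P.C1)
    {g : ℕ → S → ℝ → ℝ} (hg : P.IsApprox g lam) {j : ℕ} (hω : Diophantine j ω)
    (hnr : ∀ᶠ ν : ℕ in atTop, NonresonantAt (g (8 * ν)) lam C4 θ ω (8 * ν) (2 * ν)) :
    ∃ C : ℝ, 0 < C ∧ ∀ n, ‖ψ n‖ ≤ C * Real.exp (-(1 / 16) * |(n : ℝ)|) := by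
  have hX : 0 ≤ X := by simpa using (norm_nonneg _).trans (h.norm_le 0)
  by_cases h0 : ψ = 0
  · exact ⟨1, one_pos, fun n => by rw [h0, Pi.zero_apply, norm_zero]; positivity⟩
  obtain ⟨n0, s0, hψ0⟩ : ∃ n0 s0, ψ n0 s0 ≠ 0 := by
    by_contra hc
    push Not at hc
    exact h0 (by ext n s; exact hc n s)
  have hη : 0 < ‖ψ n0 s0‖ := norm_pos_iff.2 hψ0
  have h8 : Tendsto (fun ν : ℕ => 8 * ν) atTop atTop :=
    tendsto_id.const_mul_atTop' (by norm_num)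
  have hev : ∀ᶠ ν : ℕ in atTop,
      ∀ k ∈ dyadicShell ((8 * ν) ^ 31), P.GoodAt lam C4 θ ω E ν k := by
    filter_upwards [h8.eventually hg, hnr, h8.eventually (P.eventually_stableAt hl hC4),
      P.eventually_exists_good_run hl hC4 hcen θ hω, eventually_ge_atTop (1 + n0.natAbs),
      eventually_mul_pow_mul_exp_neg_le (48 * Fintype.card S * X) 12 hη,
      eventually_mul_pow_mul_exp_neg_le (6 * Fintype.card S) 6 one_pos]
      with ν hν1 hν2 hν3 hν4 hν5 hν6 hν7 k hk
    set N := 8 * ν with hN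
    have hN8 : 8 ≤ N := by omega
    have hN8' : (8 : ℝ) ≤ N := by exact_mod_cast hN8
    refine goodAt_of_mem_dyadicShell hl hE hN hν1 hC4 hν3 hν2 ?_ hk
    refine h.exists_window_eigenvalue_close hl hC4 hlam hE hX hN (by omega) (hν4 E hE) hν1
      hη le_rfl ?_ ?_ ?_
    · have h1 : |n0| < N := by rw [Int.abs_eq_natAbs]; omega
      have h2 : 2 * (N : ℤ) ≤ (N : ℤ) ^ 3 := by
        have : (8 : ℤ) ≤ N := by exact_mod_cast hN8
        nlinarith [sq_nonneg (N : ℤ)]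
      omega
    · have h1 : Real.exp (-(N : ℝ) ^ 3) ≤ Real.exp (-(N : ℝ) ^ 2) * Real.exp (-N) := by
        rw [← Real.exp_add]
        refine Real.exp_le_exp.2 ?_
        nlinarith [sq_nonneg (N : ℝ)]
      calc _ ≤ 3 * (N : ℝ) ^ 6 * Fintype.card S * (2 * (Real.exp (-(N : ℝ) ^ 2) * Real.exp (-N)
            * (X * (4 * (N : ℝ) ^ 6)))) := by gcongr
        _ = Real.exp (-(N : ℝ) ^ 2) / 2 * (48 * Fintype.card S * X * (N : ℝ) ^ 12 * Real.exp (-N)) := by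
            ring
        _ ≤ _ := by gcongr
    · have h1 : Real.exp (-(2 * (N : ℝ) ^ 2)) ≤ Real.exp (-(N : ℝ) ^ 2) * Real.exp (-N) := by
        rw [← Real.exp_add]
        refine Real.exp_le_exp.2 ?_
        nlinarith [sq_nonneg (N : ℝ)]
      calc _ ≤ 3 * (N : ℝ) ^ 6 * Fintype.card S * (Real.exp (-(N : ℝ) ^ 2) * Real.exp (-N)) := by gcongr
        _ = Real.exp (-(N : ℝ) ^ 2) / 2 * (6 * Fintype.card S * (N : ℝ) ^ 6 * Real.exp (-N)) := by
            ring
        _ ≤ Real.exp (-(N : ℝ) ^ 2) / 2 * 1 := by gcongr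
        _ = _ := mul_one _
  obtain ⟨ν0, hν0⟩ := eventually_atTop.1 hev
  set ν1 := max ν0 62
  set R : ℝ := ((2 * (8 * ν1) ^ 31 : ℕ) : ℝ) with hR
  have hR0 : 0 ≤ R := Nat.cast_nonneg _
  refine ⟨24 * X + X * (1 + R) * Real.exp (1 / 16 * R) + 1, by positivity, fun n => ?_⟩
  rcases le_total (2 * (8 * ν1) ^ 31) n.natAbs with hn | hn
  · obtain ⟨ν, h1, h2, h3⟩ := exists_shell_index (le_max_right _ _) hn
    have h62 : 62 ≤ ν := (le_max_right _ _).trans h1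
    refine (h.norm_le_of_good_shell hl hC4 hlam hE hX (by omega)
      (hν0 ν ((le_max_left _ _).trans h1)) h2 h3).trans ?_
    gcongr
    have : 0 ≤ X * (1 + R) * Real.exp (1 / 16 * R) := by positivity
    linarith
  · have hnR : |(n : ℝ)| ≤ R := by
      have : |n| ≤ ((2 * (8 * ν1) ^ 31 : ℕ) : ℤ) := by
        rw [Int.abs_eq_natAbs]; exact_mod_cast hn
      rw [hR]
      exact_mod_cast this
    have e1 : 1 ≤ Real.exp (1 / 16 * R) * Real.exp (-(1 / 16) * |(n : ℝ)|) := by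
      rw [← Real.exp_add]
      exact Real.one_le_exp (by linarith)
    calc ‖ψ n‖ ≤ X * (1 + |(n : ℝ)|) := h.norm_le n
      _ ≤ X * (1 + R) * 1 := by rw [mul_one]; gcongr
      _ ≤ X * (1 + R) * (Real.exp (1 / 16 * R) * Real.exp (-(1 / 16) * |(n : ℝ)|)) := by gcongr
      _ = X * (1 + R) * Real.exp (1 / 16 * R) * Real.exp (-(1 / 16) * |(n : ℝ)|) := by ring
      _ ≤ _ := by gcongr; linarith

end StripPotential

section Spectral

open scoped CompactlySupported

variable {H : Type*} [NormedAddCommGroup H] [InnerProductSpace ℂ H] [CompleteSpace H]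

/-- The functional calculus applied to a vector, as a real-linear map. -/
def cfcVec {A : H →L[ℂ] H} (hA : IsSelfAdjoint A) (v : H) : C(spectrum ℝ A, ℝ) →ₗ[ℝ] H where
  toFun g := cfcHom hA g v
  map_add' g g' := by simp
  map_smul' c g := by simp

theorem inner_cfcVec {A : H →L[ℂ] H} (hA : IsSelfAdjoint A) (v : H) (g g' : C(spectrum ℝ A, ℝ)) :
    inner ℂ (cfcVec hA v g) (cfcVec hA v g') = inner ℂ v (cfcVec hA v (g * g')) := by
  have h1 : IsSelfAdjoint (cfcHom hA g) := by
    rw [IsSelfAdjoint, ← map_star]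
    congr 1
  change inner ℂ (cfcHom hA g v) (cfcHom hA g' v) = inner ℂ v (cfcHom hA (g * g') v)
  rw [map_mul, mul_apply_eq_comp, ← ContinuousLinearMap.adjoint_inner_left _ _ v,
    ← ContinuousLinearMap.star_eq_adjoint, h1.star_eq]

/-- The quadratic form of the functional calculus as a positive functional. -/
def cfcPositive {A : H →L[ℂ] H} (hA : IsSelfAdjoint A) (v : H) :
    C_c(spectrum ℝ A, ℝ) →ₚ[ℝ] ℝ :=
  PositiveLinearMap.mk₀
    { toFun := fun g => (inner ℂ v (cfcVec hA v (g : C(spectrum ℝ A, ℝ)))).re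
      map_add' := fun g g' => by
        rw [show ((g + g' : C_c(spectrum ℝ A, ℝ)) : C(spectrum ℝ A, ℝ))
          = (g : C(spectrum ℝ A, ℝ)) + (g' : C(spectrum ℝ A, ℝ)) from rfl, map_add, inner_add_right,
          Complex.add_re]
      map_smul' := fun c g => by
        rw [show ((c • g : C_c(spectrum ℝ A, ℝ)) : C(spectrum ℝ A, ℝ))
          = c • (g : C(spectrum ℝ A, ℝ)) from rfl, map_smul]
        simp [inner_smul_right_eq_smul] }
    (fun g hg => by
      set r : C(spectrum ℝ A, ℝ) := ⟨fun x => Real.sqrt (g x), by fun_prop⟩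
      have : (g : C(spectrum ℝ A, ℝ)) = r * r := by
        ext x
        exact (Real.mul_self_sqrt (hg x)).symm
      change 0 ≤ (inner ℂ v (cfcVec hA v (g : C(spectrum ℝ A, ℝ)))).re
      rw [this, ← inner_cfcVec]
      exact inner_self_nonneg (𝕜 := ℂ))

/-- The spectral measure of a vector. -/
def specMeasure {A : H →L[ℂ] H} (hA : IsSelfAdjoint A) (v : H) : Measure (spectrum ℝ A) :=
  RealRMK.rieszMeasure (cfcPositive hA v)

instance {A : H →L[ℂ] H} (hA : IsSelfAdjoint A) (v : H) : (specMeasure hA v).Regular := by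
  unfold specMeasure; infer_instance

instance {A : H →L[ℂ] H} (hA : IsSelfAdjoint A) (v : H) : IsFiniteMeasure (specMeasure hA v) :=
  inferInstance

theorem integral_specMeasure {A : H →L[ℂ] H} (hA : IsSelfAdjoint A) (v : H)
    (g : C(spectrum ℝ A, ℝ)) :
    ∫ x, g x ∂specMeasure hA v = (inner ℂ v (cfcVec hA v g)).re :=
  RealRMK.integral_rieszMeasure (cfcPositive hA v)
    (CompactlySupportedContinuousMap.continuousMapEquiv g)

theorem norm_cfcVec {A : H →L[ℂ] H} (hA : IsSelfAdjoint A) (v : H)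
    (g : C(spectrum ℝ A, ℝ)) :
    ‖cfcVec hA v g‖ = ‖ContinuousMap.toLp (E := ℝ) 2 (specMeasure hA v) ℝ g‖ := by
  rw [← sq_eq_sq₀ (norm_nonneg _) (norm_nonneg _),
    ← real_inner_self_eq_norm_sq (ContinuousMap.toLp (E := ℝ) 2 (specMeasure hA v) ℝ g),
    ContinuousMap.inner_toLp, ← inner_self_eq_norm_sq (𝕜 := ℂ), inner_cfcVec]
  rw [show RCLike.re (inner ℂ v (cfcVec hA v (g * g))) = (inner ℂ v (cfcVec hA v (g * g))).re from rfl,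
    ← integral_specMeasure]
  simp

/-- A self-adjoint operator restricted to a cyclic subspace is a multiplication operator. -/
theorem exists_cyclic_isometry {A : H →L[ℂ] H} (hA : IsSelfAdjoint A) (v : H) :
    ∃ W : Lp ℝ 2 (specMeasure hA v) →L[ℝ] H, (∀ h, ‖W h‖ = ‖h‖) ∧
      W (ContinuousMap.toLp (E := ℝ) 2 (specMeasure hA v) ℝ 1) = v ∧
      ∀ g : C(spectrum ℝ A, ℝ),
        W (ContinuousMap.toLp (E := ℝ) 2 (specMeasure hA v) ℝ
          (ContinuousMap.restrict (spectrum ℝ A) (ContinuousMap.id ℝ) * g))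
        = A (W (ContinuousMap.toLp (E := ℝ) 2 (specMeasure hA v) ℝ g)) := by
  set μ := specMeasure hA v
  set e : C(spectrum ℝ A, ℝ) →L[ℝ] Lp ℝ 2 μ := ContinuousMap.toLp (E := ℝ) 2 μ ℝ
  have hd : DenseRange e := ContinuousMap.toLp_denseRange ℝ μ ℝ (by norm_num)
  have hn : ∃ C, ∀ x, ‖cfcVec hA v x‖ ≤ C * ‖e.toLinearMap x‖ :=
    ⟨1, fun x => by rw [one_mul]; exact (norm_cfcVec hA v x).le⟩
  set W := (cfcVec hA v).extendOfNorm e.toLinearMap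
  have hW : ∀ g, W (e g) = cfcVec hA v g := fun g =>
    LinearMap.extendOfNorm_eq (f := cfcVec hA v) (e := e.toLinearMap) hd hn g
  refine ⟨W, fun h => ?_, ?_, fun g => ?_⟩
  · refine hd.induction_on (p := fun h => ‖W h‖ = ‖h‖) h
      (isClosed_eq (by fun_prop) (by fun_prop)) fun g => ?_
    rw [hW]
    exact norm_cfcVec hA v g
  · rw [hW]
    change cfcHom hA 1 v = v
    simp
  · rw [hW, hW]
    change cfcHom hA (_ * g) v = A (cfcHom hA g v)
    rw [map_mul, cfcHom_id hA]
    rfl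

end Spectral

section MulOperator

variable {X : Set ℝ} [CompactSpace X] (μ : Measure X) [IsFiniteMeasure μ]

theorem exists_Lp_mul_id (u : Lp ℝ 2 μ) :
    ∃ k : Lp ℝ 2 μ, (k =ᵐ[μ] fun E => E.1 * u E) ∧ ∀ g : C(X, ℝ),
      inner ℝ k (ContinuousMap.toLp (E := ℝ) 2 μ ℝ g)
        = inner ℝ u (ContinuousMap.toLp (E := ℝ) 2 μ ℝ
          (ContinuousMap.restrict X (ContinuousMap.id ℝ) * g)) := by
  set c : C(X, ℝ) := ContinuousMap.restrict X (ContinuousMap.id ℝ) with hc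
  have hm : MemLp (fun E : X => E.1 * u E) 2 μ := by
    refine MemLp.of_le_mul (c := ‖c‖) (Lp.memLp u)
      ((by fun_prop : Continuous fun E : X => E.1).aestronglyMeasurable.mul
        (Lp.stronglyMeasurable u).aestronglyMeasurable) (ae_of_all _ fun E => ?_)
    rw [norm_mul]
    exact mul_le_mul_of_nonneg_right (c.norm_coe_le_norm E) (norm_nonneg _)
  refine ⟨hm.toLp _, hm.coeFn_toLp, fun g => ?_⟩
  rw [L2.inner_def, L2.inner_def]
  refine integral_congr_ae ?_
  filter_upwards [hm.coeFn_toLp, ContinuousMap.coeFn_toLp (p := 2) (𝕜 := ℝ) μ g,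
    ContinuousMap.coeFn_toLp (p := 2) (𝕜 := ℝ) μ (c * g)] with E h1 h2 h3
  rw [h1, h2, h3]
  simp [hc]
  ring

theorem Lp_eq_of_inner_toLp {h k : Lp ℝ 2 μ}
    (hhk : ∀ g : C(X, ℝ), inner ℝ h (ContinuousMap.toLp (E := ℝ) 2 μ ℝ g)
      = inner ℝ k (ContinuousMap.toLp (E := ℝ) 2 μ ℝ g)) : h = k := by
  rw [← sub_eq_zero]
  refine (ContinuousMap.toLp_denseRange ℝ μ ℝ (p := 2) (by norm_num)).eq_zero_of_inner_left (𝕜 := ℝ)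
    fun g => ?_
  rw [inner_sub_left, hhk, sub_self]

theorem ae_exists_forall_mul_sq_le {I : Type*} [Countable I] {w : I → ℝ} (hw : ∀ x, 0 < w x)
    (hws : Summable w) {u : I → Lp ℝ 2 μ} (hu : ∀ x, ‖u x‖ ≤ 1) :
    ∀ᵐ E ∂μ, ∃ C, ∀ x, w x * u x E ^ 2 ≤ C := by
  have hint : ∀ x, ∫⁻ E, ENNReal.ofReal (w x * u x E ^ 2) ∂μ ≤ ENNReal.ofReal (w x) := by
    intro x
    have h2 : Integrable (fun E => u x E ^ 2) μ := (Lp.memLp (u x)).integrable_sq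
    rw [← ofReal_integral_eq_lintegral_ofReal (h2.const_mul _)
      (ae_of_all _ fun E => by have := hw x; positivity)]
    refine ENNReal.ofReal_le_ofReal ?_
    rw [integral_const_mul]
    have h3 : ∫ E, u x E ^ 2 ∂μ = ‖u x‖ ^ 2 := by
      rw [← real_inner_self_eq_norm_sq, L2.inner_def]
      simp [sq]
    rw [h3]
    exact mul_le_of_le_one_right (hw x).le (pow_le_one₀ (norm_nonneg _) (hu x))
  have hmeas : ∀ x, Measurable fun E => ENNReal.ofReal (w x * u x E ^ 2) := fun x =>
    (((Lp.stronglyMeasurable (u x)).measurable.pow_const 2).const_mul _).ennreal_ofReal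
  have hsum : ∫⁻ E, ∑' x, ENNReal.ofReal (w x * u x E ^ 2) ∂μ ≠ ⊤ := by
    rw [lintegral_tsum fun x => (hmeas x).aemeasurable]
    exact ne_top_of_le_ne_top hws.tsum_ofReal_ne_top (ENNReal.tsum_le_tsum hint)
  filter_upwards [ae_lt_top (Measurable.tsum hmeas) hsum] with E hE
  refine ⟨(∑' x, ENNReal.ofReal (w x * u x E ^ 2)).toReal, fun x => ?_⟩
  rw [← ENNReal.ofReal_le_iff_le_toReal hE.ne]
  exact ENNReal.le_tsum x

end MulOperator

section Expansion

/-- The real and imaginary part of a coordinate, indexed by a boolean. -/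
def reImEval {I : Type} (c : Bool) (x : I) : lp (fun _ : I => ℂ) 2 →L[ℝ] ℝ :=
  (if c then Complex.reCLM else Complex.imCLM).comp
    ((lp.evalCLM ℂ (fun _ : I => ℂ) 2 x).restrictScalars ℝ)

theorem reImEval_true {I : Type} (x : I) (ψ : lp (fun _ : I => ℂ) 2) :
    reImEval true x ψ = (ψ x).re := rfl

theorem reImEval_false {I : Type} (x : I) (ψ : lp (fun _ : I => ℂ) 2) :
    reImEval false x ψ = (ψ x).im := rfl

theorem abs_reImEval_le {I : Type} (c : Bool) (x : I) (ψ : lp (fun _ : I => ℂ) 2) :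
    |reImEval c x ψ| ≤ ‖ψ‖ := by
  refine le_trans ?_ (lp.norm_apply_le_norm (by norm_num) ψ x)
  cases c
  · exact Complex.abs_im_le_norm _
  · exact Complex.abs_re_le_norm _

theorem eq_of_reImEval {I : Type} {φ ψ : lp (fun _ : I => ℂ) 2}
    (h : ∀ c x, reImEval c x φ = reImEval c x ψ) : φ = ψ :=
  lp.ext (funext fun x => Complex.ext (h true x) (h false x))

variable {I : Type} {J : Type*} [Fintype J]
  {A : lp (fun _ : I => ℂ) 2 →L[ℂ] lp (fun _ : I => ℂ) 2} {b : J → I → ℝ} {σ : J → I → I}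

theorem reImEval_apply_eq (hrow : ∀ ψ x, A ψ x = ∑ j, (b j x : ℂ) * ψ (σ j x)) (c : Bool) (x : I)
    (ψ : lp (fun _ : I => ℂ) 2) :
    reImEval c x (A ψ) = ∑ j, b j x * reImEval c (σ j x) ψ := by
  cases c
  · simp [reImEval_false, hrow, Complex.im_sum]
  · simp [reImEval_true, hrow, Complex.re_sum]

theorem countable_eigenvalues [Countable I] {H : lp (fun _ : I => ℂ) 2 →L[ℂ] lp (fun _ : I => ℂ) 2}
    (hH : IsSelfAdjoint H) :
    {E : ℝ | ∃ φ, φ ≠ 0 ∧ H φ = (E : ℂ) • φ}.Countable := by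
  classical
  set Λ := {E : ℝ | ∃ φ, φ ≠ 0 ∧ H φ = (E : ℂ) • φ}
  choose φ hφ0 hφ using fun E : Λ => E.2
  set e : Λ → lp (fun _ : I => ℂ) 2 := fun E => ((‖φ E‖ : ℂ)⁻¹) • φ E with he
  have hon : Orthonormal ℂ e := by
    refine ⟨fun E => ?_, fun E E' hne => ?_⟩
    · simp [he, norm_smul, hφ0]
    · have h1 : inner ℂ (H (φ E)) (φ E') = inner ℂ (φ E) (H (φ E')) :=
        hH.isSymmetric (φ E) (φ E')
      rw [hφ, hφ, inner_smul_left, inner_smul_right, Complex.conj_ofReal] at h1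
      have h2 : inner ℂ (φ E) (φ E') = 0 := by
        by_contra h3
        exact hne (Subtype.ext (Complex.ofReal_injective (mul_right_cancel₀ h3 h1)))
      simp [he, inner_smul_left, inner_smul_right, h2]
  have hcov : (Set.univ : Set Λ) ⊆ ⋃ x : I, {E | e E x ≠ 0} := by
    intro E _
    by_contra hc
    simp only [Set.mem_iUnion, not_exists] at hc
    have : e E = 0 := lp.ext (funext fun x => by_contra fun h => hc x h)
    exact hon.ne_zero E this
  have hcount : ∀ x : I, {E | e E x ≠ 0}.Countable := by
    intro x
    have := (hon.inner_products_summable (lp.single 2 x (1 : ℂ))).countable_support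
    refine this.mono fun E hE => ?_
    simp only [Function.mem_support]
    rw [lp.inner_single_right]
    simpa using hE
  have := (Set.countable_iUnion hcount).mono hcov
  rw [Set.countable_univ_iff] at this
  exact Set.countable_coe_iff.1 this

end Expansion

section CoordinateFunctions

variable {I : Type} {J : Type*} [Fintype J]
  {A : lp (fun _ : I => ℂ) 2 →L[ℂ] lp (fun _ : I => ℂ) 2} {b : J → I → ℝ} {σ : J → I → I}
  {X : Set ℝ} {μ : Measure X}
  (W : Lp ℝ 2 μ →L[ℝ] lp (fun _ : I => ℂ) 2)

/-- The function representing a coordinate of an isometry defined on an `L²` space. -/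
def coordFun (c : Bool) (x : I) : Lp ℝ 2 μ :=
  (InnerProductSpace.toDual ℝ (Lp ℝ 2 μ)).symm ((reImEval c x).comp W)

theorem inner_coordFun (c : Bool) (x : I) (h : Lp ℝ 2 μ) :
    inner ℝ (coordFun W c x) h = reImEval c x (W h) := by
  simp [coordFun]

variable {W}

theorem norm_coordFun_le (hW : ∀ h, ‖W h‖ = ‖h‖) (c : Bool) (x : I) :
    ‖coordFun W c x‖ ≤ 1 := by
  have h1 : ‖coordFun W c x‖ ^ 2 ≤ ‖coordFun W c x‖ := by
    rw [← real_inner_self_eq_norm_sq, inner_coordFun, ← hW (coordFun W c x)]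
    exact (le_abs_self _).trans (abs_reImEval_le c x _)
  nlinarith [norm_nonneg (coordFun W c x)]

variable [CompactSpace X] [IsFiniteMeasure μ]

theorem exists_mul_coordFun (hrow : ∀ ψ x, A ψ x = ∑ j, (b j x : ℂ) * ψ (σ j x))
    (hWA : ∀ g : C(X, ℝ),
      W (ContinuousMap.toLp (E := ℝ) 2 μ ℝ (ContinuousMap.restrict X (ContinuousMap.id ℝ) * g))
        = A (W (ContinuousMap.toLp (E := ℝ) 2 μ ℝ g))) (c : Bool) (x : I) :
    ((fun E => E.1 * coordFun W c x E) =ᵐ[μ] fun E => ∑ j, b j x * coordFun W c (σ j x) E) ∧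
    ∃ k : Lp ℝ 2 μ, (k =ᵐ[μ] fun E => E.1 * coordFun W c x E) ∧
      ∀ h, inner ℝ k h = reImEval c x (A (W h)) := by
  obtain ⟨k, hk, hki⟩ := exists_Lp_mul_id μ (coordFun W c x)
  have hinner : ∀ h, inner ℝ (∑ j, b j x • coordFun W c (σ j x)) h = reImEval c x (A (W h)) := by
    intro h
    rw [reImEval_apply_eq hrow, sum_inner]
    exact Finset.sum_congr rfl fun j _ => by rw [real_inner_smul_left, inner_coordFun]
  have hk2 : ∑ j, b j x • coordFun W c (σ j x) = k := by
    refine Lp_eq_of_inner_toLp μ fun g => ?_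
    rw [hinner, hki, inner_coordFun, hWA]
  refine ⟨?_, k, hk, fun h => by rw [← hk2, hinner]⟩
  have h1 : (k : X → ℝ) =ᵐ[μ] ∑ j, ⇑(b j x • coordFun W c (σ j x)) := by
    rw [← hk2]
    exact Lp.coeFn_finsetSum _ _
  have h2 : ∀ᵐ E ∂μ, ∀ j, (b j x • coordFun W c (σ j x)) E = b j x * coordFun W c (σ j x) E :=
    ae_all_iff.2 fun j => by
      filter_upwards [Lp.coeFn_smul (b j x) (coordFun W c (σ j x))] with E hE
      rw [hE]
      rfl
  filter_upwards [hk, h1, h2] with E e1 e2 e3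
  rw [← e1, e2, Finset.sum_apply]
  exact Finset.sum_congr rfl fun j _ => e3 j

theorem apply_indicator_singleton (hrow : ∀ ψ x, A ψ x = ∑ j, (b j x : ℂ) * ψ (σ j x))
    (hWA : ∀ g : C(X, ℝ),
      W (ContinuousMap.toLp (E := ℝ) 2 μ ℝ (ContinuousMap.restrict X (ContinuousMap.id ℝ) * g))
        = A (W (ContinuousMap.toLp (E := ℝ) 2 μ ℝ g))) (E₀ : X) :
    A (W (indicatorConstLp 2 (measurableSet_singleton E₀) (measure_ne_top μ _) (1 : ℝ)))
      = ((E₀ : ℝ) : ℂ) •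
        W (indicatorConstLp 2 (measurableSet_singleton E₀) (measure_ne_top μ _) (1 : ℝ)) := by
  set χ := indicatorConstLp (μ := μ) 2 (measurableSet_singleton E₀) (measure_ne_top μ _) (1 : ℝ)
  refine eq_of_reImEval fun c x => ?_
  obtain ⟨-, k, hk, hki⟩ := exists_mul_coordFun hrow hWA c x
  have h1 : reImEval c x (((E₀ : ℝ) : ℂ) • W χ) = (E₀ : ℝ) * reImEval c x (W χ) := by
    rw [Complex.coe_smul, map_smul, smul_eq_mul]
  rw [h1, ← hki, ← inner_coordFun, real_inner_comm, L2.inner_indicatorConstLp_one,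
    real_inner_comm, L2.inner_indicatorConstLp_one, ← integral_const_mul]
  refine (setIntegral_congr_ae (measurableSet_singleton E₀) ?_)
  filter_upwards [hk] with E hE hE0
  rw [hE, Set.mem_singleton_iff.1 hE0]

theorem inner_indicatorConstLp_toLp_one {Z : Set X} (hZ : MeasurableSet Z) :
    inner ℝ (indicatorConstLp (μ := μ) 2 hZ (measure_ne_top μ _) (1 : ℝ))
      (ContinuousMap.toLp (E := ℝ) 2 μ ℝ 1) = μ.real Z := by
  rw [L2.inner_indicatorConstLp_one]
  have h1 : ∫ E in Z, (ContinuousMap.toLp (E := ℝ) 2 μ ℝ 1) E ∂μ = ∫ _ in Z, (1 : ℝ) ∂μ := by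
    refine setIntegral_congr_ae hZ ?_
    filter_upwards [ContinuousMap.coeFn_toLp (p := 2) (𝕜 := ℝ) μ (1 : C(X, ℝ))] with E hE _
    rw [hE]
    rfl
  rw [h1]
  simp

variable [Countable I]

theorem ae_exists_coordFun_ne_zero (hW : ∀ h, ‖W h‖ = ‖h‖) :
    ∀ᵐ E ∂μ, ∃ c x, coordFun W c x E ≠ 0 := by
  set Z : Set X := {E | ∀ c x, coordFun W c x E = 0} with hZ
  have hZm : MeasurableSet Z := by
    rw [hZ, Set.ofPred_forall]
    refine MeasurableSet.iInter fun c => ?_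
    rw [Set.ofPred_forall]
    exact MeasurableSet.iInter fun x =>
      (Lp.stronglyMeasurable (coordFun W c x)).measurable (measurableSet_singleton 0)
  set χ := indicatorConstLp (μ := μ) 2 hZm (measure_ne_top μ _) (1 : ℝ) with hχ
  have h0 : W χ = 0 := by
    refine eq_of_reImEval fun c x => ?_
    rw [← inner_coordFun, map_zero, real_inner_comm, L2.inner_indicatorConstLp_one]
    exact setIntegral_eq_zero_of_forall_eq_zero fun E hE => hE c x
  have h1 : ‖χ‖ = 0 := by rw [← hW, h0, norm_zero]
  have h2 : μ.real Z = 0 := by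
    rw [← inner_indicatorConstLp_toLp_one hZm, ← hχ, norm_eq_zero.1 h1, inner_zero_left]
  rw [measureReal_eq_zero_iff] at h2
  refine (measure_eq_zero_iff_ae_notMem.1 h2).mono fun E hE => ?_
  have hE' : ¬ ∀ c x, coordFun W c x E = 0 := hE
  push Not at hE'
  exact hE'

end CoordinateFunctions

section RealSpectrum

variable {H : Type*} [NormedAddCommGroup H] [InnerProductSpace ℂ H] [CompleteSpace H]

theorem compactSpace_spectrum_real (A : H →L[ℂ] H) : CompactSpace (spectrum ℝ A) := inferInstance

theorem abs_le_norm_of_mem_spectrum {A : H →L[ℂ] H} {E : ℝ} (hE : E ∈ spectrum ℝ A) :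
    |E| ≤ ‖A‖ := by
  have h1 : (E : ℂ) ∈ spectrum ℂ A := spectrum.algebraMap_mem ℂ hE
  rcases subsingleton_or_nontrivial H with h | h
  · simp [spectrum.of_subsingleton] at h1
  · simpa using spectrum.norm_le_norm_of_mem h1

end RealSpectrum

section Completeness

variable {I : Type} [Countable I] {J : Type*} [Fintype J]
  {A : lp (fun _ : I => ℂ) 2 →L[ℂ] lp (fun _ : I => ℂ) 2} {b : J → I → ℝ} {σ : J → I → I}

/-- If every generalized eigenfunction of weighted polynomial growth with energy in `X` gives rise
to an eigenvalue, then a cyclic vector that is orthogonal to all eigenvectors vanishes. -/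
theorem cyclic_vector_eq_zero {X : Set ℝ} [CompactSpace X] {μ : Measure X} [IsFiniteMeasure μ]
    {W : Lp ℝ 2 μ →L[ℝ] lp (fun _ : I => ℂ) 2} (hA : IsSelfAdjoint A)
    (hrow : ∀ ψ x, A ψ x = ∑ j, (b j x : ℂ) * ψ (σ j x))
    {w : I → ℝ} (hw : ∀ x, 0 < w x) (hws : Summable w)
    (hloc : ∀ E : ℝ, E ∈ X → ∀ u : I → ℂ, (∃ x, u x ≠ 0) →
      (∀ x, ∑ j, (b j x : ℂ) * u (σ j x) = E * u x) → (∃ C, ∀ x, w x * ‖u x‖ ^ 2 ≤ C) →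
      ∃ φ, φ ≠ 0 ∧ A φ = (E : ℂ) • φ)
    {v : lp (fun _ : I => ℂ) 2}
    (hv : ∀ (E : ℝ) (φ : lp (fun _ : I => ℂ) 2), A φ = (E : ℂ) • φ → inner ℂ φ v = 0)
    (hW : ∀ h, ‖W h‖ = ‖h‖) (hWv : W (ContinuousMap.toLp (E := ℝ) 2 μ ℝ 1) = v)
    (hWA : ∀ g : C(X, ℝ),
      W (ContinuousMap.toLp (E := ℝ) 2 μ ℝ (ContinuousMap.restrict X (ContinuousMap.id ℝ) * g))
        = A (W (ContinuousMap.toLp (E := ℝ) 2 μ ℝ g))) : v = 0 := by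
  set Λ : Set X := {E | ∃ φ, φ ≠ 0 ∧ A φ = ((E : ℝ) : ℂ) • φ} with hΛ
  have hΛc : Λ.Countable :=
    (countable_eigenvalues hA).preimage Subtype.val_injective
  have hae : ∀ᵐ E ∂μ, E ∈ Λ := by
    have hrec : ∀ᵐ E ∂μ, ∀ c x,
        E.1 * coordFun W c x E = ∑ j, b j x * coordFun W c (σ j x) E :=
      ae_all_iff.2 fun c => ae_all_iff.2 fun x => (exists_mul_coordFun hrow hWA c x).1
    have hbd : ∀ᵐ E ∂μ, ∀ c, ∃ C, ∀ x, w x * coordFun W c x E ^ 2 ≤ C :=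
      ae_all_iff.2 fun c => ae_exists_forall_mul_sq_le μ hw hws fun x => norm_coordFun_le hW c x
    filter_upwards [hrec, hbd, ae_exists_coordFun_ne_zero hW] with E h1 h2 h3
    refine hloc E E.2 (fun x => ⟨coordFun W true x E, coordFun W false x E⟩) ?_ ?_ ?_
    · obtain ⟨c, x, hx⟩ := h3
      refine ⟨x, fun h => hx ?_⟩
      cases c
      · exact congrArg Complex.im h
      · exact congrArg Complex.re h
    · intro x
      refine Complex.ext ?_ ?_
      · simpa [Complex.re_sum] using (h1 true x).symm
      · simpa [Complex.im_sum] using (h1 false x).symm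
    · obtain ⟨C₁, hC₁⟩ := h2 true
      obtain ⟨C₂, hC₂⟩ := h2 false
      refine ⟨C₁ + C₂, fun x => ?_⟩
      rw [← Complex.normSq_eq_norm_sq, Complex.normSq_mk]
      linarith [hC₁ x, hC₂ x]
  by_contra hv0
  have hμ : μ Λ ≠ 0 := by
    intro h0
    have h1 : μ Set.univ = 0 := by
      rw [← measure_add_measure_compl hΛc.measurableSet, h0, zero_add]
      exact hae
    refine hv0 ?_
    have h2 : ContinuousMap.toLp (E := ℝ) 2 μ ℝ 1 = 0 :=
      Lp.ext (ae_iff.2 (measure_mono_null (Set.subset_univ _) h1))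
    rw [← hWv, h2, map_zero]
  obtain ⟨E₀, hE₀, hμE⟩ : ∃ E₀ ∈ Λ, μ {E₀} ≠ 0 := by
    by_contra! hcon
    refine hμ ?_
    rw [← Set.biUnion_of_singleton Λ]
    exact (measure_biUnion_null_iff hΛc).2 hcon
  set χ := indicatorConstLp (μ := μ) 2 (measurableSet_singleton E₀) (measure_ne_top μ _) (1 : ℝ)
  have h1 := hv E₀ (W χ) (apply_indicator_singleton hrow hWA E₀)
  have h2 : ‖W χ + v‖ * ‖W χ + v‖ = ‖W χ‖ * ‖W χ‖ + ‖v‖ * ‖v‖ :=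
    norm_add_sq_eq_norm_sq_add_norm_sq_of_inner_eq_zero _ _ h1
  rw [← hWv, ← map_add, hW, hW, hW] at h2
  have h3 := (norm_add_sq_eq_norm_sq_add_norm_sq_iff_real_inner_eq_zero _ _).1 h2
  rw [inner_indicatorConstLp_toLp_one, measureReal_eq_zero_iff] at h3
  exact hμE h3

/-- If every generalized eigenfunction of weighted polynomial growth gives rise to an eigenvalue,
then the eigenvectors are complete. -/
theorem eq_zero_of_forall_eigenvector_inner_eq_zero (hA : IsSelfAdjoint A)
    (hrow : ∀ ψ x, A ψ x = ∑ j, (b j x : ℂ) * ψ (σ j x))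
    {w : I → ℝ} (hw : ∀ x, 0 < w x) (hws : Summable w)
    (hloc : ∀ E : ℝ, |E| ≤ ‖A‖ → ∀ u : I → ℂ, (∃ x, u x ≠ 0) →
      (∀ x, ∑ j, (b j x : ℂ) * u (σ j x) = E * u x) → (∃ C, ∀ x, w x * ‖u x‖ ^ 2 ≤ C) →
      ∃ φ, φ ≠ 0 ∧ A φ = (E : ℂ) • φ)
    {v : lp (fun _ : I => ℂ) 2}
    (hv : ∀ (E : ℝ) (φ : lp (fun _ : I => ℂ) 2), A φ = (E : ℂ) • φ → inner ℂ φ v = 0) : v = 0 := by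
  have := compactSpace_spectrum_real A
  obtain ⟨W, hW, hWv, hWA⟩ := exists_cyclic_isometry hA v
  exact cyclic_vector_eq_zero hA hrow hw hws
    (fun E hE => hloc E (abs_le_norm_of_mem_spectrum hE)) hv hW hWv hWA

end Completeness

section WeightedPermutations

variable {I : Type}

theorem exists_weightedPerm (σ : Equiv.Perm I) {b : I → ℝ} {C : ℝ} (hC : 0 ≤ C)
    (hb : ∀ x, |b x| ≤ C) :
    ∃ T : lp (fun _ : I => ℂ) 2 →L[ℂ] lp (fun _ : I => ℂ) 2, ‖T‖ ≤ C ∧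
      ∀ ψ x, T ψ x = (b x : ℂ) * ψ (σ x) := by
  have hle : ∀ (ψ : lp (fun _ : I => ℂ) 2) x,
      ‖(b x : ℂ) * ψ (σ x)‖ ^ 2 ≤ C ^ 2 * ‖ψ (σ x)‖ ^ 2 := by
    intro ψ x
    rw [norm_mul, mul_pow, Complex.norm_real, Real.norm_eq_abs]
    have := hb x
    gcongr
  have hs : ∀ ψ : lp (fun _ : I => ℂ) 2, Summable fun x => ‖ψ x‖ ^ 2 := by
    intro ψ
    simpa using (memℓp_gen_iff (by norm_num)).1 (lp.memℓp ψ)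
  have hs2 : ∀ ψ : lp (fun _ : I => ℂ) 2, Summable fun x => C ^ 2 * ‖ψ (σ x)‖ ^ 2 := fun ψ =>
    ((σ.summable_iff (f := fun x => ‖ψ x‖ ^ 2)).2 (hs ψ)).mul_left _
  have hs3 : ∀ ψ : lp (fun _ : I => ℂ) 2, Summable fun x => ‖(b x : ℂ) * ψ (σ x)‖ ^ 2 := fun ψ =>
    Summable.of_nonneg_of_le (fun x => by positivity) (hle ψ) (hs2 ψ)
  have hm : ∀ ψ : lp (fun _ : I => ℂ) 2,
      Memℓp (E := fun _ : I => ℂ) (fun x => (b x : ℂ) * ψ (σ x)) 2 := fun ψ =>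
    (memℓp_gen_iff (by norm_num)).2 (by simpa using hs3 ψ)
  have hnorm : ∀ ψ : lp (fun _ : I => ℂ) 2, ‖ψ‖ ^ 2 = ∑' x, ‖ψ x‖ ^ 2 := by
    intro ψ
    simpa using lp.norm_rpow_eq_tsum (p := 2) (by norm_num) ψ
  refine ⟨LinearMap.mkContinuous
    { toFun := fun ψ => ⟨_, hm ψ⟩
      map_add' := fun ψ φ => lp.ext (funext fun x => ?_)
      map_smul' := fun z ψ => lp.ext (funext fun x => ?_) } C fun ψ => ?_,
    LinearMap.mkContinuous_norm_le _ hC _, fun ψ x => rfl⟩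
  · exact mul_add _ _ _
  · exact mul_left_comm _ _ _
  · refine le_of_sq_le_sq ?_ (by positivity)
    rw [hnorm, mul_pow, hnorm ψ, ← σ.tsum_eq fun x => ‖ψ x‖ ^ 2, ← tsum_mul_left]
    exact (hs3 ψ).tsum_le_tsum (hle ψ) (hs2 ψ)

theorem exists_selfAdjoint_sum_weightedPerm {J : Type*} [Fintype J] (σ : J → Equiv.Perm I)
    {b : J → I → ℝ} {C : J → ℝ} (hC : ∀ j, 0 ≤ C j) (hb : ∀ j x, |b j x| ≤ C j) (τ : J ≃ J)
    (hσ : ∀ j x, σ (τ j) (σ j x) = x) (hbτ : ∀ j x, b (τ j) (σ j x) = b j x) :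
    ∃ A : lp (fun _ : I => ℂ) 2 →L[ℂ] lp (fun _ : I => ℂ) 2, IsSelfAdjoint A ∧ ‖A‖ ≤ ∑ j, C j ∧
      ∀ ψ x, A ψ x = ∑ j, (b j x : ℂ) * ψ (σ j x) := by
  choose T hT hTa using fun j => exists_weightedPerm (σ j) (hC j) (hb j)
  have hadj : ∀ j φ ψ, inner ℂ (T j φ) ψ = inner ℂ φ (T (τ j) ψ) := by
    intro j φ ψ
    rw [lp.inner_eq_tsum, lp.inner_eq_tsum, ← (σ j).tsum_eq fun x => inner ℂ (φ x) (T (τ j) ψ x)]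
    refine tsum_congr fun x => ?_
    rw [hTa, hTa, hσ, hbτ]
    simp
    ring
  refine ⟨∑ j, T j, ?_, (norm_sum_le _ _).trans (Finset.sum_le_sum fun j _ => hT j), fun ψ x => ?_⟩
  · rw [ContinuousLinearMap.isSelfAdjoint_iff_isSymmetric]
    intro φ ψ
    simp only [ContinuousLinearMap.coe_coe, sum_apply, sum_inner, inner_sum,
      hadj]
    exact τ.sum_comp fun j => inner ℂ φ (T j ψ)
  · rw [sum_apply, lp.coeFn_sum, Finset.sum_apply]
    exact Finset.sum_congr rfl fun j _ => hTa j ψ x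

end WeightedPermutations

section StripOperator

variable {S : Type} [Fintype S] [MetricSpace S] [DecidableEq S]

/-- The permutations of the strip that realize the diagonal, the two shifts, and the hops between
two points of the fiber. -/
def stripPerm (S : Type) [DecidableEq S] : Option (Bool ⊕ S × S) → Equiv.Perm (ℤ × S)
  | none => Equiv.refl _
  | some (Sum.inl true) => (Equiv.addRight (1 : ℤ)).prodCongr (Equiv.refl S)
  | some (Sum.inl false) => (Equiv.subRight (1 : ℤ)).prodCongr (Equiv.refl S)
  | some (Sum.inr (a, b)) => (Equiv.refl ℤ).prodCongr (Equiv.swap a b)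

/-- The weights that accompany `stripPerm` in the strip operator with diagonal `V`. -/
def stripWeight (V : ℤ × S → ℝ) : Option (Bool ⊕ S × S) → ℤ × S → ℝ
  | none => V
  | some (Sum.inl _) => fun _ => 1
  | some (Sum.inr (a, b)) => fun x => if x.2 = a ∧ dist a b = 1 then 1 else 0

theorem sum_stripWeight_mul (V : ℤ × S → ℝ) (ψ : ℤ × S → ℂ) (n : ℤ) (s : S) :
    ∑ j, (stripWeight V j (n, s) : ℂ) * ψ (stripPerm S j (n, s))
      = ψ (n + 1, s) + ψ (n - 1, s) + (∑ s' : S, if dist s s' = 1 then ψ (n, s') else 0)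
        + (V (n, s) : ℂ) * ψ (n, s) := by
  have h1 : ∑ p : S × S, (stripWeight V (some (Sum.inr p)) (n, s) : ℂ)
      * ψ (stripPerm S (some (Sum.inr p)) (n, s))
      = ∑ s' : S, if dist s s' = 1 then ψ (n, s') else 0 := by
    rw [Fintype.sum_prod_type, Finset.sum_eq_single s]
    · refine Finset.sum_congr rfl fun s' _ => ?_
      by_cases h : dist s s' = 1 <;> simp [stripWeight, stripPerm, h]
    · intro a _ ha
      refine Finset.sum_eq_zero fun s' _ => ?_
      simp [stripWeight, ha.symm]
    · simp
  rw [Fintype.sum_option, Fintype.sum_sum_type, h1, Fintype.sum_bool]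
  simp [stripWeight, stripPerm]
  ring

theorem exists_stripOperator {V : ℤ × S → ℝ} {C : ℝ} (hC : 0 ≤ C) (hV : ∀ x, |V x| ≤ C) :
    ∃ A : lp (fun _ : ℤ × S => ℂ) 2 →L[ℂ] lp (fun _ : ℤ × S => ℂ) 2, IsSelfAdjoint A ∧
      ‖A‖ ≤ C + 2 + (Fintype.card S : ℝ) ^ 2 ∧
      ∀ ψ x, A ψ x = ∑ j, (stripWeight V j x : ℂ) * ψ (stripPerm S j x) := by
  have hC' : ∀ j : Option (Bool ⊕ S × S), 0 ≤ j.elim C fun _ => 1 := by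
    rintro (_ | j)
    · exact hC
    · exact zero_le_one
  have hb : ∀ j x, |stripWeight V j x| ≤ j.elim C fun _ => 1 := by
    rintro (_ | _ | ⟨a, b⟩) x
    · exact hV x
    · simp [stripWeight]
    · simp only [stripWeight, Option.elim]
      split_ifs <;> simp
  obtain ⟨A, h1, h2, h3⟩ := exists_selfAdjoint_sum_weightedPerm (stripPerm S) hC' hb
    (Equiv.optionCongr (Equiv.boolNot.sumCongr (Equiv.prodComm S S)))
    (by
      rintro (_ | (_ | _) | ⟨a, b⟩) ⟨n, s⟩
      · rfl
      · simp [stripPerm]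
      · simp [stripPerm]
      · simp [stripPerm, Equiv.swap_comm b a])
    (by
      rintro (_ | (_ | _) | ⟨a, b⟩) ⟨n, s⟩
      · rfl
      · rfl
      · rfl
      · simp [stripPerm, stripWeight, Equiv.swap_apply_eq_iff, dist_comm b a])
  refine ⟨A, h1, h2.trans_eq ?_, h3⟩
  simp [Fintype.sum_option, sq, add_assoc]

end StripOperator

section EigenBasis

theorem exists_hilbertBasis_eigenvectors {H : Type} [NormedAddCommGroup H] [InnerProductSpace ℂ H]
    [CompleteSpace H] {A : H →L[ℂ] H} (hA : IsSelfAdjoint A)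
    (hcomp : ∀ v : H, (∀ (E : ℝ) (φ : H), A φ = (E : ℂ) • φ → inner ℂ φ v = 0) → v = 0) :
    ∃ (ι : Type) (v : HilbertBasis ι ℂ H), ∀ i, ∃ E : ℝ, A (v i) = (E : ℂ) • v i := by
  set V : ℝ → Submodule ℂ H := fun E => (A - (E : ℂ) • ContinuousLinearMap.id ℂ H).ker with hV
  have hmem : ∀ E φ, φ ∈ V E ↔ A φ = (E : ℂ) • φ := by
    intro E φ
    simp [hV, sub_eq_zero]
  have hclosed : ∀ E, CompleteSpace (V E) := fun E =>
    (A - (E : ℂ) • ContinuousLinearMap.id ℂ H).isClosed_ker.completeSpace_coe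
  choose w B hB using fun E => exists_hilbertBasis ℂ (V E)
  have horth : OrthogonalFamily ℂ (fun E => V E) fun E => (V E).subtypeₗᵢ := by
    intro E E' hne φ φ'
    have h1 : inner ℂ (A φ) (φ' : H) = inner ℂ (φ : H) (A φ') := hA.isSymmetric _ _
    rw [(hmem E φ).1 φ.2, (hmem E' φ').1 φ'.2, inner_smul_left, inner_smul_right,
      Complex.conj_ofReal] at h1
    by_contra h3
    exact hne (Complex.ofReal_injective (mul_right_cancel₀ h3 h1))
  have hon : Orthonormal ℂ fun i : Σ E, w E => ((B i.1 i.2 : V i.1) : H) :=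
    horth.orthonormal_sigma_orthonormal fun E => (B E).orthonormal
  refine ⟨_, HilbertBasis.mkOfOrthogonalEqBot hon ?_, fun i => ⟨i.1, ?_⟩⟩
  · rw [Submodule.eq_bot_iff]
    intro v hv
    refine hcomp v fun E φ hφ => ?_
    have h1 := ((B E).hasSum_repr ⟨φ, (hmem E φ).2 hφ⟩).mapL
      ((innerSL ℂ v).comp (V E).subtypeL)
    have h2 : ∀ i, inner ℂ v ((B E i : V E) : H) = 0 := fun i =>
      (Submodule.mem_orthogonal' _ _).1 hv _ (Submodule.subset_span ⟨⟨E, i⟩, rfl⟩)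
    simp only [map_smul, ContinuousLinearMap.comp_apply, Submodule.subtypeL_apply,
      innerSL_apply_apply, h2, smul_zero] at h1
    exact inner_eq_zero_symm.1 (h1.unique hasSum_zero)
  · rw [HilbertBasis.coe_mkOfOrthogonalEqBot]
    exact (hmem _ _).1 (B i.1 i.2).2

end EigenBasis

theorem summable_strip_weight (S : Type) [Finite S] :
    Summable fun x : ℤ × S => ((1 + |(x.1 : ℝ)|) ^ 2)⁻¹ := by
  have h1 : Summable fun n : ℤ => ((1 + |(n : ℝ)|) ^ 2)⁻¹ := by
    refine Summable.of_nonneg_of_le (fun n => by positivity) (fun n => ?_)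
      ((Real.summable_one_div_int_add_rpow (1 / 2) 2).2 one_lt_two)
    have h0 : (n : ℝ) + 1 / 2 ≠ 0 := by
      intro h
      have h2 : ((2 * n + 1 : ℤ) : ℝ) = 0 := by push_cast; linarith
      have h3 : 2 * n + 1 = 0 := by exact_mod_cast h2
      omega
    have h4 : 0 < |(n : ℝ) + 1 / 2| := abs_pos.2 h0
    have h5 : |(n : ℝ) + 1 / 2| ≤ 1 + |(n : ℝ)| := by
      have := abs_add_le (n : ℝ) (1 / 2)
      rw [abs_of_pos (by norm_num : (0 : ℝ) < 1 / 2)] at this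
      linarith
    rw [Real.rpow_two, ← one_div]
    exact one_div_le_one_div_of_le (by positivity) (by gcongr)
  have h2 := h1.mul_of_nonneg (Summable.of_finite (f := fun _ : S => (1 : ℝ)))
    (fun n => by positivity) (fun _ => zero_le_one)
  simpa using h2

theorem memℓp_of_norm_le_exp {S : Type} [Finite S] {u : ℤ × S → ℂ} {C : ℝ}
    (hu : ∀ n s, ‖u (n, s)‖ ≤ C * Real.exp (-(1 / 16) * |(n : ℝ)|)) :
    Memℓp (E := fun _ : ℤ × S => ℂ) u 2 := by
  refine (memℓp_gen_iff (by norm_num)).2 ?_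
  simp only [ENNReal.toReal_ofNat, Real.rpow_ofNat]
  refine Summable.of_nonneg_of_le (fun x => by positivity) (fun x => ?_)
    ((summable_strip_weight S).mul_left ((16 * C) ^ 2))
  obtain ⟨n, s⟩ := x
  have hC : 0 ≤ C := by simpa using (norm_nonneg _).trans (hu 0 s)
  have h1 : (1 + |(n : ℝ)|) / 16 ≤ Real.exp (1 / 16 * |(n : ℝ)|) := by
    have := Real.add_one_le_exp (1 / 16 * |(n : ℝ)|)
    linarith
  have h2 : ‖u (n, s)‖ ≤ 16 * C * (1 + |(n : ℝ)|)⁻¹ := by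
    refine (hu n s).trans ?_
    rw [neg_mul, Real.exp_neg, mul_comm 16 C, mul_assoc]
    refine mul_le_mul_of_nonneg_left ?_ hC
    have h3 := inv_anti₀ (by positivity) h1
    rwa [inv_div, div_eq_mul_inv] at h3
  calc ‖u (n, s)‖ ^ 2 ≤ (16 * C * (1 + |(n : ℝ)|)⁻¹) ^ 2 := by gcongr
    _ = (16 * C) ^ 2 * ((1 + |(n : ℝ)|) ^ 2)⁻¹ := by rw [mul_pow, inv_pow]

theorem ae_of_ae_Ico_of_forall_add_int {p : ℝ → Prop}
    (h : ∀ᵐ ω : ℝ, ω ∈ Set.Ico (0 : ℝ) 1 → p ω) (hp : ∀ (ω : ℝ) (m : ℤ), p ω → p (ω + m)) :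
    ∀ᵐ ω : ℝ, p ω := by
  have h1 : ∀ᵐ ω : ℝ, ∀ m : ℤ, ω - m ∈ Set.Ico (0 : ℝ) 1 → p (ω - m) :=
    ae_all_iff.2 fun m =>
      (measurePreserving_sub_right volume (m : ℝ)).quasiMeasurePreserving.ae h
  filter_upwards [h1] with ω hω
  have h2 := hp _ ⌊ω⌋ (hω ⌊ω⌋ ⟨by linarith [Int.floor_le ω], by linarith [Int.lt_floor_add_one ω]⟩)
  rwa [sub_add_cancel] at h2

namespace StripPotential

variable {S : Type} [Fintype S] [MetricSpace S] [DecidableEq S] {P : StripPotential S}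

theorem f_add_int (s : S) (x : ℝ) (m : ℤ) : P.f s (x + m) = P.f s x := by
  have h1 : Function.Periodic (P.f s) 1 := fun y => by
    have := P.F_add_one s y
    rw [P.F_ofReal] at this
    have h2 := P.F_ofReal s (y + 1)
    push_cast at h2
    rw [this] at h2
    exact_mod_cast h2.symm
  simpa using h1.int_mul m x

theorem stripEigenEq_add_int {lam ω θ E : ℝ} {ψ : ℤ × S → ℂ} (m : ℤ)
    (h : StripEigenEq P.f lam ω θ ψ E) : StripEigenEq P.f lam (ω + m) θ ψ E := by
  intro n s
  have h1 : θ + (n : ℝ) * (ω + m) = θ + n * ω + (n * m : ℤ) := by push_cast; ring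
  rw [h1, f_add_int]
  exact h n s

theorem isGenEigenfunction_of_stripEigenEq {lam ω θ E X : ℝ} {u : ℤ × S → ℂ} (hX : 0 ≤ X)
    (h : StripEigenEq P.f lam ω θ u E) (hu : ∀ n s, ‖u (n, s)‖ ≤ X * (1 + |(n : ℝ)|)) :
    P.IsGenEigenfunction lam θ ω E X fun n s => u (n, s) where
  eq_zero n s := by
    have := h n s
    linear_combination this
  norm_le n := (pi_norm_le_iff_of_nonneg (by positivity)).2 (hu n)

theorem exists_hilbertBasis_of_nonresonant {lam C4 θ ω : ℝ} (hl : 1 ≤ lam)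
    (hl2 : (Fintype.card S : ℝ) ≤ lam) (hC4 : 1 ≤ C4)
    (hlam : P.IsLargeCoupling lam C4) (hcen : P.HasCenters lam C4)
    {g : ℕ → S → ℝ → ℝ} (hg : P.IsApprox g lam) {j : ℕ} (hω : Diophantine j ω)
    (hnr : ∀ᶠ ν : ℕ in atTop, NonresonantAt (g (8 * ν)) lam C4 θ ω (8 * ν) (2 * ν)) :
    ∃ (ι : Type) (v : HilbertBasis ι ℂ (lp (fun _ : ℤ × S => ℂ) 2)), ∀ i : ι,
      ∃ E : ℝ, StripEigenEq P.f lam ω θ (v i) E ∧ ExpDecayStrip (v i) := by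
  have hloc : ∀ (E : ℝ) (u : ℤ × S → ℂ) (X : ℝ), |E| ≤ lam * P.C1 → 0 ≤ X →
      StripEigenEq P.f lam ω θ u E → (∀ n s, ‖u (n, s)‖ ≤ X * (1 + |(n : ℝ)|)) →
      ∃ C : ℝ, 0 < C ∧ ∀ n s, ‖u (n, s)‖ ≤ C * Real.exp (-(1 / 16) * |(n : ℝ)|) := by
    intro E u X hE hX h hu
    obtain ⟨C, hC, hCu⟩ := (isGenEigenfunction_of_stripEigenEq hX h hu).exists_norm_le_exp hl hC4
      hlam hcen hE hg hω hnr
    exact ⟨C, hC, fun n s => (norm_le_pi_norm (fun s => u (n, s)) s).trans (hCu n)⟩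
  have hB := P.one_le_B
  obtain ⟨A, hA, hAn, hrow⟩ := exists_stripOperator (S := S)
    (V := fun x => lam * P.f x.2 (θ + (x.1 : ℝ) * ω)) (C := lam * P.B) (by positivity)
    (fun x => by
      rw [abs_mul, abs_of_nonneg (by linarith)]
      exact mul_le_mul_of_nonneg_left (P.abs_f_le _ _) (by linarith))
  have hAC : ‖A‖ ≤ lam * P.C1 := by
    refine hAn.trans ?_
    have hd : (0 : ℝ) ≤ Fintype.card S := Nat.cast_nonneg _
    rw [C1]
    nlinarith
  have heq : ∀ (u : ℤ × S → ℂ) (E : ℝ), (∀ x, ∑ j, (stripWeight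
      (fun x => lam * P.f x.2 (θ + (x.1 : ℝ) * ω)) j x : ℂ) * u (stripPerm S j x) = E * u x) ↔
      StripEigenEq P.f lam ω θ u E := by
    intro u E
    rw [Prod.forall]
    exact forall₂_congr fun n s => by rw [sum_stripWeight_mul]
  have heqA : ∀ (φ : lp (fun _ : ℤ × S => ℂ) 2) (E : ℝ), A φ = (E : ℂ) • φ ↔
      StripEigenEq P.f lam ω θ φ E := by
    intro φ E
    rw [← heq]
    constructor
    · intro h x
      rw [← hrow, h]
      rfl
    · intro h
      refine lp.ext (funext fun x => ?_)
      rw [hrow, h]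
      rfl
  obtain ⟨ι, v, hv⟩ := exists_hilbertBasis_eigenvectors hA fun v hv =>
    eq_zero_of_forall_eigenvector_inner_eq_zero (w := fun x => ((1 + |(x.1 : ℝ)|) ^ 2)⁻¹) hA hrow
      (fun x => by positivity) (summable_strip_weight S) (by
        intro E hE u hu0 hu ⟨D, hD⟩
        have hX : ∀ n s, ‖u (n, s)‖ ≤ √D * (1 + |(n : ℝ)|) := by
          intro n s
          have h1 := hD (n, s)
          rw [inv_mul_le_iff₀ (by positivity), mul_comm] at h1
          rw [← Real.sqrt_sq (by positivity : 0 ≤ 1 + |(n : ℝ)|), ← Real.sqrt_mul' _ (by positivity)]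
          exact Real.le_sqrt_of_sq_le h1
        obtain ⟨C, hC, hCu⟩ := hloc E u _ (hE.trans hAC) (Real.sqrt_nonneg D) ((heq u E).1 hu) hX
        refine ⟨⟨u, memℓp_of_norm_le_exp hCu⟩, ?_, (heqA _ E).2 ((heq u E).1 hu)⟩
        intro h
        obtain ⟨x, hx⟩ := hu0
        exact hx (congrArg (fun φ : lp (fun _ : ℤ × S => ℂ) 2 => φ x) h)) hv
  refine ⟨ι, v, fun i => ?_⟩
  obtain ⟨E, hE⟩ := hv i
  have hvE := (heqA _ E).1 hE
  have h1 : ‖v i‖ = 1 := v.orthonormal.1 i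
  have hEA : |E| ≤ lam * P.C1 := by
    refine le_trans ?_ hAC
    have := A.le_opNorm (v i)
    rwa [hE, norm_smul, h1, mul_one, mul_one, Complex.norm_real] at this
  obtain ⟨C, hC, hCu⟩ := hloc E (v i) 1 hEA zero_le_one hvE fun n s => by
    have := lp.norm_apply_le_norm (by norm_num) (v i) (n, s)
    rw [h1] at this
    linarith [abs_nonneg (n : ℝ)]
  exact ⟨E, hvE, C, hC, 1 / 16, by norm_num, hCu⟩

theorem exists_coupling (P : StripPotential S) :
    ∃ lam₀ : ℝ, ∀ lam : ℝ, lam₀ < lam → ∀ θ : ℝ, ∀ᵐ ω : ℝ ∂volume,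
      ∃ (ι : Type) (v : HilbertBasis ι ℂ (lp (fun _ : ℤ × S => ℂ) 2)), ∀ i : ι,
        ∃ E : ℝ, StripEigenEq P.f lam ω θ (v i) E ∧ ExpDecayStrip (v i) := by
  obtain ⟨C4, hC4, lam1, hlam1, hcen⟩ := P.exists_centers
  refine ⟨max lam1 (max (Fintype.card S)
    ((16 * Fintype.card S + 1) * (Real.exp 1 * (P.C2 ^ Fintype.card S * C4)) ^ 8)),
    fun lam hlam θ => ?_⟩
  simp only [max_lt_iff] at hlam
  obtain ⟨h1, h2, h3⟩ := hlam
  have hl : 1 ≤ lam := by linarith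
  have hlc : P.IsLargeCoupling lam C4 := h3.le.trans (by nlinarith)
  obtain ⟨g, b, hb, hg⟩ := P.exists_approx_seq hl
  refine ae_of_ae_Ico_of_forall_add_int ?_ ?_
  · filter_upwards [P.ae_eventually_nonresonantAt hl hC4 (hcen lam h1.le) hb hg θ] with ω hω hω1
    obtain ⟨j, -, hj, hnr⟩ := hω hω1
    exact exists_hilbertBasis_of_nonresonant hl h2.le hC4 hlc (hcen lam h1.le) hg hj hnr
  · rintro ω m ⟨ι, v, hv⟩
    refine ⟨ι, v, fun i => ?_⟩
    obtain ⟨E, hE, hdec⟩ := hv i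
    exact ⟨E, stripEigenEq_add_int m hE, hdec⟩

end StripPotential

/-- **Bourgain–Jitomirskaya** (strip): let `S₀` be a finite metric space and `f_s`, `s ∈ S₀`,
nonconstant real analytic 1-periodic functions.  Then there is `λ₀` such that for every
`λ > λ₀` and every phase `θ`, the operator `Δ + λ V` on `ℓ²(ℤ × S₀)` with
`V(n,s) = λ f_s(θ+nω)` exhibits Anderson localization (an orthonormal basis of eigenvectors
which decay exponentially in the `ℤ`-direction) for almost every frequency `ω`. -/
theorem anderson_localization_strip
    (S₀ : Type) [Fintype S₀] [MetricSpace S₀] (f : S₀ → ℝ → ℝ)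
    (hf_an : ∀ s, ∀ x, AnalyticAt ℝ (f s) x)
    (hf_per : ∀ s, ∀ x : ℝ, f s (x + 1) = f s x)
    (hf_nonconst : ∀ s, ∃ x y, f s x ≠ f s y) :
    ∃ lam₀ : ℝ, ∀ lam : ℝ, lam₀ < lam → ∀ θ : ℝ,
      ∀ᵐ ω : ℝ ∂volume,
        ∃ (ι : Type) (v : HilbertBasis ι ℂ (lp (fun _ : ℤ × S₀ => ℂ) 2)), ∀ i : ι,
          ∃ E : ℝ, StripEigenEq f lam ω θ (v i) E ∧ ExpDecayStrip (v i) := by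
  classical
  obtain ⟨ρ, hρ, B, hB, F, hFd, hFf, hFp, hFB⟩ :=
    exists_bounded_holomorphic_extension hf_an hf_per
  refine StripPotential.exists_coupling
    { f := f, F := F, ρ := ρ, B := B, ρ_pos := hρ, one_le_B := hB, differentiableOn := hFd
      F_ofReal := hFf, F_add_one := hFp, norm_F_le := hFB, nonconst := fun s e => ?_ }
  by_contra! hc
  obtain ⟨x, y, hxy⟩ := hf_nonconst s
  have h1 := (hc x).trans (hc y).symm
  rw [hFf, hFf] at h1
  exact hxy (Complex.ofReal_injective h1)
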